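/- Let (W,S) be a finite irreducible Coxeter system of rank n with Coxeter number h, and let m ≥ 1. Then the number MC^{(m)}(W) of maximal chains in the m-divisible noncrossing partition poset L^{(m)}_W satisfies |W| · MC^{(m)}(W) = n! · (m·h)ⁿ. -/

import Mathlib

open scoped BigOperators

section Defs

variable {G : Type*} [Group G]

/-- `t` is a reflection with respect to the generating set `S`:
a conjugate of an element of `S`. -/
def IsReflectionOf (S : Set G) (t : G) : Prop :=
  ∃ g : G, ∃ s ∈ S, t = g * s * g⁻¹

/-- The absolute length of `w`: the minimal length of a word in the
reflections (conjugates of elements of `S`) whose product is `w`. -/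
noncomputable def absLength (S : Set G) (w : G) : ℕ :=
  sInf {k | ∃ l : List G, (∀ t ∈ l, IsReflectionOf S t) ∧ l.length = k ∧ l.prod = w}

/-- The absolute order: `u ≤ v` iff `ℓ_T(u) + ℓ_T(u⁻¹v) = ℓ_T(v)`. -/
def absLe (S : Set G) (u v : G) : Prop :=
  absLength S u + absLength S (u⁻¹ * v) = absLength S v

/-- `c` is a Coxeter element with respect to the set `S` of simple reflections:
a product of all the elements of `S`, each occurring exactly once, in some order. -/
def IsCoxeterElementOf (S : Set G) (c : G) : Prop :=
  ∃ l : List G, l.Nodup ∧ (∀ x, x ∈ l ↔ x ∈ S) ∧ l.prod = c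

/-- The rank-selected multichain count `C_{(j₁,…,j_m)}(W)`: the number of multichains
`x₁ ≤ ⋯ ≤ x_{m-1}` in the interval `[1,c]` of the absolute order whose sequence of
rank jumps (prepending `1` and appending `c`) is given by `j`. -/
noncomputable def chainCount (S : Set G) (c : G) {m : ℕ} (j : Fin m → ℕ) : ℕ :=
  Nat.card {y : Fin (m + 1) → G //
    y 0 = 1 ∧ y (Fin.last m) = c ∧
    (∀ i, absLe S (y i) c) ∧
    (∀ i : Fin m, absLe S (y i.castSucc) (y i.succ)) ∧
    (∀ i : Fin m, absLength S (y i.succ) = absLength S (y i.castSucc) + j i)}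

end Defs

section Cox

variable {B : Type*} {W : Type*} [Group W] {M : CoxeterMatrix B}

/-- The set of simple reflections of a Coxeter system. -/
def simpleSet (cs : CoxeterSystem M W) : Set W := Set.range cs.simple

/-- A Coxeter system is irreducible if its set of simple reflections is nonempty and cannot
be partitioned into two nonempty subsets such that every simple reflection in one commutes
with every simple reflection in the other. -/
def IsIrreducibleCS (cs : CoxeterSystem M W) : Prop :=
  Nonempty B ∧
    ∀ A : Set B, (∀ a ∈ A, ∀ b ∈ Aᶜ, Commute (cs.simple a) (cs.simple b)) →
      A = ∅ ∨ A = Set.univ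

/-- The standard parabolic subgroup `W_⟨s⟩` generated by the simple reflections
other than `cs.simple s`. -/
def parabolic (cs : CoxeterSystem M W) (s : B) : Subgroup W :=
  Subgroup.closure (Set.range cs.simple \ {cs.simple s})

/-- The set of simple reflections of the parabolic subgroup `W_⟨s⟩`, viewed as
elements of that subgroup. -/
def parabolicGens (cs : CoxeterSystem M W) (s : B) : Set (parabolic cs s) :=
  {x | (x : W) ∈ Set.range cs.simple \ {cs.simple s}}

end Cox

section MDivisible

variable {G : Type*} [Group G]

/-- `δ = (δ₀, δ₁, …, δ_d)` is an element of the poset `L^{(d)}` of `d`-divisible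
noncrossing partitions (a delta sequence): each `δᵢ` lies in `[1,c]`, the product
`δ₀δ₁⋯δ_d` is `c`, and the absolute lengths of the `δᵢ` sum to `n`. -/
def IsMDivisibleNC (S : Set G) (c : G) (n d : ℕ) (δ : Fin (d + 1) → G) : Prop :=
  (∀ i, absLe S (δ i) c) ∧ (List.ofFn δ).prod = c ∧ (∑ i, absLength S (δ i)) = n

/-- The partial order on `d`-divisible noncrossing partitions:
`δ ≤ δ'` iff `δᵢ ≤ δ'ᵢ` in absolute order for all `i = 1, …, d`. -/
def mDivLe (S : Set G) {d : ℕ} (δ δ' : Fin (d + 1) → G) : Prop :=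
  ∀ i : Fin d, absLe S (δ i.succ) (δ' i.succ)

/-- The rank of a `d`-divisible noncrossing partition: `ℓ_T(δ₁) + ⋯ + ℓ_T(δ_d)`. -/
noncomputable def mDivRank (S : Set G) {d : ℕ} (δ : Fin (d + 1) → G) : ℕ :=
  ∑ i : Fin d, absLength S (δ i.succ)

/-- The rank-selected multichain count `C^{(d)}_{(j₁,…,j_m)}(W)`: the number of multichains
`x₁ ≤ ⋯ ≤ x_{m-1}` in the poset of `d`-divisible noncrossing partitions with
`rk(x₁) = j₁`, `rk(xᵢ) = rk(x_{i-1}) + jᵢ`, and `rk(x_{m-1}) = n − j_m`. -/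
noncomputable def mDivChainCount (S : Set G) (c : G) (n d : ℕ) {m : ℕ} (j : Fin m → ℕ) : ℕ :=
  Nat.card {x : Fin (m - 1) → (Fin (d + 1) → G) //
    (∀ t, IsMDivisibleNC S c n d (x t)) ∧
    (∀ (t : ℕ) (h1 : t + 1 < m - 1), mDivLe S (x ⟨t, by omega⟩) (x ⟨t + 1, h1⟩)) ∧
    (∀ h0 : 0 < m - 1, mDivRank S (x ⟨0, h0⟩) = j ⟨0, by omega⟩) ∧
    (∀ (t : ℕ) (h1 : t + 1 < m - 1),
      mDivRank S (x ⟨t + 1, h1⟩) = mDivRank S (x ⟨t, by omega⟩) + j ⟨t + 1, by omega⟩) ∧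
    (∀ h0 : 0 < m - 1, mDivRank S (x ⟨m - 2, by omega⟩) + j ⟨m - 1, by omega⟩ = n)}

/-- The number of maximal chains `x₀ < x₁ < ⋯ < x_n` (with `rk(xᵢ) = i` for all `i`)
in the poset of `d`-divisible noncrossing partitions. -/
noncomputable def mDivMaxChainCount (S : Set G) (c : G) (n d : ℕ) : ℕ :=
  Nat.card {x : Fin (n + 1) → (Fin (d + 1) → G) //
    (∀ t, IsMDivisibleNC S c n d (x t)) ∧
    (∀ t : Fin n, mDivLe S (x t.castSucc) (x t.succ)) ∧
    (∀ t : Fin (n + 1), mDivRank S (x t) = (t : ℕ))}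

end MDivisible

open scoped InnerProductSpace

set_option linter.unusedSectionVars false

open Polynomial.Chebyshev in
theorem real_S_eval_mul_sin (θ : ℝ) (n : ℤ) :
    (S ℝ n).eval (2 * Real.cos θ) * Real.sin θ = Real.sin ((n + 1) * θ) :=
  mod_cast S_two_mul_complex_cos θ n

open Polynomial.Chebyshev in
/-- The vanishing of the Chebyshev coefficients in the `m`-th power of a product of two
reflections whose mirrors meet at angle `π / m`. -/
theorem chebyshev_coeff_eq_zero (m : ℕ) (hm : 3 ≤ m) (t : ℝ)
    (ht : t = 2 * Real.cos (2 * Real.pi / m)) :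
    (S ℝ (((m : ℤ) - 2) / 2)).eval t *
        ((S ℝ (((m : ℤ) - 1) / 2)).eval t + (S ℝ (((m : ℤ) - 3) / 2)).eval t) = 0 ∧
      (S ℝ (((m : ℤ) - 1) / 2)).eval t *
        ((S ℝ ((m : ℤ) / 2)).eval t + (S ℝ (((m : ℤ) - 2) / 2)).eval t) = 0 := by
  set θ := 2 * Real.pi / m with hθ
  have hmpos : (0 : ℝ) < m := by positivity
  have hm3 : (3 : ℝ) ≤ m := by exact_mod_cast hm
  have hsin : Real.sin θ ≠ 0 := by
    apply ne_of_gt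
    apply Real.sin_pos_of_pos_of_lt_pi
    · positivity
    · rw [hθ, div_lt_iff₀ hmpos]
      nlinarith [Real.pi_pos]
  have key : ∀ n : ℤ, (S ℝ n).eval t = Real.sin ((n + 1) * θ) / Real.sin θ := by
    intro n
    rw [eq_div_iff hsin, ht, real_S_eval_mul_sin]
  rcases Nat.even_or_odd' m with ⟨p, hp | hp⟩
  · have h1 : ((m : ℤ) - 2) / 2 = p - 1 := by omega
    have h2 : ((m : ℤ) - 1) / 2 = p - 1 := by omega
    have h0 : (S ℝ ((p : ℤ) - 1)).eval t = 0 := by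
      rw [key]
      have : (((p : ℤ) - 1 : ℤ) + 1 : ℝ) * θ = Real.pi := by
        have hmp : (m : ℝ) = 2 * p := by exact_mod_cast hp
        rw [hθ, hmp]
        have : (p : ℝ) ≠ 0 := by
          rintro h
          rw [h] at hmp; linarith
        push_cast
        field_simp
        ring
      rw [this]; simp
    rw [h1, h2, h0]; simp
  · have h1 : ((m : ℤ) - 2) / 2 = p - 1 := by omega
    have h2 : ((m : ℤ) - 1) / 2 = p := by omega
    have h3 : ((m : ℤ) - 3) / 2 = p - 1 := by omega
    have h4 : (m : ℤ) / 2 = p := by omega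
    have h0 : (S ℝ (p : ℤ)).eval t + (S ℝ ((p : ℤ) - 1)).eval t = 0 := by
      rw [key, key, ← add_div]
      have hmp : (m : ℝ) = 2 * p + 1 := by exact_mod_cast hp
      have e : ((p : ℤ) + 1 : ℝ) * θ = 2 * Real.pi - (((p : ℤ) - 1 : ℤ) + 1 : ℝ) * θ := by
        have : (2 * p + 1 : ℝ) ≠ 0 := by positivity
        rw [hθ, hmp]
        push_cast
        field_simp
        ring
      rw [e, Real.sin_two_pi_sub]; simp
    rw [h1, h2, h3, h4, h0]; simp

section Tits

variable {B : Type*} [Fintype B] [DecidableEq B] {W : Type*} [Group W] {M : CoxeterMatrix B}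

/-- Entries of the (doubled) Tits form. -/
noncomputable def titsCoeff (M : CoxeterMatrix B) (i j : B) : ℝ := -2 * Real.cos (Real.pi / M i j)

theorem titsCoeff_self (M : CoxeterMatrix B) (i : B) : titsCoeff M i i = 2 := by
  simp [titsCoeff]

theorem titsCoeff_comm (M : CoxeterMatrix B) (i j : B) : titsCoeff M i j = titsCoeff M j i := by
  simp [titsCoeff, M.symmetric i j]

theorem titsCoeff_trichotomy (M : CoxeterMatrix B) {i j : B} (hij : i ≠ j) :
    (titsCoeff M i j = 0 ∧ M i j = 2) ∨ titsCoeff M i j ≤ -1 := by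
  rw [titsCoeff]
  have h1 := M.off_diagonal i j hij
  rcases Nat.lt_or_ge (M i j) 3 with h | h
  · have : M i j = 0 ∨ M i j = 2 := by
      have h1' : M i j ≠ 1 := h1
      omega
    rcases this with h | h
    · right; simp [h]
    · left; simp [h]
  · right
    have h3 : (3 : ℝ) ≤ M i j := by exact_mod_cast h
    have : Real.cos (Real.pi / 3) ≤ Real.cos (Real.pi / M i j) := by
      apply Real.cos_le_cos_of_nonneg_of_le_pi
      · positivity
      · linarith [Real.pi_pos]
      · gcongr
    rw [Real.cos_pi_div_three] at this
    linarith

/-- The coroot functional of a simple root. -/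
noncomputable def titsFunctional (M : CoxeterMatrix B) (i : B) : Module.Dual ℝ (B → ℝ) :=
  ∑ j, titsCoeff M i j • LinearMap.proj j

theorem titsFunctional_apply (M : CoxeterMatrix B) (i : B) (v : B → ℝ) :
    titsFunctional M i v = ∑ j, titsCoeff M i j * v j := by
  simp [titsFunctional]

theorem titsFunctional_single (M : CoxeterMatrix B) (i j : B) :
    titsFunctional M i (Pi.single j 1) = titsCoeff M i j := by
  simp [titsFunctional_apply, Pi.single_apply]

theorem titsFunctional_single_self (M : CoxeterMatrix B) (i : B) :
    titsFunctional M i (Pi.single i 1) = 2 := by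
  rw [titsFunctional_single, titsCoeff_self]

/-- The simple reflections of the geometric representation. -/
noncomputable def titsReflection (M : CoxeterMatrix B) (i : B) : (B → ℝ) ≃ₗ[ℝ] (B → ℝ) :=
  Module.reflection (titsFunctional_single_self M i)

theorem titsReflection_apply (M : CoxeterMatrix B) (i : B) (v : B → ℝ) :
    titsReflection M i v = v - titsFunctional M i v • Pi.single i 1 := by
  simp [titsReflection, Module.reflection_apply]

theorem titsReflection_liftable (M : CoxeterMatrix B) :
    M.IsLiftable (titsReflection M) := by
  intro i j
  by_cases hij : i = j
  · subst hij
    have : M i i = 1 := M.diagonal i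
    rw [this, pow_one]
    ext1 v
    exact Module.involutive_reflection (titsFunctional_single_self M i) v
  · ext1 v
    rw [titsReflection, titsReflection]
    have h1 : M i j ≠ 1 := M.off_diagonal i j hij
    have ht : titsFunctional M i (Pi.single j 1) * titsFunctional M j (Pi.single i 1) - 2 =
        2 * Real.cos (2 * (Real.pi / M i j)) := by
      rw [titsFunctional_single, titsFunctional_single, titsCoeff_comm M j i, titsCoeff,
        Real.cos_two_mul]
      ring
    rw [Module.reflection_mul_reflection_pow_apply _ _ _ _ _ ht.symm]
    rcases Nat.lt_or_ge (M i j) 3 with h | h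
    · have : M i j = 0 ∨ M i j = 2 := by omega
      rcases this with h | h
      · simp [h]
      · have h0 : titsCoeff M i j = 0 := by simp [titsCoeff, h]
        have h0' : titsCoeff M j i = 0 := by rw [titsCoeff_comm, h0]
        rw [titsFunctional_single, titsFunctional_single, h0, h0', h]
        have hc : Real.cos (2 * (Real.pi / (2 : ℕ))) = -1 := by
          rw [Nat.cast_ofNat, mul_div_cancel₀ _ (two_ne_zero), Real.cos_pi]
        rw [hc]
        norm_num
        abel
    · have := chebyshev_coeff_eq_zero (M i j) h (2 * Real.cos (2 * (Real.pi / M i j)))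
        (by congr 2; ring)
      rw [this.1, this.2]
      simp

/-- The geometric representation of a Coxeter group. -/
noncomputable def titsRep (cs : CoxeterSystem M W) : W →* ((B → ℝ) ≃ₗ[ℝ] (B → ℝ)) :=
  cs.lift ⟨titsReflection M, titsReflection_liftable M⟩

theorem titsRep_simple (cs : CoxeterSystem M W) (i : B) :
    titsRep cs (cs.simple i) = titsReflection M i :=
  cs.lift_apply_simple (titsReflection_liftable M) i

theorem titsRep_alternatingWord (cs : CoxeterSystem M W) (i j : B) (u : ℕ → ℝ)
    (h0 : u 0 = 0) (h1 : u 1 = 1)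
    (hu : ∀ k, u (k + 2) = -titsCoeff M i j * u (k + 1) - u k) (k : ℕ) :
    titsRep cs (cs.wordProd (CoxeterSystem.alternatingWord i j k)) (Pi.single i 1) =
      if Even k then u (k + 1) • Pi.single i 1 + u k • Pi.single j (1 : ℝ)
      else u k • Pi.single i 1 + u (k + 1) • Pi.single j 1 := by
  induction k with
  | zero => simp [CoxeterSystem.alternatingWord, h0, h1]
  | succ k ih =>
    rw [CoxeterSystem.alternatingWord_succ', CoxeterSystem.wordProd_cons, map_mul,
      LinearEquiv.mul_apply, ih]
    by_cases hk : Even k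
    · have hk' : ¬ Even (k + 1) := by simpa [Nat.even_add_one] using hk
      rw [if_pos hk, if_pos hk, if_neg hk', titsRep_simple, titsReflection_apply, map_add, map_smul,
        map_smul, titsFunctional_single, titsFunctional_single_self, hu, titsCoeff_comm M j i]
      simp only [smul_eq_mul]
      module
    · have hk' : Even (k + 1) := by simpa [Nat.even_add_one] using hk
      rw [if_neg hk, if_neg hk, if_pos hk', titsRep_simple, titsReflection_apply, map_add, map_smul,
        map_smul, titsFunctional_single_self, titsFunctional_single, hu]
      simp only [smul_eq_mul]
      module

/-- The solution of the recurrence `u (k+2) = 2 cos (π/m) u (k+1) - u k` with `u 0 = 0`,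
`u 1 = 1`. -/
noncomputable def sineQuotient (m k : ℕ) : ℝ :=
  if m = 0 then k else Real.sin (k * (Real.pi / m)) / Real.sin (Real.pi / m)

theorem sineQuotient_zero (m : ℕ) : sineQuotient m 0 = 0 := by simp [sineQuotient]

theorem sin_pi_div_pos {m : ℕ} (hm : 2 ≤ m) : 0 < Real.sin (Real.pi / m) := by
  have hm' : (2 : ℝ) ≤ m := by exact_mod_cast hm
  apply Real.sin_pos_of_pos_of_lt_pi
  · positivity
  · rw [div_lt_iff₀ (by linarith)]; nlinarith [Real.pi_pos]

theorem sineQuotient_one {m : ℕ} (hm : m ≠ 1) : sineQuotient m 1 = 1 := by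
  rw [sineQuotient]
  split_ifs with h
  · simp
  · have := sin_pi_div_pos (m := m) (by omega)
    rw [Nat.cast_one, one_mul]
    exact div_self this.ne'

theorem sineQuotient_add_two (m k : ℕ) :
    sineQuotient m (k + 2) =
      2 * Real.cos (Real.pi / m) * sineQuotient m (k + 1) - sineQuotient m k := by
  rw [sineQuotient, sineQuotient, sineQuotient]
  split_ifs with h
  · simp [h]; ring
  · rw [← mul_div_assoc (2 * Real.cos (Real.pi / m)), ← sub_div]
    congr 1
    set θ := Real.pi / m
    have e1 : ((k + 2 : ℕ) : ℝ) * θ = (k + 1 : ℕ) * θ + θ := by push_cast; ring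
    have e2 : (k : ℝ) * θ = (k + 1 : ℕ) * θ - θ := by push_cast; ring
    rw [e1, e2, Real.sin_add, Real.sin_sub]
    ring

theorem sineQuotient_nonneg {m k : ℕ} (hm : m ≠ 1) (hk : m ≠ 0 → k ≤ m) :
    0 ≤ sineQuotient m k := by
  rw [sineQuotient]
  split_ifs with h
  · positivity
  · apply div_nonneg _ (sin_pi_div_pos (by omega)).le
    have hm0 : (0 : ℝ) < m := by positivity
    have hk' : (k : ℝ) ≤ m := by exact_mod_cast hk h
    apply Real.sin_nonneg_of_nonneg_of_le_pi
    · positivity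
    · rw [mul_div_assoc', div_le_iff₀ hm0]; nlinarith [Real.pi_pos]

theorem exists_alternatingWord_append (i j : B) (m l : ℕ) :
    ∃ p : List B, p.length = l ∧
      CoxeterSystem.alternatingWord i j (m + l) = p ++ CoxeterSystem.alternatingWord i j m := by
  induction l with
  | zero => exact ⟨[], rfl, rfl⟩
  | succ l ih =>
    obtain ⟨p, hp, h⟩ := ih
    refine ⟨(if Even (m + l) then j else i) :: p, by simp [hp], ?_⟩
    rw [← add_assoc, CoxeterSystem.alternatingWord_succ', h]
    rfl

theorem alternatingWord_length_lt (cs : CoxeterSystem M W) (i j : B) (k : ℕ) (v : W)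
    (hlen : cs.length v + k = cs.length (v * cs.wordProd (CoxeterSystem.alternatingWord i j k)))
    (hi : cs.length (v * cs.wordProd (CoxeterSystem.alternatingWord i j k)) <
      cs.length (v * cs.wordProd (CoxeterSystem.alternatingWord i j k) * cs.simple i))
    (hM : M i j ≠ 0) : k < M i j := by
  by_contra! hk
  obtain ⟨l, rfl⟩ := Nat.exists_eq_add_of_le hk
  obtain ⟨p, hp, h⟩ := exists_alternatingWord_append i j (M i j) l
  have hb : cs.wordProd (CoxeterSystem.alternatingWord i j (M i j)) =
      cs.wordProd (CoxeterSystem.alternatingWord j i (M i j)) := by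
    have := cs.wordProd_braidWord_eq i j
    rwa [CoxeterSystem.braidWord, CoxeterSystem.braidWord, M.symmetric j i] at this
  obtain ⟨m', hm'⟩ := Nat.exists_eq_succ_of_ne_zero hM
  have e : v * cs.wordProd (CoxeterSystem.alternatingWord i j (M i j + l)) * cs.simple i =
      v * (cs.wordProd (p ++ CoxeterSystem.alternatingWord i j m')) := by
    rw [h, cs.wordProd_append, hb, hm', Nat.succ_eq_add_one, CoxeterSystem.alternatingWord_succ,
      cs.wordProd_concat, cs.wordProd_append]
    simp [mul_assoc]
  rw [e] at hi
  have h1 := cs.length_mul_le v (cs.wordProd (p ++ CoxeterSystem.alternatingWord i j m'))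
  have h2 := cs.length_wordProd_le (p ++ CoxeterSystem.alternatingWord i j m')
  rw [List.length_append, CoxeterSystem.length_alternatingWord, hp] at h2
  omega

/-- The basic positivity theorem for the geometric representation. -/
theorem titsRep_nonneg (cs : CoxeterSystem M W) (w : W) (i : B)
    (hw : cs.length w < cs.length (w * cs.simple i)) (r : B) :
    0 ≤ titsRep cs w (Pi.single i 1) r := by
  induction hn : cs.length w using Nat.strong_induction_on generalizing w i with
  | _ n ih =>
  by_cases h1 : w = 1
  · subst h1
    rw [map_one, LinearEquiv.coe_one, id]
    by_cases h : r = i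
    · subst h; simp
    · simp [h]
  obtain ⟨j, hj⟩ := cs.exists_rightDescent_of_ne_one h1
  have hij : i ≠ j := by
    rintro rfl
    rw [CoxeterSystem.IsRightDescent] at hj
    omega
  let P : ℕ → Prop := fun k => ∃ v, w = v * cs.wordProd (CoxeterSystem.alternatingWord i j k) ∧
    cs.length v + k = cs.length w
  have hP1 : P 1 := by
    refine ⟨w * cs.simple j, by simp [CoxeterSystem.alternatingWord], ?_⟩
    exact cs.isRightDescent_iff.1 hj
  have hbd : ∀ k, P k → k ≤ cs.length w := by
    rintro k ⟨v, -, h⟩; omega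
  classical
  have hPk : P (Nat.findGreatest P (cs.length w)) := Nat.findGreatest_spec (hbd 1 hP1) hP1
  have hmax : ∀ k, P k → k ≤ Nat.findGreatest P (cs.length w) := fun k hk =>
    Nat.le_findGreatest (hbd k hk) hk
  set k := Nat.findGreatest P (cs.length w)
  have hk1 : 1 ≤ k := hmax 1 hP1
  obtain ⟨v, hv, hvk⟩ := hPk
  have hnext : cs.length v < cs.length (v * cs.simple (if Even k then j else i)) := by
    by_contra! hcon
    have hlt : cs.IsRightDescent v (if Even k then j else i) :=
      lt_of_le_of_ne hcon (cs.length_mul_simple_ne _ _)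
    have := hmax (k + 1) ⟨v * cs.simple (if Even k then j else i), by
      rw [CoxeterSystem.alternatingWord_succ', cs.wordProd_cons, hv]
      simp only [mul_assoc, CoxeterSystem.simple_mul_simple_cancel_left], by
      have := cs.isRightDescent_iff.1 hlt
      omega⟩
    omega
  have hother : cs.length v < cs.length (v * cs.simple (if Even k then i else j)) := by
    by_contra! hcon
    have hlt : cs.IsRightDescent v (if Even k then i else j) :=
      lt_of_le_of_ne hcon (cs.length_mul_simple_ne _ _)
    obtain ⟨k', hk'⟩ : ∃ k', k = k' + 1 := ⟨k - 1, by omega⟩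
    have hpar : (if Even k then i else j) = if Even k' then j else i := by
      rw [hk']; by_cases h : Even k' <;> simp [Nat.even_add_one, h]
    have e : w = (v * cs.simple (if Even k then i else j)) *
        cs.wordProd (CoxeterSystem.alternatingWord i j k') := by
      rw [hv, hk', CoxeterSystem.alternatingWord_succ', cs.wordProd_cons, ← hk', hpar, mul_assoc]
    have h2 := cs.length_mul_le (v * cs.simple (if Even k then i else j))
      (cs.wordProd (CoxeterSystem.alternatingWord i j k'))
    rw [← e] at h2
    have h3 := cs.length_wordProd_le (CoxeterSystem.alternatingWord i j k')
    rw [CoxeterSystem.length_alternatingWord] at h3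
    have := cs.isRightDescent_iff.1 hlt
    omega
  have hvi : cs.length v < cs.length (v * cs.simple i) := by
    by_cases h : Even k
    · simpa [h] using hother
    · simpa [h] using hnext
  have hvj : cs.length v < cs.length (v * cs.simple j) := by
    by_cases h : Even k
    · simpa [h] using hnext
    · simpa [h] using hother
  have hposi := ih (cs.length v) (by omega) v i hvi rfl
  have hposj := ih (cs.length v) (by omega) v j hvj rfl
  have hM1 : M i j ≠ 1 := M.off_diagonal i j hij
  have hkM : M i j ≠ 0 → k + 1 ≤ M i j := fun h =>
    alternatingWord_length_lt cs i j k v (by rw [← hv, hvk]) (by rwa [← hv]) h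
  have hu0 : 0 ≤ sineQuotient (M i j) k := sineQuotient_nonneg hM1 fun h => by
    have := hkM h; omega
  have hu1 : 0 ≤ sineQuotient (M i j) (k + 1) := sineQuotient_nonneg hM1 hkM
  have hform := titsRep_alternatingWord cs i j (sineQuotient (M i j)) (sineQuotient_zero _)
    (sineQuotient_one hM1) (fun k => by rw [sineQuotient_add_two, titsCoeff]; ring) k
  rw [hv, map_mul, LinearEquiv.mul_apply, hform]
  split_ifs <;> rw [map_add, map_smul, map_smul, Pi.add_apply, Pi.smul_apply, Pi.smul_apply,
    smul_eq_mul, smul_eq_mul] <;> positivity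

theorem titsRep_nonpos (cs : CoxeterSystem M W) (w : W) (i : B)
    (hw : cs.length (w * cs.simple i) < cs.length w) (r : B) :
    titsRep cs w (Pi.single i 1) r ≤ 0 := by
  have h := titsRep_nonneg cs (w * cs.simple i) i (by simpa using hw) r
  rw [map_mul, LinearEquiv.mul_apply, titsRep_simple, titsReflection_apply,
    titsFunctional_single_self, two_smul, sub_add_cancel_left, map_neg] at h
  simpa using h

end Tits

/-- An orthogonal reflection representation of a finite Coxeter group on a Euclidean space whose
simple roots (normalised to have squared length `2`) form a basis. -/
structure ReflRep (B W V : Type*) [Group W] [NormedAddCommGroup V] [InnerProductSpace ℝ V] where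
  simple : B → W
  root : Module.Basis B ℝ V
  rep : W →* (V ≃ₗᵢ[ℝ] V)
  len : W → ℕ
  rep_simple : ∀ b v, rep (simple b) v = v - ⟪root b, v⟫_ℝ • root b
  inner_self : ∀ b, ⟪root b, root b⟫_ℝ = 2
  inner_trichotomy : ∀ a b, a ≠ b → ⟪root a, root b⟫_ℝ = 0 ∨ ⟪root a, root b⟫_ℝ ≤ -1
  closure_simple : Subgroup.closure (Set.range simple) = ⊤
  pos_or_neg : ∀ w b, (∀ r, 0 ≤ root.repr (rep w (root b)) r) ∨
    (∀ r, root.repr (rep w (root b)) r ≤ 0)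
  exists_descent : ∀ w, w ≠ 1 → ∃ b, ∀ r, root.repr (rep w (root b)) r ≤ 0
  len_lt : ∀ w b, (∀ r, root.repr (rep w (root b)) r ≤ 0) → len (w * simple b) < len w

section Construction

variable {B : Type*} [Fintype B] [DecidableEq B] {W : Type*} [Group W] [Fintype W]
  {M : CoxeterMatrix B}

/-- The isometric model of the `W`-averaged inner product: `x ↦ (w x)_w`. -/
noncomputable def averagingMap (cs : CoxeterSystem M W) :
    (B → ℝ) →ₗ[ℝ] EuclideanSpace ℝ (W × B) where
  toFun x := WithLp.toLp 2 fun p => titsRep cs p.1 x p.2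
  map_add' x y := by ext p; simp
  map_smul' r x := by ext p; simp

theorem averagingMap_apply (cs : CoxeterSystem M W) (x : B → ℝ) (p : W × B) :
    averagingMap cs x p = titsRep cs p.1 x p.2 := rfl

theorem averagingMap_injective (cs : CoxeterSystem M W) :
    Function.Injective (averagingMap cs) := by
  intro x y h
  ext b
  have := congrArg (fun z : EuclideanSpace ℝ (W × B) => z (1, b)) h
  simpa [averagingMap_apply] using this

theorem averagingMap_inner (cs : CoxeterSystem M W) (w : W) (x y : B → ℝ) :
    ⟪averagingMap cs (titsRep cs w x), averagingMap cs (titsRep cs w y)⟫_ℝ =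
      ⟪averagingMap cs x, averagingMap cs y⟫_ℝ := by
  simp only [PiLp.inner_apply, Fintype.sum_prod_type, averagingMap_apply]
  rw [← Equiv.sum_comp (Equiv.mulRight w)
    (fun u => ∑ b, ⟪titsRep cs u x b, titsRep cs u y b⟫_ℝ)]
  simp [map_mul]

theorem two_mul_averagingMap_inner_single (cs : CoxeterSystem M W) (i : B) (v : B → ℝ) :
    2 * ⟪averagingMap cs (Pi.single i 1), averagingMap cs v⟫_ℝ = titsFunctional M i v *
      ⟪averagingMap cs (Pi.single i 1), averagingMap cs (Pi.single i 1)⟫_ℝ := by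
  have h := averagingMap_inner cs (cs.simple i) (Pi.single i 1) v
  rw [titsRep_simple, titsReflection_apply, titsReflection_apply, titsFunctional_single_self,
    two_smul, sub_add_cancel_left, map_neg, map_sub, map_smul, inner_neg_left, inner_sub_right,
    inner_smul_right] at h
  linarith

theorem commute_of_titsCoeff_eq_zero (cs : CoxeterSystem M W) {i j : B}
    (h : titsCoeff M i j = 0) : Commute (cs.simple i) (cs.simple j) := by
  by_cases hij : i = j
  · subst hij; exact Commute.refl _
  rcases titsCoeff_trichotomy M hij with ⟨-, h2⟩ | h1
  · have := cs.simple_mul_simple_pow i j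
    rw [h2, pow_two] at this
    have h3 := eq_inv_of_mul_eq_one_left this
    rw [mul_inv_rev, cs.inv_simple, cs.inv_simple] at h3
    exact h3
  · linarith

theorem averagingMap_inner_self_eq (cs : CoxeterSystem M W) (hirr : IsIrreducibleCS cs) (i j : B) :
    ⟪averagingMap cs (Pi.single i 1), averagingMap cs (Pi.single i 1)⟫_ℝ =
      ⟪averagingMap cs (Pi.single j 1), averagingMap cs (Pi.single j 1)⟫_ℝ := by
  have key := hirr.2 {k | ⟪averagingMap cs (Pi.single k 1), averagingMap cs (Pi.single k 1)⟫_ℝ =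
      ⟪averagingMap cs (Pi.single j 1), averagingMap cs (Pi.single j 1)⟫_ℝ} (by
    intro a ha b hb
    apply commute_of_titsCoeff_eq_zero
    by_contra h0
    apply hb
    have h1 := two_mul_averagingMap_inner_single cs a (Pi.single b 1)
    have h2 := two_mul_averagingMap_inner_single cs b (Pi.single a 1)
    rw [titsFunctional_single] at h1 h2
    rw [real_inner_comm, h1, titsCoeff_comm M b a] at h2
    have := mul_left_cancel₀ h0 h2
    exact this.symm.trans ha)
  rcases key with h | h
  · exact absurd (show j ∈ (∅ : Set B) from h ▸ rfl) (Set.notMem_empty j)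
  · exact (show i ∈ _ from h ▸ Set.mem_univ i)

theorem exists_reflRep (cs : CoxeterSystem M W) (hirr : IsIrreducibleCS cs) :
    ∃ (V : Submodule ℝ (EuclideanSpace ℝ (W × B))) (R : ReflRep B W V),
      R.simple = cs.simple := by
  obtain ⟨i₀⟩ := hirr.1
  set e := ⟪averagingMap cs (Pi.single i₀ 1), averagingMap cs (Pi.single i₀ 1)⟫_ℝ with he
  have he_all : ∀ i, ⟪averagingMap cs (Pi.single i 1), averagingMap cs (Pi.single i 1)⟫_ℝ = e :=
    fun i => averagingMap_inner_self_eq cs hirr i i₀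
  have he_pos : 0 < e := by
    apply real_inner_self_pos.2
    intro h
    have := averagingMap_injective cs (h.trans (map_zero _).symm)
    have := congrFun this i₀
    simp at this
  set k := Real.sqrt (2 / e) with hk
  have hk2 : k * k = 2 / e := Real.mul_self_sqrt (by positivity)
  have hk0 : k ≠ 0 := by
    rw [hk]; positivity
  have hinj : Function.Injective (k • averagingMap cs) := by
    intro x y h
    exact averagingMap_injective cs (smul_right_injective _ hk0 h)
  let φ : (B → ℝ) ≃ₗ[ℝ] LinearMap.range (k • averagingMap cs) := LinearEquiv.ofInjective _ hinj
  have hφ : ∀ x y, ⟪φ x, φ y⟫_ℝ = 2 / e * ⟪averagingMap cs x, averagingMap cs y⟫_ℝ := by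
    intro x y
    change ⟪k • averagingMap cs x, k • averagingMap cs y⟫_ℝ = _
    rw [inner_smul_left, inner_smul_right, ← hk2]
    simp; ring
  have hφs : ∀ i y, ⟪φ (Pi.single i 1), φ y⟫_ℝ = titsFunctional M i y := by
    intro i y
    rw [hφ]
    have := two_mul_averagingMap_inner_single cs i y
    rw [he_all] at this
    field_simp
    linarith
  let rep : W →* (LinearMap.range (k • averagingMap cs) ≃ₗᵢ[ℝ]
      LinearMap.range (k • averagingMap cs)) :=
    { toFun := fun w => (φ.symm.trans ((titsRep cs w).trans φ)).isometryOfInner (by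
        intro x y
        obtain ⟨x, rfl⟩ := φ.surjective x
        obtain ⟨y, rfl⟩ := φ.surjective y
        simp only [LinearEquiv.trans_apply, LinearEquiv.symm_apply_apply]
        rw [hφ, hφ, averagingMap_inner])
      map_one' := by ext1 x; simp
      map_mul' := fun u v => by ext1 x; simp }
  have hrep : ∀ w x, rep w (φ x) = φ (titsRep cs w x) := by
    intro w x
    simp [rep]
  let root : Module.Basis B ℝ (LinearMap.range (k • averagingMap cs)) := (Pi.basisFun ℝ B).map φ
  have hroot : ∀ b, root b = φ (Pi.single b 1) := by
    intro b; simp [root]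
  have hrepr : ∀ x b, root.repr (φ x) b = x b := by
    intro x b; simp [root]
  have hneg : ∀ w b, (∀ r, root.repr (rep w (root b)) r ≤ 0) ↔
      cs.length (w * cs.simple b) < cs.length w := by
    intro w b
    constructor
    · intro h
      by_contra! hcon
      have hlt := lt_of_le_of_ne hcon (cs.length_mul_simple_ne w b).symm
      have h0 : titsRep cs w (Pi.single b 1) = 0 := by
        ext r
        apply le_antisymm _ (titsRep_nonneg cs w b hlt r)
        have := h r
        rwa [hroot, hrep, hrepr] at this
      rw [LinearEquiv.map_eq_zero_iff] at h0
      simpa using congrFun h0 b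
    · intro h r
      rw [hroot, hrep, hrepr]
      exact titsRep_nonpos cs w b h r
  refine ⟨_,
    { simple := cs.simple, root := root, rep := rep, len := cs.length,
      rep_simple := ?_, inner_self := ?_, inner_trichotomy := ?_, closure_simple := ?_,
      pos_or_neg := ?_, exists_descent := ?_, len_lt := ?_ }, rfl⟩
  · intro b v
    obtain ⟨v, rfl⟩ := φ.surjective v
    rw [hroot, hrep, hφs, titsRep_simple, titsReflection_apply, map_sub, map_smul]
  · intro b
    rw [hroot, hφs, titsFunctional_single_self]
  · intro a b hab
    rw [hroot, hroot, hφs, titsFunctional_single]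
    exact (titsCoeff_trichotomy M hab).imp And.left id
  · exact cs.subgroup_closure_range_simple
  · intro w b
    rcases lt_or_gt_of_ne (cs.length_mul_simple_ne w b) with h | h
    · exact Or.inr ((hneg w b).2 h)
    · left
      intro r
      rw [hroot, hrep, hrepr]
      exact titsRep_nonneg cs w b h r
  · intro w hw
    obtain ⟨b, hb⟩ := cs.exists_rightDescent_of_ne_one hw
    exact ⟨b, (hneg w b).2 hb⟩
  · intro w b h
    exact (hneg w b).1 h

end Construction

namespace ReflRep

variable {B W V : Type*} [Fintype B] [DecidableEq B] [Group W] [Fintype W]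
  [NormedAddCommGroup V] [InnerProductSpace ℝ V] (R : ReflRep B W V)

/-- Roots: the images of the simple roots under the group. -/
def IsRoot (v : V) : Prop := ∃ w b, v = R.rep w (R.root b)

/-- All coordinates in the basis of simple roots are nonnegative. -/
def Nonneg (v : V) : Prop := ∀ r, 0 ≤ R.root.repr v r

/-- The span of the simple roots indexed by `J`. -/
def span (J : Finset B) : Submodule ℝ V :=
  Submodule.span ℝ (Set.image R.root J)

/-- The standard parabolic subgroup generated by the simple reflections indexed by `J`. -/
def sub (J : Finset B) : Subgroup W := Subgroup.closure (R.simple '' J)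

theorem finiteDimensional (R : ReflRep B W V) : FiniteDimensional ℝ V := Module.Finite.of_basis R.root

theorem mem_span_iff {J : Finset B} {v : V} : v ∈ R.span J ↔ ∀ j ∉ J, R.root.repr v j = 0 := by
  rw [span, Module.Basis.mem_span_image]
  constructor
  · intro h j hj
    by_contra h0
    exact hj (h (by simpa using h0))
  · intro h j hj
    by_contra h0
    exact (by simpa using hj : R.root.repr v j ≠ 0) (h j h0)

theorem root_mem_span {J : Finset B} {j : B} (hj : j ∈ J) : R.root j ∈ R.span J :=
  Submodule.subset_span ⟨j, hj, rfl⟩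

theorem span_mono {J K : Finset B} (h : J ⊆ K) : R.span J ≤ R.span K :=
  Submodule.span_mono (Set.image_mono (by exact_mod_cast h))

theorem simple_mem_sub {J : Finset B} {j : B} (hj : j ∈ J) : R.simple j ∈ R.sub J :=
  Subgroup.subset_closure ⟨j, hj, rfl⟩

theorem sub_mono {J K : Finset B} (h : J ⊆ K) : R.sub J ≤ R.sub K :=
  Subgroup.closure_mono (Set.image_mono (by exact_mod_cast h))

theorem sub_univ : R.sub Finset.univ = ⊤ := by
  simpa [sub] using R.closure_simple

theorem sub_empty : R.sub ∅ = ⊥ := by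
  simp [sub]

theorem span_univ : R.span Finset.univ = ⊤ := by
  simp [span]

theorem finrank_span (J : Finset B) : Module.finrank ℝ (R.span J) = J.card := by
  have h := finrank_span_eq_card (R := ℝ) (b := fun j : J => R.root j)
    (R.root.linearIndependent.comp _ Subtype.val_injective)
  rw [Fintype.card_coe] at h
  rw [← h, span, show R.root '' (J : Set B) = Set.range fun j : J => R.root j by ext v; simp]

theorem repr_eq_sum (v : V) : v = ∑ b, R.root.repr v b • R.root b := (R.root.sum_repr v).symm

theorem eq_sum_of_mem_span {J : Finset B} {v : V} (hv : v ∈ R.span J) :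
    v = ∑ b ∈ J, R.root.repr v b • R.root b := by
  conv_lhs => rw [R.repr_eq_sum v]
  symm
  apply Finset.sum_subset (Finset.subset_univ _)
  intro j _ hj
  rw [R.mem_span_iff.1 hv j hj, zero_smul]

theorem rep_mul (u w : W) (v : V) : R.rep (u * w) v = R.rep u (R.rep w v) := by
  rw [map_mul]; rfl

theorem rep_one (v : V) : R.rep 1 v = v := by
  rw [map_one]; rfl

theorem rep_inv_rep (w : W) (v : V) : R.rep w⁻¹ (R.rep w v) = v := by
  rw [← rep_mul, inv_mul_cancel, rep_one]

theorem rep_rep_inv (w : W) (v : V) : R.rep w (R.rep w⁻¹ v) = v := by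
  rw [← rep_mul, mul_inv_cancel, rep_one]

theorem inner_rep (w : W) (u v : V) : ⟪R.rep w u, R.rep w v⟫_ℝ = ⟪u, v⟫_ℝ :=
  (R.rep w).inner_map_map u v

theorem inner_rep_left (w : W) (u v : V) : ⟪R.rep w u, v⟫_ℝ = ⟪u, R.rep w⁻¹ v⟫_ℝ := by
  rw [← R.inner_rep w u, rep_rep_inv]

theorem eq_one_of_rep {w : W} (h : ∀ v, R.rep w v = v) : w = 1 := by
  by_contra hw
  obtain ⟨b, hb⟩ := R.exists_descent w hw
  have := hb b
  rw [h] at this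
  simp at this
  linarith

theorem ext_rep {u w : W} (h : ∀ v, R.rep u v = R.rep w v) : u = w := by
  have : w⁻¹ * u = 1 := R.eq_one_of_rep fun v => by rw [rep_mul, h, rep_inv_rep]
  exact (inv_mul_eq_one.1 this).symm

theorem rep_simple_self (b : B) : R.rep (R.simple b) (R.root b) = -R.root b := by
  rw [R.rep_simple, R.inner_self, two_smul]; abel

theorem rep_simple_simple (b : B) (v : V) : R.rep (R.simple b) (R.rep (R.simple b) v) = v := by
  simp only [R.rep_simple, inner_sub_right, inner_smul_right, R.inner_self]
  module

theorem simple_mul_simple (b : B) : R.simple b * R.simple b = 1 :=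
  R.eq_one_of_rep fun v => by rw [rep_mul, rep_simple_simple]

theorem simple_inv (b : B) : (R.simple b)⁻¹ = R.simple b :=
  inv_eq_of_mul_eq_one_left (R.simple_mul_simple b)

theorem isRoot_root (b : B) : R.IsRoot (R.root b) := ⟨1, b, (R.rep_one _).symm⟩

variable {R}

theorem IsRoot.rep {v : V} (h : R.IsRoot v) (w : W) : R.IsRoot (R.rep w v) := by
  obtain ⟨u, b, rfl⟩ := h
  exact ⟨w * u, b, (R.rep_mul w u _).symm⟩

theorem IsRoot.neg {v : V} (h : R.IsRoot v) : R.IsRoot (-v) := by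
  obtain ⟨u, b, rfl⟩ := h
  exact ⟨u * R.simple b, b, by rw [R.rep_mul, rep_simple_self, map_neg]⟩

theorem IsRoot.inner_self {v : V} (h : R.IsRoot v) : ⟪v, v⟫_ℝ = 2 := by
  obtain ⟨u, b, rfl⟩ := h
  rw [R.inner_rep, R.inner_self]

theorem IsRoot.ne_zero {v : V} (h : R.IsRoot v) : v ≠ 0 := by
  rintro rfl
  have := h.inner_self
  simp at this

theorem IsRoot.nonneg_or {v : V} (h : R.IsRoot v) : R.Nonneg v ∨ R.Nonneg (-v) := by
  obtain ⟨u, b, rfl⟩ := h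
  rcases R.pos_or_neg u b with h | h
  · exact Or.inl h
  · right
    intro r
    have := h r
    simpa using this

/-- A positive root proportional to a simple root is that simple root. -/
theorem IsRoot.eq_root {v : V} (h : R.IsRoot v) {a : B} (ha : v ∈ R.span {a}) (hn : R.Nonneg v) :
    v = R.root a := by
  have h1 := R.eq_sum_of_mem_span ha
  rw [Finset.sum_singleton] at h1
  have h2 := h.inner_self
  have h3 := hn a
  set x := R.root.repr v a
  rw [h1, inner_smul_left, inner_smul_right, R.inner_self] at h2
  simp at h2
  have : x = 1 := by nlinarith
  rw [h1, this, one_smul]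

variable (R)

theorem repr_rep_simple (a : B) (v : V) (r : B) (h : r ≠ a) :
    R.root.repr (R.rep (R.simple a) v) r = R.root.repr v r := by
  rw [R.rep_simple]
  simp [h.symm]

variable {R}

theorem IsRoot.nonneg_rep_simple {v : V} (h : R.IsRoot v) (hn : R.Nonneg v) {a : B}
    (ha : v ≠ R.root a) : R.Nonneg (R.rep (R.simple a) v) := by
  rcases (h.rep (R.simple a)).nonneg_or with h1 | h1
  · exact h1
  · exfalso
    apply ha
    apply h.eq_root _ hn
    rw [mem_span_iff]
    intro j hj
    have hj : j ≠ a := by simpa using hj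
    have := h1 j
    rw [map_neg, Finsupp.neg_apply, R.repr_rep_simple a v j hj] at this
    linarith [hn j]

variable (R)

/-- Elements of a parabolic subgroup act trivially modulo the span of its simple roots. -/
theorem rep_sub_self_mem {J : Finset B} {w : W} (hw : w ∈ R.sub J) (v : V) :
    R.rep w v - v ∈ R.span J := by
  induction hw using Subgroup.closure_induction generalizing v with
  | mem x hx =>
    obtain ⟨j, hj, rfl⟩ := hx
    rw [R.rep_simple, sub_sub_cancel_left]
    exact neg_mem (Submodule.smul_mem _ _ (R.root_mem_span hj))
  | one => simp
  | mul x y _ _ hx hy =>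
    have := add_mem (hx (R.rep y v)) (hy v)
    rw [rep_mul]
    simpa using this
  | inv x _ hx =>
    have := neg_mem (hx (R.rep x⁻¹ v))
    rw [rep_rep_inv] at this
    simpa using this

theorem rep_mem_span {J : Finset B} {w : W} (hw : w ∈ R.sub J) {v : V} (hv : v ∈ R.span J) :
    R.rep w v ∈ R.span J := by
  have := add_mem (R.rep_sub_self_mem hw v) hv
  simpa using this

theorem exists_descent_mem {J : Finset B} {w : W} (hw : w ∈ R.sub J) (h1 : w ≠ 1) :
    ∃ b ∈ J, (∀ r, R.root.repr (R.rep w (R.root b)) r ≤ 0) ∧ R.len (w * R.simple b) < R.len w := by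
  obtain ⟨b, hb⟩ := R.exists_descent w h1
  refine ⟨b, ?_, hb, R.len_lt w b hb⟩
  by_contra hbJ
  have := R.mem_span_iff.1 (R.rep_sub_self_mem hw (R.root b)) b hbJ
  have h2 := hb b
  simp at this
  linarith

/-- Elements fixed by all simple reflections of `J` are fixed by the parabolic subgroup. -/
theorem rep_eq_of_inner_eq_zero {J : Finset B} {v : V} (h : ∀ j ∈ J, ⟪R.root j, v⟫_ℝ = 0) {w : W}
    (hw : w ∈ R.sub J) : R.rep w v = v := by
  induction hw using Subgroup.closure_induction with
  | mem x hx =>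
    obtain ⟨j, hj, rfl⟩ := hx
    rw [R.rep_simple, h j hj]; simp
  | one => exact R.rep_one v
  | mul x y _ _ hx hy => rw [rep_mul, hy, hx]
  | inv x _ hx =>
    conv_lhs => rw [← hx]
    rw [rep_inv_rep]

/-- Nonnegative inner products with the simple roots in `J`. -/
def Dominant (J : Finset B) (v : V) : Prop := ∀ j ∈ J, 0 ≤ ⟪R.root j, v⟫_ℝ

variable {R} in
theorem Dominant.inner_nonneg {J : Finset B} {v u : V} (h : R.Dominant J v) (hu : u ∈ R.span J)
    (hn : R.Nonneg u) : 0 ≤ ⟪u, v⟫_ℝ := by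
  rw [R.eq_sum_of_mem_span hu, sum_inner]
  refine Finset.sum_nonneg fun j hj => ?_
  rw [inner_smul_left]
  exact mul_nonneg (hn j) (h j hj)

theorem mem_sub_of_dominant {J : Finset B} {v : V} {w : W} (hw : w ∈ R.sub J)
    (hv : R.Dominant J v) (hwv : R.Dominant J (R.rep w v)) :
    w ∈ R.sub (J.filter fun j => ⟪R.root j, v⟫_ℝ = 0) := by
  induction hn : R.len w using Nat.strong_induction_on generalizing w with
  | _ n ih =>
    by_cases h1 : w = 1
    · rw [h1]; exact one_mem _
    obtain ⟨b, hbJ, hb, hlen⟩ := R.exists_descent_mem hw h1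
    have hb0 : ⟪R.root b, v⟫_ℝ = 0 := by
      apply le_antisymm _ (hv b hbJ)
      have := hwv.inner_nonneg (u := -R.rep w (R.root b))
        (neg_mem (R.rep_mem_span hw (R.root_mem_span hbJ))) (fun r => by simpa using hb r)
      rw [inner_neg_left, R.inner_rep] at this
      linarith
    have hb1 : R.simple b ∈ R.sub (J.filter fun j => ⟪R.root j, v⟫_ℝ = 0) :=
      R.simple_mem_sub (by simp [hbJ, hb0])
    have := ih _ (hn ▸ hlen) (mul_mem hw (R.simple_mem_sub hbJ)) (by
      rw [rep_mul, R.rep_simple, hb0, zero_smul, sub_zero]; exact hwv) rfl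
    exact (mul_mem_cancel_right hb1).1 this

theorem exists_inner_eq (f : B → ℝ) : ∃ v, ∀ b, ⟪R.root b, v⟫_ℝ = f b := by
  have := R.finiteDimensional
  have : CompleteSpace V := FiniteDimensional.complete ℝ V
  refine ⟨(InnerProductSpace.toDual ℝ V).symm
    (LinearMap.toContinuousLinearMap (R.root.constr ℝ f)), fun b => ?_⟩
  rw [real_inner_comm, InnerProductSpace.toDual_symm_apply]
  simp

theorem exists_mem_span_inner_eq (J : Finset B) (f : B → ℝ) :
    ∃ v ∈ R.span J, ∀ b ∈ J, ⟪R.root b, v⟫_ℝ = f b := by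
  have := R.finiteDimensional
  obtain ⟨v, hv⟩ := R.exists_inner_eq f
  refine ⟨(R.span J).starProjection v, Submodule.starProjection_apply_mem _ _, fun b hb => ?_⟩
  have := Submodule.starProjection_inner_eq_zero (K := R.span J) v _ (R.root_mem_span hb)
  rw [inner_sub_left, sub_eq_zero] at this
  rw [real_inner_comm, ← this, real_inner_comm, hv]

theorem inner_eq_zero_of_mem_span {J : Finset B} {v : V} (h : ∀ j ∈ J, ⟪R.root j, v⟫_ℝ = 0)
    {u : V} (hu : u ∈ R.span J) : ⟪u, v⟫_ℝ = 0 := by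
  rw [R.eq_sum_of_mem_span hu, sum_inner]
  exact Finset.sum_eq_zero fun j hj => by rw [inner_smul_left, h j hj, mul_zero]

theorem eq_of_inner_eq {J : Finset B} {u v : V} (hu : u ∈ R.span J) (hv : v ∈ R.span J)
    (h : ∀ j ∈ J, ⟪R.root j, u⟫_ℝ = ⟪R.root j, v⟫_ℝ) : u = v := by
  rw [← sub_eq_zero, ← inner_self_eq_zero (𝕜 := ℝ)]
  apply R.inner_eq_zero_of_mem_span (J := J) _ (sub_mem hu hv)
  intro j hj
  rw [inner_sub_right, h j hj, sub_self]

theorem exists_dominant (J : Finset B) (v : V) : ∃ w ∈ R.sub J, R.Dominant J (R.rep w v) := by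
  obtain ⟨ρ, hρ⟩ := R.exists_inner_eq 1
  classical
  obtain ⟨w, hwJ, hw⟩ := Finset.exists_max_image (Finset.univ.filter fun w : W => w ∈ R.sub J)
    (fun w => ⟪R.rep w v, ρ⟫_ℝ) ⟨1, by simp⟩
  simp only [Finset.mem_filter, Finset.mem_univ, true_and] at hwJ hw
  refine ⟨w, hwJ, fun j hj => ?_⟩
  by_contra! hneg
  have := hw (R.simple j * w) (mul_mem (R.simple_mem_sub hj) hwJ)
  simp only [rep_mul, R.rep_simple, inner_sub_left, inner_smul_left, hρ] at this
  simp at this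
  linarith

theorem root_inj {a b : B} (h : R.root a = R.root b) : a = b := R.root.injective h

/-- Roots in the span of `J` are conjugate to simple roots in `J`. -/
theorem exists_rep_root_of_mem_span {J : Finset B} {v : V} (h : R.IsRoot v) (hv : v ∈ R.span J) :
    ∃ w ∈ R.sub J, ∃ j ∈ J, v = R.rep w (R.root j) := by
  wlog hn : R.Nonneg v generalizing v
  · obtain ⟨w, hw, j, hj, h1⟩ := this h.neg (neg_mem hv) (h.nonneg_or.resolve_left hn)
    refine ⟨w * R.simple j, mul_mem hw (R.simple_mem_sub hj), j, hj, ?_⟩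
    rw [rep_mul, rep_simple_self, map_neg, ← h1, neg_neg]
  classical
  obtain ⟨ρ, hρ⟩ := R.exists_inner_eq 1
  obtain ⟨w, hw1, hw⟩ := Finset.exists_min_image
    (Finset.univ.filter fun w : W => w ∈ R.sub J ∧ R.Nonneg (R.rep w v))
    (fun w => ⟪R.rep w v, ρ⟫_ℝ) ⟨1, by simpa using hn⟩
  simp only [Finset.mem_filter, Finset.mem_univ, true_and] at hw1 hw
  obtain ⟨hwJ, hw1⟩ := hw1
  set u := R.rep w v with hu
  have huJ : u ∈ R.span J := R.rep_mem_span hwJ hv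
  have hur : R.IsRoot u := h.rep _
  obtain ⟨j, hj, hpos⟩ : ∃ j ∈ J, 0 < ⟪R.root j, u⟫_ℝ := by
    by_contra! hcon
    have h2 := hur.inner_self
    have : R.Dominant J (-u) := fun j hj => by
      rw [inner_neg_right]; linarith [hcon j hj]
    have := this.inner_nonneg huJ hw1
    rw [inner_neg_right, h2] at this
    linarith
  have hj' : u = R.root j := by
    by_contra hne
    have := hw (R.simple j * w) ⟨mul_mem (R.simple_mem_sub hj) hwJ, by
      rw [rep_mul]
      exact hur.nonneg_rep_simple hw1 hne⟩
    simp only [rep_mul, R.rep_simple, inner_sub_left, inner_smul_left,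
      hρ] at this
    simp at this
    linarith
  refine ⟨w⁻¹, inv_mem hwJ, j, hj, ?_⟩
  rw [← hj', hu, rep_inv_rep]

theorem mem_span_filter_of_inner_eq_zero {J : Finset B} {u v : V} (hd : R.Dominant J u)
    (h : R.IsRoot v) (hv : v ∈ R.span J) (h0 : ⟪v, u⟫_ℝ = 0) :
    v ∈ R.span (J.filter fun j => ⟪R.root j, u⟫_ℝ = 0) := by
  wlog hn : R.Nonneg v generalizing v
  · have := this h.neg (neg_mem hv) (by rw [inner_neg_left, h0, neg_zero])
      (h.nonneg_or.resolve_left hn)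
    simpa using neg_mem this
  rw [mem_span_iff]
  intro j hj
  by_cases hjJ : j ∈ J
  · rw [R.eq_sum_of_mem_span hv, sum_inner] at h0
    simp only [inner_smul_left] at h0
    have := (Finset.sum_eq_zero_iff_of_nonneg
      (fun i hi => mul_nonneg (hn i) (hd i hi))).1 h0 j hjJ
    rcases mul_eq_zero.1 this with h1 | h1
    · exact h1
    · exact absurd (Finset.mem_filter.2 ⟨hjJ, h1⟩) hj
  · exact R.mem_span_iff.1 hv j hjJ

end ReflRep

/-- A Perron vector for an indecomposable positive definite symmetric matrix with nonpositive
off-diagonal entries. -/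
theorem exists_perron {ι : Type*} [Fintype ι] [Nonempty ι] (G : ι → ι → ℝ)
    (hsymm : ∀ i j, G i j = G j i) (hoff : ∀ i j, i ≠ j → G i j ≤ 0)
    (hpos : ∀ x : ι → ℝ, x ≠ 0 → 0 < ∑ i, ∑ j, x i * x j * G i j)
    (hind : ∀ A : Set ι, A.Nonempty → (∀ i ∈ A, ∀ j, G i j ≠ 0 → j ∈ A) → A = Set.univ) :
    ∃ (μ : ℝ) (a : ι → ℝ), 0 < μ ∧ (∀ i, 0 < a i) ∧ ∀ i, ∑ j, G i j * a j = μ * a i := by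
  classical
  let q : (ι → ℝ) → ℝ := fun x => ∑ i, ∑ j, x i * x j * G i j
  let nn : (ι → ℝ) → ℝ := fun x => ∑ i, x i ^ 2
  have hq_smul : ∀ (t : ℝ) x, q (t • x) = t ^ 2 * q x := by
    intro t x
    simp only [q, Finset.mul_sum, Pi.smul_apply, smul_eq_mul]
    exact Finset.sum_congr rfl fun i _ => Finset.sum_congr rfl fun j _ => by ring
  have hn_smul : ∀ (t : ℝ) x, nn (t • x) = t ^ 2 * nn x := by
    intro t x
    simp only [nn, Finset.mul_sum, Pi.smul_apply, smul_eq_mul]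
    exact Finset.sum_congr rfl fun i _ => by ring
  have hcont : Continuous fun x : EuclideanSpace ℝ ι => q x := by
    simp only [q]; fun_prop
  obtain ⟨i₀⟩ := ‹Nonempty ι›
  obtain ⟨x, hx, hmin⟩ := (isCompact_sphere (0 : EuclideanSpace ℝ ι) 1).exists_isMinOn
    ⟨EuclideanSpace.single i₀ (1 : ℝ), by simp⟩ hcont.continuousOn
  have hxn : nn x = 1 := by
    have : ‖x‖ = 1 := by simpa using hx
    rw [EuclideanSpace.norm_eq, Real.sqrt_eq_one] at this
    simpa [nn] using this
  have hbound : ∀ y : ι → ℝ, q x * nn y ≤ q y := by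
    intro y
    have hny : 0 ≤ nn y := Finset.sum_nonneg fun i _ => sq_nonneg _
    rcases hny.eq_or_lt with h0 | h0
    · have hy : y = 0 := by
        ext i
        have := (Finset.sum_eq_zero_iff_of_nonneg (fun i _ => sq_nonneg (y i))).1 h0.symm i
          (Finset.mem_univ _)
        simpa using this
      rw [← h0, hy]; simp [q]
    · set t := (Real.sqrt (nn y))⁻¹ with ht
      have ht2 : t ^ 2 * nn y = 1 := by
        rw [ht, inv_pow, Real.sq_sqrt hny, inv_mul_cancel₀ h0.ne']
      have hmem : WithLp.toLp 2 (t • y) ∈ Metric.sphere (0 : EuclideanSpace ℝ ι) 1 := by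
        simp only [mem_sphere_zero_iff_norm]
        rw [EuclideanSpace.norm_eq, Real.sqrt_eq_one, ← ht2, ← hn_smul]
        simp [nn, mul_pow]
      have h2 : q x ≤ q (t • y) := hmin hmem
      rw [hq_smul] at h2
      have ht0 : 0 < t ^ 2 := by
        by_contra! h
        nlinarith
      calc q x * nn y ≤ t ^ 2 * q y * nn y := by gcongr
        _ = t ^ 2 * nn y * q y := by ring
        _ = q y := by rw [ht2, one_mul]
  set a : ι → ℝ := fun i => |x i| with ha
  have han : nn a = 1 := by simpa [nn, ha] using hxn
  have hqa : q a = q x := by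
    apply le_antisymm _ (by simpa [han] using hbound a)
    refine Finset.sum_le_sum fun i _ => Finset.sum_le_sum fun j _ => ?_
    by_cases hij : i = j
    · subst hij; simp [ha]
    · have h1 := hoff i j hij
      have h2 : x i * x j ≤ a i * a j := by
        rw [ha]; simp only; rw [← abs_mul]; exact le_abs_self _
      nlinarith
  have hμ : 0 < q x := hpos x (by
    intro h
    rw [h] at hxn
    simp [nn] at hxn)
  have heig : ∀ i, ∑ j, G i j * a j = q x * a i := by
    intro i
    have hexp : ∀ t : ℝ, q (a + t • Pi.single i 1) = q a + 2 * t * (∑ j, G i j * a j) +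
        t ^ 2 * G i i := by
      intro t
      simp only [q, Pi.add_apply, Pi.smul_apply, smul_eq_mul, Pi.single_apply, mul_ite, mul_one,
        mul_zero, add_mul, mul_add, Finset.sum_add_distrib, ite_mul, zero_mul,
        Finset.sum_ite_eq', Finset.mem_univ, if_true, Finset.sum_ite_irrel, Finset.sum_const_zero]
      have e1 : ∑ j, a j * t * G j i = t * ∑ j, G i j * a j := by
        rw [Finset.mul_sum]
        exact Finset.sum_congr rfl fun j _ => by rw [hsymm j i]; ring
      have e2 : ∑ j, t * a j * G i j = t * ∑ j, G i j * a j := by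
        rw [Finset.mul_sum]
        exact Finset.sum_congr rfl fun j _ => by ring
      rw [e1, e2]; ring
    have hnexp : ∀ t : ℝ, nn (a + t • Pi.single i 1) = 1 + 2 * t * a i + t ^ 2 := by
      intro t
      suffices nn (a + t • Pi.single i 1) = nn a + 2 * t * a i + t ^ 2 by
        rw [this, han]
      simp only [nn, Pi.add_apply, Pi.smul_apply, smul_eq_mul, Pi.single_apply, mul_ite,
        mul_zero, add_sq, Finset.sum_add_distrib, ite_pow, Finset.sum_ite_eq', Finset.mem_univ,
        if_true]
      simp
      ring
    set S := ∑ j, G i j * a j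
    have key : ∀ t : ℝ, 0 ≤ (G i i - q x) * (t * t) + 2 * (S - q x * a i) * t + 0 := by
      intro t
      have := hbound (a + t • Pi.single i 1)
      rw [hexp, hnexp, hqa] at this
      nlinarith
    have hd := discrim_le_zero key
    simp only [discrim] at hd
    nlinarith [sq_nonneg (S - q x * a i)]
  have ha0 : ∀ i, 0 ≤ a i := fun i => abs_nonneg _
  have hsupp : {i | a i ≠ 0} = Set.univ := by
    apply hind
    · by_contra hcon
      rw [Set.not_nonempty_iff_eq_empty] at hcon
      have : ∀ i, a i = 0 := fun i => by
        by_contra h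
        exact (hcon ▸ (show i ∈ {i | a i ≠ 0} from h) : i ∈ (∅ : Set ι))
      simp [nn, this] at han
    · intro i hi j hij hj
      have hj : a j = 0 := hj
      have h1 := heig j
      rw [hj, mul_zero, Finset.sum_eq_zero_iff_of_nonpos] at h1
      · have := h1 i (Finset.mem_univ _)
        rw [hsymm] at this
        exact (mul_ne_zero hij hi) this
      · intro k _
        by_cases hjk : j = k
        · subst hjk; rw [hj, mul_zero]
        · exact mul_nonpos_of_nonpos_of_nonneg (hoff j k hjk) (ha0 k)
  refine ⟨q x, a, hμ, fun i => lt_of_le_of_ne (ha0 i) (Ne.symm ?_), heig⟩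
  exact (hsupp ▸ Set.mem_univ i : i ∈ {i | a i ≠ 0})

section Recurrence

variable {t : ℝ} {P : ℕ}

theorem exists_zero_of_recurrence {f : ℕ → ℝ} (ht : t < 2) (hP : 0 < P)
    (hrec : ∀ k, f (k + 2) = t * f (k + 1) - f k) (hper : ∀ k, f (k + P) = f k)
    (hsign : ∀ k, 0 ≤ f k * f (k + 1)) (hne : ∀ k, f k ≠ 0 ∨ f (k + 1) ≠ 0) :
    ∃ k, f k = 0 ∧ f (k + 1) < 0 := by
  by_contra! hcon
  have hperm : ∀ n k, f (k + n * P) = f k := by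
    intro n k
    induction n with
    | zero => simp
    | succ n ih => rw [Nat.succ_mul, ← add_assoc, hper, ih]
  have hshift : ∀ g : ℕ → ℝ, (∀ k, g (k + P) = g k) →
      ∑ k ∈ Finset.range P, g (k + 1) = ∑ k ∈ Finset.range P, g k := by
    intro g hg
    have h1 := Finset.sum_range_succ g P
    have h2 := Finset.sum_range_succ' g P
    have := hg 0
    rw [zero_add] at this
    linarith
  have hsum : ∑ k ∈ Finset.range P, f k = 0 := by
    have h1 := hshift f hper
    have h2 := hshift (fun k => f (k + 1)) (fun k => by
      rw [add_right_comm, hper])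
    simp only [add_assoc, one_add_one_eq_two, hrec, Finset.sum_sub_distrib,
      ← Finset.mul_sum] at h2
    rw [h1] at h2
    have : (2 - t) * ∑ k ∈ Finset.range P, f k = 0 := by linarith
    rcases mul_eq_zero.1 this with h | h
    · linarith
    · exact h
  by_cases hpos : ∃ k, 0 < f k
  · obtain ⟨k, hk⟩ := hpos
    have h1 : ∀ j, 0 < f (k + j) := by
      intro j
      induction j with
      | zero => exact hk
      | succ j ih =>
        have h2 : 0 ≤ f (k + j + 1) := by
          by_contra! h
          nlinarith [hsign (k + j)]
        rcases h2.eq_or_lt with h | h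
        · have h3 := hcon _ h.symm
          have h4 := hrec (k + j)
          rw [← h] at h4
          rw [show k + j + 1 + 1 = k + j + 2 by ring] at h3
          linarith
        · exact h
    have h2 : ∀ j, 0 < f j := by
      intro j
      rw [← hperm k j]
      have : j + k * P = k + (j + k * P - k) := by
        have : k ≤ k * P := Nat.le_mul_of_pos_right k hP
        omega
      rw [this]
      exact h1 _
    have := Finset.sum_pos (fun k (_ : k ∈ Finset.range P) => h2 k) ⟨0, by simpa using hP⟩
    linarith
  · push Not at hpos
    have h0 := (Finset.sum_eq_zero_iff_of_nonpos (fun k (_ : k ∈ Finset.range P) => hpos k)).1 hsum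
    have h1 : ∀ k, f k = 0 := by
      intro k
      rw [← Nat.mod_add_div' k P, hperm]
      exact h0 _ (Finset.mem_range.2 (Nat.mod_lt _ hP))
    rcases hne 0 with h | h <;> exact h (h1 _)

theorem exists_period_of_recurrence {U : ℕ → ℝ} (hP : 0 < P) (h0 : U 0 = 0) (h1 : U 1 = 1)
    (hrec : ∀ k, U (k + 2) = t * U (k + 1) - U k) (hper : ∀ k, U (k + P) = U k)
    (hsign : ∀ k, 0 ≤ U k * U (k + 1)) :
    ∃ H, 0 < H ∧ (∀ k, U (k + 2 * H) = U k) ∧ ∀ k, U k = 0 → 0 < U (k + 1) → 2 * H ∣ k := by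
  classical
  have hex : ∃ H, 0 < H ∧ U H = 0 := ⟨P, hP, by simpa [h0] using hper 0⟩
  obtain ⟨hH, hUH⟩ := Nat.find_spec hex
  set H := Nat.find hex
  have hmin : ∀ j, 0 < j → j < H → U j ≠ 0 := fun j hj hjH h => Nat.find_min hex hjH ⟨hj, h⟩
  have hinv : ∀ k, U k ^ 2 + U (k + 1) ^ 2 - t * U k * U (k + 1) = 1 := by
    intro k
    induction k with
    | zero => simp [h0, h1]
    | succ k ih => rw [show k + 1 + 1 = k + 2 from rfl, hrec]; linarith
  have hUpos : ∀ j, 0 < j → j < H → 0 < U j := by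
    intro j
    induction j with
    | zero => intro h; omega
    | succ j ih =>
      intro _ hj
      rcases Nat.eq_zero_or_pos j with rfl | hj0
      · rw [h1]; norm_num
      · have h2 := ih hj0 (by omega)
        rcases lt_or_gt_of_ne (hmin (j + 1) (by omega) hj) with h | h
        · nlinarith [hsign j]
        · exact h
  have hH1 : H ≠ 1 := by
    intro h
    rw [h, h1] at hUH
    exact one_ne_zero hUH
  obtain ⟨G, hG⟩ : ∃ G, H = G + 2 := ⟨H - 2, by omega⟩
  have hneg : U (H + 1) = -1 := by
    have e1 := hinv H
    rw [hUH] at e1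
    have e2 := hrec (G + 1)
    rw [show G + 1 + 2 = H + 1 by omega, show G + 1 + 1 = H by omega, hUH] at e2
    have e3 := hUpos (G + 1) (by omega) (by omega)
    nlinarith
  have hanti : ∀ k, U (H + k) = - U k ∧ U (H + (k + 1)) = - U (k + 1) := by
    intro k
    induction k with
    | zero => simp [hUH, h0, hneg, h1]
    | succ k ih =>
      refine ⟨ih.2, ?_⟩
      have := hrec (H + k)
      rw [add_assoc, add_assoc, ih.1, ih.2] at this
      rw [show k + 1 + 1 = k + 2 from rfl, this, hrec]
      ring
  have hper2 : ∀ k, U (k + 2 * H) = U k := by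
    intro k
    rw [show k + 2 * H = H + (H + k) by ring, (hanti _).1, (hanti _).1, neg_neg]
  refine ⟨H, hH, hper2, fun k hk hk1 => ?_⟩
  have hper3 : ∀ n k, U (k + n * (2 * H)) = U k := by
    intro n k
    induction n with
    | zero => simp
    | succ n ih => rw [Nat.succ_mul, ← add_assoc, hper2, ih]
  have hdiv := Nat.mod_add_div' k (2 * H)
  have hlt : k % (2 * H) < 2 * H := Nat.mod_lt _ (by omega)
  apply Nat.dvd_of_mod_eq_zero
  set r := k % (2 * H)
  rw [← hdiv, hper3] at hk
  rw [← hdiv, add_right_comm, hper3] at hk1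
  by_contra hr
  rcases lt_trichotomy r H with h | h | h
  · exact hmin r (by omega) h hk
  · rw [h, hneg] at hk1; linarith
  · have := (hanti (r - H)).1
    rw [show H + (r - H) = r by omega, hk] at this
    exact hmin (r - H) (by omega) (by omega) (by linarith)

end Recurrence

namespace ReflRep

variable {B W V : Type*} [Fintype B] [DecidableEq B] [Group W] [Fintype W]
  [NormedAddCommGroup V] [InnerProductSpace ℝ V] (R : ReflRep B W V)

/-- A proper two-colouring of the Coxeter diagram. -/
def IsColoring (ε : B → Bool) : Prop :=
  ∀ a b, a ≠ b → ⟪R.root a, R.root b⟫_ℝ ≠ 0 → ε a ≠ ε b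

/-- The product of the simple reflections indexed by `K`, in some order. -/
noncomputable def prodSimple (K : Finset B) : W := (K.toList.map R.simple).prod

/-- The product of the simple reflections in `J` of a given colour. -/
noncomputable def half (ε : B → Bool) (J : Finset B) (x : Bool) : W :=
  R.prodSimple (J.filter fun j => ε j = x)

/-- The bipartite Coxeter element of the parabolic subgroup indexed by `J`. -/
noncomputable def cox (ε : B → Bool) (J : Finset B) : W := R.half ε J true * R.half ε J false

/-- Simple roots of colour `true`, negatives of simple roots of colour `false`. -/
noncomputable def signed (ε : B → Bool) (s : B) : V := if ε s then R.root s else -R.root s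

/-- Connected components of the Coxeter diagram restricted to `J`. -/
structure IsComponent (J K : Finset B) : Prop where
  subset : K ⊆ J
  nonempty : K.Nonempty
  closed : ∀ a ∈ K, ∀ b ∈ J, ⟪R.root a, R.root b⟫_ℝ ≠ 0 → b ∈ K
  minimal : ∀ A ⊆ K, A.Nonempty → (∀ a ∈ A, ∀ b ∈ K, ⟪R.root a, R.root b⟫_ℝ ≠ 0 → b ∈ A) → A = K

theorem rep_list_prod {l : List B} (hn : l.Nodup)
    (h : ∀ a ∈ l, ∀ b ∈ l, a ≠ b → ⟪R.root a, R.root b⟫_ℝ = 0) (v : V) :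
    R.rep (l.map R.simple).prod v = v - (l.map fun r => ⟪R.root r, v⟫_ℝ • R.root r).sum := by
  induction l with
  | nil => simp
  | cons a l ih =>
    rw [List.map_cons, List.prod_cons, rep_mul, ih hn.of_cons fun b hb c hc =>
      h b (List.mem_cons_of_mem _ hb) c (List.mem_cons_of_mem _ hc)]
    have h0 : ⟪R.root a, (l.map fun r => ⟪R.root r, v⟫_ℝ • R.root r).sum⟫_ℝ = 0 := by
      rw [List.nodup_cons] at hn
      have h1 : ∀ b ∈ l, ⟪R.root a, R.root b⟫_ℝ = 0 := fun b hb =>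
        h a List.mem_cons_self b (List.mem_cons_of_mem _ hb) (by rintro rfl; exact hn.1 hb)
      clear h hn ih
      induction l with
      | nil => simp
      | cons b l ih =>
        rw [List.map_cons, List.sum_cons, inner_add_right, inner_smul_right,
          h1 b List.mem_cons_self, ih fun c hc => h1 c (List.mem_cons_of_mem _ hc)]
        simp
    rw [R.rep_simple, inner_sub_right, h0, List.map_cons, List.sum_cons, sub_zero]
    abel

theorem rep_prodSimple {K : Finset B}
    (h : ∀ a ∈ K, ∀ b ∈ K, a ≠ b → ⟪R.root a, R.root b⟫_ℝ = 0) (v : V) :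
    R.rep (R.prodSimple K) v = v - ∑ r ∈ K, ⟪R.root r, v⟫_ℝ • R.root r := by
  rw [prodSimple, rep_list_prod R K.nodup_toList (by simpa using h), Finset.sum_map_toList]

theorem prodSimple_mem {K J : Finset B} (h : K ⊆ J) : R.prodSimple K ∈ R.sub J := by
  apply Subgroup.list_prod_mem
  intro x hx
  obtain ⟨a, ha, rfl⟩ := List.mem_map.1 hx
  exact R.simple_mem_sub (h (by simpa using ha))

theorem half_mem (ε : B → Bool) (J : Finset B) (x : Bool) : R.half ε J x ∈ R.sub J :=
  R.prodSimple_mem (Finset.filter_subset _ _)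

theorem cox_mem (ε : B → Bool) (J : Finset B) : R.cox ε J ∈ R.sub J :=
  mul_mem (R.half_mem ε J _) (R.half_mem ε J _)

theorem isRoot_signed (ε : B → Bool) (s : B) : R.IsRoot (R.signed ε s) := by
  unfold signed
  split_ifs
  · exact R.isRoot_root s
  · exact (R.isRoot_root s).neg

theorem signed_mem_span (ε : B → Bool) {J : Finset B} {s : B} (hs : s ∈ J) :
    R.signed ε s ∈ R.span J := by
  unfold signed
  split_ifs
  · exact R.root_mem_span hs
  · exact neg_mem (R.root_mem_span hs)

theorem signed_inj {ε : B → Bool} {r s : B} (h : R.signed ε r = R.signed ε s) : r = s := by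
  by_contra hne
  have := congrArg (fun v => R.root.repr v r) h
  unfold signed at this
  split_ifs at this <;> simp [Ne.symm hne] at this

variable {R}

theorem IsColoring.inner_eq_zero {ε : B → Bool} (hε : R.IsColoring ε) {a b : B} (hab : a ≠ b)
    (h : ε a = ε b) : ⟪R.root a, R.root b⟫_ℝ = 0 := by
  by_contra h0
  exact hε a b hab h0 h

theorem IsColoring.rep_half {ε : B → Bool} (hε : R.IsColoring ε) (J : Finset B) (x : Bool) (v : V) :
    R.rep (R.half ε J x) v =
      v - ∑ r ∈ J.filter (fun j => ε j = x), ⟪R.root r, v⟫_ℝ • R.root r := by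
  apply rep_prodSimple
  intro a ha b hb hab
  simp only [Finset.mem_filter] at ha hb
  exact hε.inner_eq_zero hab (ha.2.trans hb.2.symm)

theorem IsComponent.inner_eq_zero {J K : Finset B} (hK : R.IsComponent J K) {j : B} (hj : j ∈ J)
    (hjK : j ∉ K) {v : V} (hv : v ∈ R.span K) : ⟪R.root j, v⟫_ℝ = 0 := by
  rw [real_inner_comm]
  apply R.inner_eq_zero_of_mem_span _ hv
  intro k hk
  by_contra h
  exact hjK (hK.closed k hk j hj h)

theorem IsComponent.rep_mem_span {J K : Finset B} (hK : R.IsComponent J K) {w : W}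
    (hw : w ∈ R.sub J) {v : V} (hv : v ∈ R.span K) : R.rep w v ∈ R.span K := by
  classical
  induction w using WellFounded.induction (measure R.len).wf generalizing v with
  | _ w ih =>
    by_cases h1 : w = 1
    · rw [h1, rep_one]; exact hv
    obtain ⟨b, hbJ, -, hlen⟩ := R.exists_descent_mem hw h1
    have h2 : R.rep (R.simple b) v ∈ R.span K := by
      rw [R.rep_simple]
      by_cases hbK : b ∈ K
      · exact sub_mem hv (Submodule.smul_mem _ _ (R.root_mem_span hbK))
      · rw [hK.inner_eq_zero hbJ hbK hv, zero_smul, sub_zero]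
        exact hv
    have := ih (w * R.simple b) hlen (mul_mem hw (R.simple_mem_sub hbJ)) h2
    rwa [rep_mul, rep_simple_simple] at this

variable (R)

theorem exists_component {J : Finset B} {s : B} (hs : s ∈ J) :
    ∃ K, s ∈ K ∧ R.IsComponent J K := by
  classical
  obtain ⟨K, hK, hmin⟩ := Finset.exists_min_image (J.powerset.filter fun K => s ∈ K ∧
    ∀ a ∈ K, ∀ b ∈ J, ⟪R.root a, R.root b⟫_ℝ ≠ 0 → b ∈ K) Finset.card
    ⟨J, by simp only [Finset.mem_filter, Finset.mem_powerset]; exact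
      ⟨Finset.Subset.refl _, hs, fun _ _ b hb _ => hb⟩⟩
  simp only [Finset.mem_filter, Finset.mem_powerset] at hK hmin
  obtain ⟨hKJ, hsK, hcl⟩ := hK
  have hmin' : ∀ A ⊆ K, s ∈ A → (∀ a ∈ A, ∀ b ∈ K, ⟪R.root a, R.root b⟫_ℝ ≠ 0 → b ∈ A) →
      A = K := by
    intro A hA hsA hAcl
    exact Finset.eq_of_subset_of_card_le hA (hmin A ⟨hA.trans hKJ, hsA, fun a ha b hb h =>
      hAcl a ha b (hcl a (hA ha) b hb h) h⟩)
  refine ⟨K, hsK, hKJ, ⟨s, hsK⟩, hcl, fun A hA ⟨a, ha⟩ hAcl => ?_⟩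
  by_cases hsA : s ∈ A
  · exact hmin' A hA hsA hAcl
  · have := hmin' (K \ A) Finset.sdiff_subset (Finset.mem_sdiff.2 ⟨hsK, hsA⟩) (by
      intro b hb c hc hbc
      rw [Finset.mem_sdiff] at hb ⊢
      refine ⟨hc, fun hcA => hb.2 (hAcl c hcA b hb.1 ?_)⟩
      rwa [real_inner_comm])
    exact absurd ha (Finset.mem_sdiff.1 (this ▸ hA ha)).2

theorem inner_root_nonpos {a b : B} (h : a ≠ b) : ⟪R.root a, R.root b⟫_ℝ ≤ 0 := by
  rcases R.inner_trichotomy a b h with h | h <;> linarith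

theorem exists_perron_vector {J K : Finset B} (hK : R.IsComponent J K) :
    ∃ (μ : ℝ) (a : B → ℝ), 0 < μ ∧ (∀ r ∈ K, 0 < a r) ∧
      ∀ r ∈ K, ∑ s ∈ K, ⟪R.root r, R.root s⟫_ℝ * a s = μ * a r := by
  classical
  have : Nonempty K := hK.nonempty.coe_sort
  obtain ⟨μ, a, hμ, ha, heig⟩ := exists_perron (fun r s : K => ⟪R.root r, R.root s⟫_ℝ)
    (fun r s => real_inner_comm _ _) (fun r s h => R.inner_root_nonpos (by simpa using h))
    (by
      intro x hx
      have h1 : ∑ i, ∑ j, x i * x j * ⟪R.root i, R.root j⟫_ℝ =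
          ⟪∑ i, x i • R.root i, ∑ i, x i • R.root i⟫_ℝ := by
        rw [sum_inner]
        refine Finset.sum_congr rfl fun i _ => ?_
        rw [inner_sum]
        refine Finset.sum_congr rfl fun j _ => ?_
        rw [inner_smul_left, inner_smul_right, mul_assoc]
        rfl
      rw [h1]
      apply real_inner_self_pos.2
      intro h
      apply hx
      ext i
      have := (R.root.linearIndependent.comp ((↑) : K → B) Subtype.val_injective)
      exact Fintype.linearIndependent_iff.1 this x h i)
    (by
      intro A hA hcl
      have := hK.minimal (K.filter fun k => ∃ h : k ∈ K, (⟨k, h⟩ : K) ∈ A)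
        (Finset.filter_subset _ _) (by
          obtain ⟨x, hx⟩ := hA
          exact ⟨x, by simp [hx]⟩) (by
          intro a ha b hb hab
          simp only [Finset.mem_filter] at ha ⊢
          obtain ⟨_, haK, haA⟩ := ha
          exact ⟨hb, hb, hcl _ haA ⟨b, hb⟩ hab⟩)
      rw [Set.eq_univ_iff_forall]
      rintro ⟨k, hk⟩
      exact (Finset.mem_filter.1 (this.symm.subset hk)).2.2)
  refine ⟨μ, fun b => if h : b ∈ K then a ⟨b, h⟩ else 0, hμ, fun r hr => ?_, fun r hr => ?_⟩
  · simp only [hr, dif_pos]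
    exact ha _
  · rw [← Finset.sum_coe_sort]
    simpa [hr] using heig ⟨r, hr⟩

variable {R} in
theorem IsColoring.exists_perron_pair {ε : B → Bool} (hε : R.IsColoring ε) {J K : Finset B}
    (hK : R.IsComponent J K) :
    ∃ (t : ℝ) (a : B → ℝ) (p : Bool → V), t < 2 ∧ (∀ r ∈ K, 0 < a r) ∧ (∀ x, p x ∈ R.span K) ∧
      (∀ r ∈ K, ∀ x, ⟪R.root r, p x⟫_ℝ = if ε r = x then a r else 0) ∧
      (∀ x, R.rep (R.half ε J x) (p x) = t • p (!x) - p x) ∧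
      ∀ x, R.rep (R.half ε J x) (p !x) = p !x := by
  classical
  obtain ⟨μ, a, hμ, ha, heig⟩ := R.exists_perron_vector hK
  choose p hp hpi using fun x => R.exists_mem_span_inner_eq K (fun r => if ε r = x then a r else 0)
  have hsum : ∀ x, ∑ r ∈ K.filter (fun j => ε j = x), a r • R.root r =
      (2 : ℝ) • p x - (2 - μ) • p (!x) := by
    intro x
    apply R.eq_of_inner_eq (J := K)
    · exact Submodule.sum_mem _ fun r hr =>
        Submodule.smul_mem _ _ (R.root_mem_span (Finset.mem_filter.1 hr).1)
    · exact sub_mem (Submodule.smul_mem _ _ (hp _)) (Submodule.smul_mem _ _ (hp _))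
    intro r hr
    rw [inner_sub_right, inner_smul_right, inner_smul_right, hpi _ r hr, hpi _ r hr, inner_sum]
    simp only [inner_smul_right]
    by_cases hrx : ε r = x
    · rw [Finset.sum_eq_single_of_mem r (by simp [hr, hrx])]
      · rw [R.inner_self, if_pos hrx, if_neg (by rw [hrx]; cases x <;> simp)]
        ring
      · intro s hs hsr
        rw [hε.inner_eq_zero (Ne.symm hsr) (hrx.trans (Finset.mem_filter.1 hs).2.symm), mul_zero]
    · have hrx' : ε r = !x := by cases h : ε r <;> cases x <;> simp_all
      have h1 := heig r hr
      rw [← Finset.sum_filter_add_sum_filter_not K (fun j => ε j = x)] at h1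
      have h2 : ∑ s ∈ K.filter (fun j => ¬ ε j = x), ⟪R.root r, R.root s⟫_ℝ * a s = 2 * a r := by
        rw [Finset.sum_eq_single_of_mem r (by simp [hr, hrx]), R.inner_self]
        intro s hs hsr
        rw [hε.inner_eq_zero (Ne.symm hsr), zero_mul]
        have := (Finset.mem_filter.1 hs).2
        cases h : ε s <;> cases x <;> simp_all
      rw [h2] at h1
      rw [if_neg hrx, if_pos hrx']
      have h3 : ∑ s ∈ K.filter (fun j => ε j = x), a s * ⟪R.root r, R.root s⟫_ℝ =
          ∑ s ∈ K.filter (fun j => ε j = x), ⟪R.root r, R.root s⟫_ℝ * a s :=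
        Finset.sum_congr rfl fun _ _ => mul_comm _ _
      rw [h3]
      linarith
  have hJK : ∀ x y, ∑ r ∈ J.filter (fun j => ε j = x), ⟪R.root r, p y⟫_ℝ • R.root r =
      ∑ r ∈ K.filter (fun j => ε j = x), ⟪R.root r, p y⟫_ℝ • R.root r := by
    intro x y
    symm
    apply Finset.sum_subset (Finset.filter_subset_filter _ hK.subset)
    intro r hr hrK
    simp only [Finset.mem_filter] at hr hrK
    rw [hK.inner_eq_zero hr.1 (fun h => hrK ⟨h, hr.2⟩) (hp y), zero_smul]
  refine ⟨2 - μ, a, p, by linarith, ha, hp, fun r hr x => hpi x r hr, fun x => ?_, fun x => ?_⟩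
  · rw [hε.rep_half, hJK, Finset.sum_congr rfl (g := fun r => a r • R.root r), hsum]
    · module
    · intro r hr
      rw [Finset.mem_filter] at hr
      rw [hpi x r hr.1, if_pos hr.2]
  · rw [hε.rep_half, hJK, Finset.sum_eq_zero, sub_zero]
    intro r hr
    rw [Finset.mem_filter] at hr
    rw [hpi _ r hr.1, if_neg, zero_smul]
    rw [hr.2]; cases x <;> simp

variable {R} in
/-- A root supported on pairwise orthogonal simple roots is simple up to sign. -/
theorem IsRoot.eq_or_eq_neg {v : V} (h : R.IsRoot v) {L : Finset B} (hv : v ∈ R.span L)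
    (hL : ∀ a ∈ L, ∀ b ∈ L, a ≠ b → ⟪R.root a, R.root b⟫_ℝ = 0) :
    ∃ r ∈ L, v = R.root r ∨ v = -R.root r := by
  wlog hn : R.Nonneg v generalizing v
  · obtain ⟨r, hr, h1⟩ := this h.neg (neg_mem hv) (h.nonneg_or.resolve_left hn)
    refine ⟨r, hr, ?_⟩
    rw [neg_inj, neg_eq_iff_eq_neg] at h1
    exact h1.symm
  obtain ⟨r, hr, hr0⟩ : ∃ r ∈ L, R.root.repr v r ≠ 0 := by
    by_contra! hcon
    apply h.ne_zero
    rw [R.eq_sum_of_mem_span hv]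
    exact Finset.sum_eq_zero fun r hr => by rw [hcon r hr, zero_smul]
  refine ⟨r, hr, Or.inl ?_⟩
  by_contra hne
  have h1 := h.nonneg_rep_simple hn hne r
  have h2 : ⟪R.root r, v⟫_ℝ = 2 * R.root.repr v r := by
    conv_lhs => rw [R.eq_sum_of_mem_span hv]
    rw [inner_sum, Finset.sum_eq_single_of_mem r hr]
    · rw [inner_smul_right, R.inner_self, mul_comm]
    · intro s hs hsr
      rw [inner_smul_right, hL r hr s hs (Ne.symm hsr), mul_zero]
  rw [R.rep_simple, h2] at h1
  simp at h1
  exact hr0 (le_antisymm (by linarith) (hn r))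

end ReflRep

namespace ReflRep

variable {B W V : Type*} [Fintype B] [DecidableEq B] [Group W] [Fintype W]
  [NormedAddCommGroup V] [InnerProductSpace ℝ V] {R : ReflRep B W V}

theorem eq_two_mul_or (k : ℕ) : ∃ j, k = 2 * j ∨ k = 2 * j + 1 :=
  ⟨k / 2, by omega⟩

/-- The orbits of the bipartite Coxeter element on the roots of a component. -/
theorem IsColoring.orbits {ε : B → Bool} (hε : R.IsColoring ε) {J K : Finset B}
    (hK : R.IsComponent J K) :
    ∃ H, 0 < H ∧ (∀ v ∈ R.span K, R.rep (R.cox ε J ^ H) v = v) ∧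
      (∀ v, R.IsRoot v → v ∈ R.span K →
        ∃ j < H, ∃ r ∈ K, v = R.rep (R.cox ε J ^ j) (R.signed ε r)) ∧
      ∀ j < H, ∀ j' < H, ∀ r ∈ K, ∀ r' ∈ K,
        R.rep (R.cox ε J ^ j) (R.signed ε r) = R.rep (R.cox ε J ^ j') (R.signed ε r') →
          j = j' ∧ r = r' := by
  classical
  obtain ⟨t, a, p, ht, ha, hpK, hpr, hp1, hp2⟩ := hε.exists_perron_pair hK
  set c := R.cox ε J with hc
  have hcJ : c ∈ R.sub J := R.cox_mem ε J
  have hct : R.rep c (p true) = t • p false - p true := by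
    rw [hc, cox, rep_mul, show p true = p (!false) from rfl, hp2, Bool.not_false, hp1]; rfl
  have hcf : R.rep c (p false) = t • R.rep c (p true) - p false := by
    rw [hct, hc, cox, rep_mul, hp1, map_sub, map_smul, Bool.not_false, hp1,
      show p false = p (!true) from rfl, hp2]
  -- the sequence of Perron vectors
  let y : ℕ → V := fun k => R.rep (c ^ (k / 2)) (p (k % 2 == 0))
  have hy0 : ∀ j, y (2 * j) = R.rep (c ^ j) (p true) := by
    intro j
    simp only [y]
    rw [show 2 * j / 2 = j by omega, show 2 * j % 2 = 0 by omega]; rfl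
  have hy1 : ∀ j, y (2 * j + 1) = R.rep (c ^ j) (p false) := by
    intro j
    simp only [y]
    rw [show (2 * j + 1) / 2 = j by omega, show (2 * j + 1) % 2 = 1 by omega]; rfl
  have hyrec : ∀ k, y (k + 2) = t • y (k + 1) - y k := by
    intro k
    obtain ⟨j, rfl | rfl⟩ := eq_two_mul_or k
    · rw [show 2 * j + 2 = 2 * (j + 1) by ring, hy0, hy1, hy0, pow_succ, rep_mul, hct, map_sub,
        map_smul]
    · rw [show 2 * j + 1 + 2 = 2 * (j + 1) + 1 by ring, show 2 * j + 1 + 1 = 2 * (j + 1) by ring,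
        hy0, hy1, hy1, pow_succ, rep_mul, hcf, map_sub, map_smul, ← rep_mul]
  have hyper : ∀ k, y (k + 2 * orderOf c) = y k := by
    intro k
    obtain ⟨j, rfl | rfl⟩ := eq_two_mul_or k
    · rw [← mul_add, hy0, hy0, pow_add, pow_orderOf_eq_one, mul_one]
    · rw [add_right_comm, ← mul_add, hy1, hy1, pow_add, pow_orderOf_eq_one, mul_one]
  have hord : 0 < 2 * orderOf c := by
    have := orderOf_pos c
    omega
  let f : V → ℕ → ℝ := fun v k => ⟪v, y k⟫_ℝ
  have hfrec : ∀ v k, f v (k + 2) = t * f v (k + 1) - f v k := by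
    intro v k
    simp only [f, hyrec, inner_sub_right, inner_smul_right]
  have hfper : ∀ v k, f v (k + 2 * orderOf c) = f v k := fun v k => by simp only [f, hyper]
  have hf0 : ∀ v j, f v (2 * j) = ⟪R.rep (c ^ j)⁻¹ v, p true⟫_ℝ := by
    intro v j
    rw [inner_rep_left, inv_inv, ← hy0]
  have hf1 : ∀ v j, f v (2 * j + 1) = ⟪R.rep (c ^ j)⁻¹ v, p false⟫_ℝ := by
    intro v j
    rw [inner_rep_left, inv_inv, ← hy1]
  have hf2 : ∀ v j, f v (2 * j + 2) =
      ⟪R.rep (R.half ε J true)⁻¹ (R.rep (c ^ j)⁻¹ v), p true⟫_ℝ := by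
    intro v j
    rw [inner_rep_left, inner_rep_left, inv_inv, inv_inv, hp1, Bool.not_true, ← hct, ← rep_mul,
      ← pow_succ, ← hy0]
    rfl
  have hf1' : ∀ v j, f v (2 * j + 1) =
      ⟪R.rep (R.half ε J true)⁻¹ (R.rep (c ^ j)⁻¹ v), p false⟫_ℝ := by
    intro v j
    rw [inner_rep_left _ (R.half ε J true)⁻¹, inv_inv, show p false = p (!true) from rfl, hp2,
      Bool.not_true, hf1]
  have hdomx : ∀ x, R.Dominant K (p x) := by
    intro x r hr
    rw [hpr r hr]
    split_ifs
    · exact (ha r hr).le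
    · exact le_rfl
  have hinvK : ∀ j, ∀ v ∈ R.span K, R.rep (c ^ j)⁻¹ v ∈ R.span K := fun j v hv =>
    hK.rep_mem_span (inv_mem (pow_mem hcJ j)) hv
  have hstep : ∀ v k, R.IsRoot v → v ∈ R.span K → ∃ β x, R.IsRoot β ∧ β ∈ R.span K ∧
      f v k = ⟪β, p x⟫_ℝ ∧ f v (k + 1) = ⟪β, p !x⟫_ℝ := by
    intro v k hv hvK
    obtain ⟨j, rfl | rfl⟩ := eq_two_mul_or k
    · exact ⟨R.rep (c ^ j)⁻¹ v, true, hv.rep _, hinvK j v hvK, hf0 v j, hf1 v j⟩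
    · exact ⟨R.rep (R.half ε J true)⁻¹ (R.rep (c ^ j)⁻¹ v), false, (hv.rep _).rep _,
        hK.rep_mem_span (inv_mem (R.half_mem ε J true)) (hinvK j v hvK), hf1' v j, hf2 v j⟩
  have hsign : ∀ v, R.IsRoot v → v ∈ R.span K → ∀ k, 0 ≤ f v k * f v (k + 1) := by
    intro v hv hvK k
    obtain ⟨β, x, hβ, hβK, h1, h2⟩ := hstep v k hv hvK
    rw [h1, h2]
    rcases hβ.nonneg_or with hn | hn
    · exact mul_nonneg ((hdomx x).inner_nonneg hβK hn) ((hdomx !x).inner_nonneg hβK hn)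
    · have e1 := (hdomx x).inner_nonneg (neg_mem hβK) hn
      have e2 := (hdomx !x).inner_nonneg (neg_mem hβK) hn
      rw [inner_neg_left] at e1 e2
      nlinarith
  have hsupp : ∀ v x, R.IsRoot v → v ∈ R.span K → ⟪v, p x⟫_ℝ = 0 →
      v ∈ R.span (K.filter fun r => ε r = !x) := by
    intro v x hv hvK h0
    refine R.span_mono ?_ (R.mem_span_filter_of_inner_eq_zero (hdomx x) hv hvK h0)
    intro r hr
    rw [Finset.mem_filter] at hr ⊢
    refine ⟨hr.1, ?_⟩
    rw [hpr r hr.1] at hr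
    by_contra h
    have : ε r = x := by cases h : ε r <;> cases x <;> simp_all
    rw [if_pos this] at hr
    exact (ha r hr.1).ne' hr.2
  have hsimple : ∀ v x, R.IsRoot v → v ∈ R.span K → ⟪v, p x⟫_ℝ = 0 →
      ∃ r ∈ K, (ε r = !x) ∧ (v = R.root r ∨ v = -R.root r) := by
    intro v x hv hvK h0
    obtain ⟨r, hr, h⟩ := hv.eq_or_eq_neg (hsupp v x hv hvK h0) (by
      intro b hb d hd hbd
      simp only [Finset.mem_filter] at hb hd
      exact hε.inner_eq_zero hbd (hb.2.trans hd.2.symm))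
    rw [Finset.mem_filter] at hr
    exact ⟨r, hr.1, hr.2, h⟩
  have hne : ∀ v, R.IsRoot v → v ∈ R.span K → ∀ k, f v k ≠ 0 ∨ f v (k + 1) ≠ 0 := by
    intro v hv hvK k
    obtain ⟨β, x, hβ, hβK, h1, h2⟩ := hstep v k hv hvK
    rw [h1, h2]
    by_contra! hcon
    obtain ⟨r, hr, hx, h⟩ := hsimple β x hβ hβK hcon.1
    have h3 := hpr r hr (!x)
    rw [if_pos hx] at h3
    have h4 := ha r hr
    rcases h with rfl | rfl
    · linarith [hcon.2]
    · rw [inner_neg_left, inner_neg_left] at hcon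
      linarith [hcon.2]
  let e : B → ℕ := fun r => if ε r then 1 else 0
  have hevent : ∀ v k, R.IsRoot v → v ∈ R.span K → f v k = 0 → f v (k + 1) < 0 →
      ∃ r ∈ K, R.rep (c ^ (k / 2))⁻¹ v = R.signed ε r := by
    intro v k hv hvK h0 h1
    obtain ⟨j, rfl | rfl⟩ := eq_two_mul_or k
    · rw [hf0] at h0
      rw [hf1] at h1
      obtain ⟨r, hr, hx, h⟩ := hsimple _ true (hv.rep _) (hinvK j v hvK) h0
      refine ⟨r, hr, ?_⟩
      rw [show 2 * j / 2 = j by omega]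
      rcases h with h | h
      · rw [h, hpr r hr, if_pos (by simpa using hx)] at h1
        linarith [ha r hr]
      · rw [h, signed, if_neg (by simp [hx])]
    · rw [hf1] at h0
      rw [show 2 * j + 1 + 1 = 2 * j + 2 by ring, hf2, inner_rep_left, inv_inv, hp1,
        inner_sub_right, inner_smul_right, Bool.not_true, h0] at h1
      obtain ⟨r, hr, hx, h⟩ := hsimple _ false (hv.rep _) (hinvK j v hvK) h0
      refine ⟨r, hr, ?_⟩
      rw [show (2 * j + 1) / 2 = j by omega]
      rcases h with h | h
      · rw [h, signed, if_pos (by simp [hx])]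
      · rw [h, inner_neg_left, hpr r hr, if_pos (by simpa using hx)] at h1
        linarith [ha r hr]
  have hevent' : ∀ v j, ∀ r ∈ K, R.rep (c ^ j)⁻¹ v = R.signed ε r →
      f v (2 * j + e r) = 0 ∧ f v (2 * j + e r + 1) < 0 := by
    intro v j r hr h
    have har := ha r hr
    cases hx : ε r
    · simp only [e, hx, Bool.false_eq_true, if_false, add_zero]
      rw [hf0, hf1, h, signed, hx]
      simp [hpr r hr, hx, har]
    · simp only [e, hx, if_true]
      rw [show 2 * j + 1 + 1 = 2 * j + 2 by ring, hf1, hf2, h, inner_rep_left, inv_inv, hp1,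
        signed, hx, inner_sub_right, inner_smul_right]
      simp [hpr r hr, hx, har]
  obtain ⟨s, hs⟩ := hK.nonempty
  have hev_s := hevent' (R.signed ε s) 0 s hs (by simp)
  have hsgn := R.isRoot_signed ε s
  have hsgnK := R.signed_mem_span ε hs
  simp only [mul_zero, zero_add] at hev_s
  obtain ⟨hev0, hev1⟩ := hev_s
  set g := f (R.signed ε s) with hg
  let U : ℕ → ℝ := fun k => g (e s + k) / g (e s + 1)
  obtain ⟨H, hH, hUper, hUdvd⟩ := exists_period_of_recurrence (U := U) (t := t) hord
    (by simp [U, hev0]) (div_self hev1.ne)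
    (fun k => by
      simp only [U]
      rw [← add_assoc, ← add_assoc, hg, hfrec]
      ring)
    (fun k => by
      simp only [U]
      rw [← add_assoc, hg, hfper])
    (fun k => by
      simp only [U]
      rw [← add_assoc, div_mul_div_comm]
      exact div_nonneg (hsign _ hsgn hsgnK _) (mul_self_nonneg _))
  have hU0 : U 0 = 0 := by simp [U, hev0]
  have hU1 : U 1 = 1 := div_self hev1.ne
  have hUrec : ∀ k, U (k + 2) = t * U (k + 1) - U k := fun k => by
    simp only [U]
    rw [← add_assoc, ← add_assoc, hg, hfrec]
    ring
  have hfU : ∀ v k, f v k = 0 → ∀ j, f v (k + j) = f v (k + 1) * U j ∧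
      f v (k + (j + 1)) = f v (k + 1) * U (j + 1) := by
    intro v k h0 j
    induction j with
    | zero => simp [h0, hU0, hU1]
    | succ j ih =>
      refine ⟨ih.2, ?_⟩
      rw [show k + (j + 1 + 1) = k + j + 2 by ring, hfrec, add_assoc, ih.2, ih.1,
        show j + 1 + 1 = j + 2 by ring, hUrec]
      ring
  have hyU : ∀ k, y k = U k • y 1 - (t * U k - U (k + 1)) • y 0 ∧
      y (k + 1) = U (k + 1) • y 1 - U k • y 0 := by
    intro k
    induction k with
    | zero => simp [hU0, hU1]
    | succ k ih =>
      have e1 := hUrec k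
      refine ⟨?_, ?_⟩
      · rw [ih.2, show k + 1 + 1 = k + 2 by ring, hUrec]
        congr 2; ring
      · rw [show k + 1 + 1 = k + 2 by ring, hyrec, hUrec, ih.2]
        rw [ih.1]
        module
  have hyH : y (2 * H) = y 0 ∧ y (2 * H + 1) = y 1 := by
    have e0 := hUper 0
    have e1 := hUper 1
    rw [zero_add] at e0
    rw [add_comm] at e1
    rw [(hyU (2 * H)).1, (hyU (2 * H)).2, e0, e1, hU0, hU1]
    simp
  have hcH : ∀ v ∈ R.span K, R.rep (c ^ H) v = v := by
    have hp0 : R.rep (c ^ H) (p true + p false) = p true + p false := by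
      rw [map_add, ← hy0, ← hy1, hyH.1, hyH.2, ← mul_zero 2, hy0,
        show y 1 = y (2 * 0 + 1) from rfl, hy1]
      simp
    have hpos : ∀ r ∈ K, 0 < ⟪R.root r, p true + p false⟫_ℝ := by
      intro r hr
      rw [inner_add_right, hpr r hr, hpr r hr]
      cases ε r <;> simp [ha r hr]
    have hzero : ∀ r ∈ J, r ∉ K → ⟪R.root r, p true + p false⟫_ℝ = 0 := fun r hr hrK =>
      hK.inner_eq_zero hr hrK (add_mem (hpK _) (hpK _))
    have hdom : R.Dominant J (p true + p false) := by
      intro r hr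
      by_cases hrK : r ∈ K
      · exact (hpos r hrK).le
      · exact (hzero r hr hrK).ge
    intro v hv
    apply R.rep_eq_of_inner_eq_zero _ (R.mem_sub_of_dominant (pow_mem hcJ H) hdom (by
      rw [hp0]; exact hdom))
    intro r hr
    rw [Finset.mem_filter] at hr
    have : r ∉ K := fun h => (hpos r h).ne' hr.2
    exact hK.inner_eq_zero hr.1 this hv
  have hcHn : ∀ n, ∀ v ∈ R.span K, R.rep (c ^ (H * n)) v = v := by
    intro n v hv
    induction n with
    | zero => simp
    | succ n ih => rw [Nat.mul_succ, pow_add, rep_mul, hcH v hv, ih]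
  refine ⟨H, hH, hcH, fun v hv hvK => ?_, ?_⟩
  · obtain ⟨k, h0, h1⟩ := exists_zero_of_recurrence ht hord (hfrec v) (hfper v) (hsign v hv hvK)
      (hne v hv hvK)
    obtain ⟨r, hr, h⟩ := hevent v k hv hvK h0 h1
    refine ⟨k / 2 % H, Nat.mod_lt _ hH, r, hr, ?_⟩
    conv_lhs => rw [← R.rep_rep_inv (c ^ (k / 2)) v, h]
    conv_lhs => rw [← Nat.mod_add_div (k / 2) H]
    rw [pow_add, rep_mul, hcHn _ _ (R.signed_mem_span ε hr)]
  · have key : ∀ i < H, ∀ r ∈ K, ∀ r' ∈ K, R.signed ε r = R.rep (c ^ i) (R.signed ε r') →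
        i = 0 ∧ r = r' := by
      intro i hi r hr r' hr' h
      have h1 := hevent' (R.signed ε r) 0 r hr (by simp)
      have h2 := hevent' (R.signed ε r) i r' hr' (by rw [h, rep_inv_rep])
      have he : ∀ b, e b ≤ 1 := fun b => by simp only [e]; split_ifs <;> omega
      have her := he r
      have her' := he r'
      have hi0 : i = 0 := by
        by_contra hi0
        obtain ⟨d, hd⟩ : ∃ d, 2 * i + e r' = e r + d := ⟨2 * i + e r' - e r, by omega⟩
        rw [mul_zero, zero_add] at h1
        have h3 := hfU (R.signed ε r) (e r) h1.1 d
        rw [hd, add_assoc] at h2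
        rw [h3.1, h3.2] at h2
        have h4 : U d = 0 := by
          rcases mul_eq_zero.1 h2.1 with h | h
          · exact absurd h h1.2.ne
          · exact h
        have h5 : 0 < U (d + 1) := by
          by_contra! h
          nlinarith [h1.2, h2.2]
        have h6 := Nat.le_of_dvd (by omega) (hUdvd d h4 h5)
        omega
      refine ⟨hi0, ?_⟩
      rw [hi0, pow_zero, rep_one] at h
      exact R.signed_inj h
    have key2 : ∀ j < H, ∀ j' < H, j ≤ j' → ∀ r ∈ K, ∀ r' ∈ K,
        R.rep (c ^ j) (R.signed ε r) = R.rep (c ^ j') (R.signed ε r') → j = j' ∧ r = r' := by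
      intro j hj j' hj' hjj r hr r' hr' h
      obtain ⟨i, rfl⟩ := Nat.exists_eq_add_of_le hjj
      rw [pow_add, rep_mul] at h
      have := key i (by omega) r hr r' hr' ((R.rep (c ^ j)).injective h)
      exact ⟨by omega, this.2⟩
    intro j hj j' hj' r hr r' hr' h
    rcases le_total j j' with hjj | hjj
    · exact key2 j hj j' hj' hjj r hr r' hr' h
    · have := key2 j' hj' j hj hjj r' hr' r hr h.symm
      exact ⟨this.1.symm, this.2.symm⟩

end ReflRep

namespace ReflRep

variable {B W V : Type*} [Fintype B] [DecidableEq B] [Group W] [Fintype W]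
  [NormedAddCommGroup V] [InnerProductSpace ℝ V] (R : ReflRep B W V)

open Classical in
/-- The roots lying in the span of the simple roots indexed by `J`. -/
noncomputable def roots (J : Finset B) : Finset V :=
  (Finset.univ.image fun p : W × B => R.rep p.1 (R.root p.2)).filter fun v => v ∈ R.span J

variable {R}

theorem mem_roots {J : Finset B} {v : V} : v ∈ R.roots J ↔ R.IsRoot v ∧ v ∈ R.span J := by
  simp only [roots, Finset.mem_filter, Finset.mem_image, Finset.mem_univ, true_and, Prod.exists,
    IsRoot, eq_comm]

theorem rep_mem_roots {J : Finset B} {w : W} (hw : w ∈ R.sub J) {v : V} (hv : v ∈ R.roots J) :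
    R.rep w v ∈ R.roots J := by
  rw [mem_roots] at *
  exact ⟨hv.1.rep w, R.rep_mem_span hw hv.2⟩

theorem sum_roots_rep {M : Type*} [AddCommMonoid M] {J : Finset B} {w : W} (hw : w ∈ R.sub J)
    (g : V → M) : ∑ v ∈ R.roots J, g (R.rep w v) = ∑ v ∈ R.roots J, g v :=
  Finset.sum_bij' (fun v _ => R.rep w v) (fun v _ => R.rep w⁻¹ v)
    (fun _ hv => rep_mem_roots hw hv) (fun _ hv => rep_mem_roots (inv_mem hw) hv)
    (fun v _ => R.rep_inv_rep w v) (fun v _ => R.rep_rep_inv w v) (fun _ _ => rfl)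

variable (R)

/-- The Coxeter number of the component of `s` in `J`, as the normalised sum of squares. -/
noncomputable def coxNum (J : Finset B) (s : B) : ℝ :=
  (1 / 4) * ∑ v ∈ R.roots J, ⟪v, R.root s⟫_ℝ ^ 2

/-- The Casimir-type operator attached to the roots of `J`. -/
noncomputable def casimir (J : Finset B) (u : V) : V := ∑ v ∈ R.roots J, ⟪v, u⟫_ℝ • v

variable {R}

theorem casimir_rep {J : Finset B} {w : W} (hw : w ∈ R.sub J) (u : V) :
    R.casimir J (R.rep w u) = R.rep w (R.casimir J u) := by
  rw [casimir, ← sum_roots_rep hw, casimir, map_sum]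
  refine Finset.sum_congr rfl fun v _ => ?_
  rw [R.inner_rep, map_smul]

theorem casimir_add (J : Finset B) (u v : V) :
    R.casimir J (u + v) = R.casimir J u + R.casimir J v := by
  simp only [casimir, inner_add_right, add_smul, Finset.sum_add_distrib]

theorem casimir_smul (J : Finset B) (a : ℝ) (u : V) :
    R.casimir J (a • u) = a • R.casimir J u := by
  simp only [casimir, inner_smul_right, mul_smul, Finset.smul_sum]

theorem inner_casimir_left (J : Finset B) (u v : V) :
    ⟪R.casimir J u, v⟫_ℝ = ∑ x ∈ R.roots J, ⟪x, u⟫_ℝ * ⟪x, v⟫_ℝ := by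
  simp only [casimir, sum_inner, inner_smul_left, RCLike.conj_to_real]

theorem inner_casimir_right (J : Finset B) (u v : V) :
    ⟪u, R.casimir J v⟫_ℝ = ∑ x ∈ R.roots J, ⟪x, u⟫_ℝ * ⟪x, v⟫_ℝ := by
  rw [real_inner_comm, inner_casimir_left]
  exact Finset.sum_congr rfl fun x _ => mul_comm _ _

theorem casimir_root {J : Finset B} {s : B} (hs : s ∈ J) :
    R.casimir J (R.root s) = (2 * R.coxNum J s) • R.root s := by
  have h1 := casimir_rep (R.simple_mem_sub hs) (R.root s)
  rw [rep_simple_self, ← neg_one_smul ℝ (R.root s), casimir_smul, R.rep_simple] at h1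
  have h2 : ⟪R.root s, R.casimir J (R.root s)⟫_ℝ = 4 * R.coxNum J s := by
    rw [inner_casimir_right, coxNum]
    simp only [← sq]
    ring
  rw [h2] at h1
  set x := R.casimir J (R.root s)
  have h3 : (2 : ℝ) • x = (4 * R.coxNum J s) • R.root s := by
    rw [two_smul, ← sub_eq_zero]
    have : x + x - (4 * R.coxNum J s) • R.root s
        = (x - (4 * R.coxNum J s) • R.root s) - (-1 : ℝ) • x := by
      rw [neg_one_smul]; abel
    rw [this, ← h1, sub_self]
  calc x = (1 / 2 : ℝ) • ((2 : ℝ) • x) := by rw [smul_smul]; norm_num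
    _ = _ := by rw [h3, smul_smul]; congr 1; ring

theorem IsComponent.coxNum_eq {J K : Finset B} (hK : R.IsComponent J K) {s t : B} (hs : s ∈ K)
    (ht : t ∈ K) : R.coxNum J s = R.coxNum J t := by
  have := hK.minimal (K.filter fun r => R.coxNum J r = R.coxNum J t) (Finset.filter_subset _ _)
    ⟨t, by simp [ht]⟩ (by
      intro a ha b hb hab
      rw [Finset.mem_filter] at ha ⊢
      refine ⟨hb, ?_⟩
      have h1 := inner_casimir_left (R := R) J (R.root a) (R.root b)
      rw [← inner_casimir_right, casimir_root (hK.subset ha.1), casimir_root (hK.subset hb),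
        inner_smul_left, inner_smul_right] at h1
      have h2 := mul_right_cancel₀ hab h1
      simp only [RCLike.conj_to_real] at h2
      linarith [ha.2])
  have hs' := hs
  rw [← this, Finset.mem_filter] at hs'
  exact hs'.2

theorem IsComponent.casimir_eq {J K : Finset B} (hK : R.IsComponent J K) {s : B} (hs : s ∈ K)
    {u : V} (hu : u ∈ R.span K) : R.casimir J u = (2 * R.coxNum J s) • u := by
  rw [R.eq_sum_of_mem_span hu]
  set f : B → ℝ := fun j => R.root.repr u j
  have : ∀ L ⊆ K, R.casimir J (∑ j ∈ L, f j • R.root j)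
      = (2 * R.coxNum J s) • ∑ j ∈ L, f j • R.root j := by
    intro L
    induction L using Finset.induction_on with
    | empty => intro _; simp [casimir]
    | insert a L ha ih =>
      intro hL
      rw [Finset.sum_insert ha, casimir_add, casimir_smul, ih fun x hx => hL (by simp [hx]),
        casimir_root (hK.subset (hL (by simp))), smul_add, smul_smul, smul_smul,
        hK.coxNum_eq (hL (by simp)) hs, mul_comm]
  exact this K subset_rfl

theorem IsComponent.mem_span_or {J K : Finset B} (hK : R.IsComponent J K) {v : V}
    (hv : v ∈ R.roots J) : v ∈ R.span K ∨ ∀ u ∈ R.span K, ⟪v, u⟫_ℝ = 0 := by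
  rw [mem_roots] at hv
  obtain ⟨w, hw, j, hj, rfl⟩ := R.exists_rep_root_of_mem_span hv.1 hv.2
  by_cases hjK : j ∈ K
  · exact Or.inl (hK.rep_mem_span hw (R.root_mem_span hjK))
  · right
    intro u hu
    rw [R.inner_rep_left]
    exact hK.inner_eq_zero hj hjK (hK.rep_mem_span (inv_mem hw) hu)

theorem sum_inner_sq_of_mem (U : Submodule ℝ V) [FiniteDimensional ℝ U] {v : V} (hv : v ∈ U) :
    ∑ i, ⟪v, (stdOrthonormalBasis ℝ U i : V)⟫_ℝ ^ 2 = ⟪v, v⟫_ℝ := by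
  have := (stdOrthonormalBasis ℝ U).sum_sq_inner_left (⟨v, hv⟩ : U)
  rw [real_inner_self_eq_norm_sq]
  simpa using this

theorem IsComponent.coxNum_mul_card {J K : Finset B} (hK : R.IsComponent J K) {s : B}
    (hs : s ∈ K) : R.coxNum J s * K.card = (R.roots K).card := by
  classical
  have := R.finiteDimensional
  set e := stdOrthonormalBasis ℝ (R.span K)
  have h1 : ∑ i, ⟪(e i : V), R.casimir J (e i : V)⟫_ℝ = 2 * R.coxNum J s * K.card := by
    have h2 : ∀ i, ⟪(e i : V), R.casimir J (e i : V)⟫_ℝ = 2 * R.coxNum J s := by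
      intro i
      have h3 := e.orthonormal.1 i
      rw [hK.casimir_eq hs (e i).2, inner_smul_right, real_inner_self_eq_norm_sq]
      have : ‖(e i : V)‖ = 1 := h3
      rw [this]; ring
    rw [Finset.sum_congr rfl fun i _ => h2 i]
    simp [R.finrank_span, mul_comm]
  have h4 : ∑ i, ⟪(e i : V), R.casimir J (e i : V)⟫_ℝ = ∑ v ∈ R.roots J, if v ∈ R.roots K then 2 else 0 := by
    simp only [inner_casimir_right]
    rw [Finset.sum_comm]
    refine Finset.sum_congr rfl fun v hv => ?_
    by_cases hvK : v ∈ R.roots K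
    · rw [if_pos hvK]
      rw [mem_roots] at hvK
      rw [← hvK.1.inner_self, ← sum_inner_sq_of_mem _ hvK.2]
      exact Finset.sum_congr rfl fun i _ => (sq _).symm
    · rw [if_neg hvK]
      rcases hK.mem_span_or hv with h | h
      · exact absurd (mem_roots.2 ⟨(mem_roots.1 hv).1, h⟩) hvK
      · exact Finset.sum_eq_zero fun i _ => by rw [h _ (e i).2, zero_mul]
  rw [← Finset.sum_filter] at h4
  have h5 : (R.roots J).filter (fun v => v ∈ R.roots K) = R.roots K := by
    ext v
    simp only [Finset.mem_filter, mem_roots]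
    exact ⟨fun h => h.2, fun h => ⟨⟨h.1, R.span_mono hK.subset h.2⟩, h⟩⟩
  rw [h5, h1] at h4
  simp only [Finset.sum_const, nsmul_eq_mul] at h4
  linarith

/-- The orbits of the bipartite Coxeter element, with their length identified. -/
theorem IsColoring.orbits_coxNum {ε : B → Bool} (hε : R.IsColoring ε) {J K : Finset B}
    (hK : R.IsComponent J K) :
    ∃ H : ℕ, 0 < H ∧ (∀ s ∈ K, R.coxNum J s = (H : ℝ)) ∧
      (∀ v ∈ R.span K, R.rep (R.cox ε J ^ H) v = v) ∧
      (∀ v, R.IsRoot v → v ∈ R.span K →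
        ∃ j < H, ∃ r ∈ K, v = R.rep (R.cox ε J ^ j) (R.signed ε r)) ∧
      ∀ j < H, ∀ j' < H, ∀ r ∈ K, ∀ r' ∈ K,
        R.rep (R.cox ε J ^ j) (R.signed ε r) = R.rep (R.cox ε J ^ j') (R.signed ε r') →
          j = j' ∧ r = r' := by
  obtain ⟨H, h0, h1, h2, h3⟩ := hε.orbits hK
  refine ⟨H, h0, ?_, h1, h2, h3⟩
  have hc : (Finset.range H ×ˢ K).card = (R.roots K).card := by
    refine Finset.card_bij (fun p _ => R.rep (R.cox ε J ^ p.1) (R.signed ε p.2)) ?_ ?_ ?_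
    · intro p hp
      rw [Finset.mem_product] at hp
      exact mem_roots.2 ⟨(R.isRoot_signed ε _).rep _,
        hK.rep_mem_span (pow_mem (R.cox_mem ε J) _) (R.signed_mem_span ε hp.2)⟩
    · intro p hp q hq hpq
      simp only [Finset.mem_product, Finset.mem_range] at hp hq
      exact Prod.ext_iff.2 (h3 _ hp.1 _ hq.1 _ hp.2 _ hq.2 hpq)
    · intro v hv
      rw [mem_roots] at hv
      obtain ⟨j, hj, r, hr, rfl⟩ := h2 v hv.1 hv.2
      exact ⟨(j, r), by simp [hj, hr], rfl⟩
  intro s hs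
  have h4 := hK.coxNum_mul_card hs
  rw [← hc, Finset.card_product, Finset.card_range, Nat.cast_mul] at h4
  exact mul_right_cancel₀ (by simpa using hK.nonempty.ne_empty) h4

theorem coxNum_eq_floor {J : Finset B} {s : B} {H : ℕ} (h : R.coxNum J s = (H : ℝ)) :
    ⌊R.coxNum J s⌋₊ = H := by
  rw [h, Nat.floor_natCast]

theorem mem_of_signed_mem_span {ε : B → Bool} {K : Finset B} {s : B}
    (h : R.signed ε s ∈ R.span K) : s ∈ K := by
  have h1 : R.root s ∈ R.span K := by
    rw [signed] at h
    split_ifs at h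
    · exact h
    · exact neg_mem_iff.1 h
  by_contra hs
  have := mem_span_iff R |>.1 h1 s hs
  simp at this

/-- Summing a function invariant under the Coxeter element over the roots. -/
theorem IsColoring.sum_roots {ε : B → Bool} (hε : R.IsColoring ε) (J : Finset B) (g : V → ℝ)
    (hg : ∀ v, g (R.rep (R.cox ε J) v) = g v) :
    ∑ v ∈ R.roots J, g v = ∑ s ∈ J, R.coxNum J s * g (R.signed ε s) := by
  have hgp : ∀ (j : ℕ) v, g (R.rep (R.cox ε J ^ j) v) = g v := by
    intro j v
    induction j with
    | zero => rw [pow_zero, R.rep_one]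
    | succ j ih => rw [pow_succ', rep_mul, hg, ih]
  have key : ∀ s ∈ J, R.coxNum J s * g (R.signed ε s)
      = ∑ j ∈ Finset.range ⌊R.coxNum J s⌋₊, g (R.rep (R.cox ε J ^ j) (R.signed ε s)) := by
    intro s hs
    obtain ⟨K, hsK, hK⟩ := R.exists_component hs
    obtain ⟨H, _, hH, _⟩ := hε.orbits_coxNum hK
    rw [coxNum_eq_floor (hH s hsK), hH s hsK]
    rw [Finset.sum_congr rfl fun j _ => hgp j _]
    simp
  rw [Finset.sum_congr rfl key, Finset.sum_sigma']
  symm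
  refine Finset.sum_bij (fun p _ => R.rep (R.cox ε J ^ p.2) (R.signed ε p.1)) ?_ ?_ ?_ ?_
  · intro p hp
    rw [Finset.mem_sigma] at hp
    exact mem_roots.2 ⟨(R.isRoot_signed ε _).rep _,
      R.rep_mem_span (pow_mem (R.cox_mem ε J) _) (R.signed_mem_span ε hp.1)⟩
  · rintro ⟨s, j⟩ hp ⟨s', j'⟩ hp' hpp
    simp only [Finset.mem_sigma, Finset.mem_range] at hp hp' hpp
    obtain ⟨K, hsK, hK⟩ := R.exists_component hp.1
    obtain ⟨H, _, hH, _, _, h3⟩ := hε.orbits_coxNum hK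
    have hs'K : s' ∈ K := by
      apply mem_of_signed_mem_span (R := R) (ε := ε)
      have h5 : R.signed ε s'
          = R.rep (R.cox ε J ^ j')⁻¹ (R.rep (R.cox ε J ^ j) (R.signed ε s)) := by
        rw [hpp, R.rep_inv_rep]
      rw [h5]
      exact hK.rep_mem_span (inv_mem (pow_mem (R.cox_mem ε J) _))
        (hK.rep_mem_span (pow_mem (R.cox_mem ε J) _) (R.signed_mem_span ε hsK))
    rw [coxNum_eq_floor (hH _ hsK)] at hp
    rw [coxNum_eq_floor (hH _ hs'K)] at hp'
    obtain ⟨rfl, rfl⟩ := h3 _ hp.2 _ hp'.2 _ hsK _ hs'K hpp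
    rfl
  · intro v hv
    rw [mem_roots] at hv
    obtain ⟨w, hw, s, hs, hvs⟩ := R.exists_rep_root_of_mem_span hv.1 hv.2
    obtain ⟨K, hsK, hK⟩ := R.exists_component hs
    obtain ⟨H, _, hH, _, h2, _⟩ := hε.orbits_coxNum hK
    obtain ⟨j, hj, r, hr, h⟩ := h2 v hv.1 (by
      rw [hvs]; exact hK.rep_mem_span hw (R.root_mem_span hsK))
    refine ⟨⟨r, j⟩, ?_, h.symm⟩
    rw [Finset.mem_sigma, Finset.mem_range, coxNum_eq_floor (hH _ hr)]
    exact ⟨hK.subset hr, hj⟩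
  · intro _ _
    rfl

theorem sum_sq_of_inner_eq_zero {J : Finset B} {s : B} (hs : s ∈ J) {u : V} (hu : u ∈ R.span J)
    (h : ∀ r ∈ J, r ≠ s → ⟪R.root r, u⟫_ℝ = 0) :
    ∑ v ∈ R.roots J, ⟪v, u⟫_ℝ ^ 2 = 2 * R.coxNum J s * ⟪u, u⟫_ℝ := by
  have h1 : ∑ v ∈ R.roots J, ⟪v, u⟫_ℝ ^ 2 = ⟪u, R.casimir J u⟫_ℝ := by
    rw [inner_casimir_right]
    exact Finset.sum_congr rfl fun _ _ => sq _
  have h2 : ∀ v ∈ R.span J, ⟪v, u⟫_ℝ = R.root.repr v s * ⟪R.root s, u⟫_ℝ := by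
    intro v hv
    conv_lhs => rw [R.eq_sum_of_mem_span hv]
    rw [sum_inner, Finset.sum_eq_single_of_mem s hs, inner_smul_left]
    · rfl
    · intro r hr hrs
      rw [inner_smul_left, h r hr hrs, mul_zero]
  have h3 : R.casimir J u ∈ R.span J :=
    Submodule.sum_mem _ fun v hv => Submodule.smul_mem _ _ (mem_roots.1 hv).2
  rw [h1, real_inner_comm, h2 _ h3, h2 u hu]
  have h4 : ⟪R.root s, R.casimir J u⟫_ℝ = 2 * R.coxNum J s * ⟪R.root s, u⟫_ℝ := by
    rw [inner_casimir_right, ← inner_casimir_left, casimir_root hs, inner_smul_left]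
    rfl
  -- the operator is diagonal on simple roots, hence on the dual basis
  have h5 : ∀ r ∈ J, ⟪R.root r, R.casimir J u⟫_ℝ = ⟪R.root r, (2 * R.coxNum J s) • u⟫_ℝ := by
    intro r hr
    rw [inner_casimir_right, ← inner_casimir_left, casimir_root hr, inner_smul_left,
      inner_smul_right]
    by_cases hrs : r = s
    · rw [hrs]; rfl
    · rw [h r hr hrs]; simp
  rw [R.eq_of_inner_eq h3 (Submodule.smul_mem _ _ hu) h5, map_smul]
  simp only [Finsupp.smul_apply, smul_eq_mul]
  ring

/-- The Coxeter number of an irreducible group is the order of its bipartite Coxeter element. -/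
theorem orderOf_cox {ε : B → Bool} (hε : R.IsColoring ε)
    (hB : R.IsComponent Finset.univ Finset.univ) (s : B) :
    R.coxNum Finset.univ s = orderOf (R.cox ε Finset.univ) := by
  obtain ⟨H, h0, hH, h1, h2, h3⟩ := hε.orbits_coxNum hB
  rw [hH s (Finset.mem_univ _)]
  have hc : R.cox ε Finset.univ ^ H = 1 :=
    R.eq_one_of_rep fun v => h1 v (by rw [R.span_univ]; trivial)
  congr 1
  refine le_antisymm ?_ (orderOf_le_of_pow_eq_one h0 hc)
  by_contra! hlt
  have := h3 _ hlt 0 h0 s (Finset.mem_univ _) s (Finset.mem_univ _) (by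
    rw [pow_orderOf_eq_one, pow_zero])
  have h6 := orderOf_pos (R.cox ε Finset.univ)
  omega

theorem sum_sq_univ (hB : R.IsComponent Finset.univ Finset.univ) (s : B) (u : V) :
    ∑ v ∈ R.roots Finset.univ, ⟪v, u⟫_ℝ ^ 2 = 2 * R.coxNum Finset.univ s * ⟪u, u⟫_ℝ := by
  have h1 : ∑ v ∈ R.roots Finset.univ, ⟪v, u⟫_ℝ ^ 2 = ⟪u, R.casimir Finset.univ u⟫_ℝ := by
    rw [inner_casimir_right]
    exact Finset.sum_congr rfl fun _ _ => sq _
  rw [h1, hB.casimir_eq (Finset.mem_univ s) (by rw [R.span_univ]; trivial), inner_smul_right]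

end ReflRep

section NestedDistances

variable {V : Type*} [NormedAddCommGroup V] [InnerProductSpace ℝ V] [FiniteDimensional ℝ V]

/-- The squared distance from a vector to a subspace. -/
noncomputable def distSq (U : Submodule ℝ V) (v : V) : ℝ := ‖v - U.starProjection v‖ ^ 2

theorem distSq_eq {U : Submodule ℝ V} {v p : V} (hp : p ∈ U) (h : ∀ u ∈ U, ⟪u, v - p⟫_ℝ = 0) :
    distSq U v = ‖v - p‖ ^ 2 := by
  rw [distSq, Submodule.eq_starProjection_of_mem_orthogonal hp ((Submodule.mem_orthogonal _ _).2 h)]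

theorem distSq_eq_zero {U : Submodule ℝ V} {v : V} (hv : v ∈ U) : distSq U v = 0 := by
  rw [distSq_eq hv (by simp)]
  simp

theorem distSq_map (f : V ≃ₗᵢ[ℝ] V) (U : Submodule ℝ V) (v : V) :
    distSq (U.map (f.toLinearEquiv : V →ₗ[ℝ] V)) (f v) = distSq U v := by
  rw [distSq_eq (p := f (U.starProjection v))]
  · rw [← map_sub, LinearIsometryEquiv.norm_map, distSq]
  · exact ⟨_, Submodule.starProjection_apply_mem U v, rfl⟩
  · rintro _ ⟨u, hu, rfl⟩
    rw [← map_sub]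
    refine (f.inner_map_map _ _).trans ?_
    exact (Submodule.mem_orthogonal _ _).1 (Submodule.sub_starProjection_mem_orthogonal v) u hu

/-- Sums over sequences of vectors of `A` of the squared volumes spanned over a subspace,
weighted by a function of the subspace reached. -/
noncomputable def nestSum (A : Finset V) (G : Submodule ℝ V → ℝ) : ℕ → Submodule ℝ V → ℝ
  | 0, U => G U
  | k + 1, U => ∑ v ∈ A, distSq U v * nestSum A G k (U ⊔ ℝ ∙ v)

theorem nestSum_succ' (A : Finset V) (G : Submodule ℝ V → ℝ) (k : ℕ) (U : Submodule ℝ V) :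
    nestSum A G (k + 1) U =
      nestSum A (fun U => ∑ v ∈ A, distSq U v * G (U ⊔ ℝ ∙ v)) k U := by
  induction k generalizing U with
  | zero => rfl
  | succ k ih =>
    rw [nestSum, nestSum]
    exact Finset.sum_congr rfl fun v _ => by rw [ih]

theorem nestSum_sum {ι : Type*} (I : Finset ι) (A : Finset V) (f : ι → ℝ)
    (G : ι → Submodule ℝ V → ℝ) (k : ℕ) (U : Submodule ℝ V) :
    nestSum A (fun U => ∑ i ∈ I, f i * G i U) k U = ∑ i ∈ I, f i * nestSum A (G i) k U := by
  induction k generalizing U with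
  | zero => rfl
  | succ k ih =>
    simp only [nestSum, ih, Finset.mul_sum]
    rw [Finset.sum_comm]
    exact Finset.sum_congr rfl fun _ _ => Finset.sum_congr rfl fun _ _ => by ring

theorem finrank_sup_singleton {U : Submodule ℝ V} {v : V} (hv : v ∉ U) :
    Module.finrank ℝ ↥(U ⊔ ℝ ∙ v) = Module.finrank ℝ U + 1 := by
  have h0 : v ≠ 0 := by rintro rfl; exact hv U.zero_mem
  have h := Submodule.finrank_sup_add_finrank_inf_eq U (ℝ ∙ v)
  have h1 : U ⊓ ℝ ∙ v = ⊥ := by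
    rw [← disjoint_iff]
    exact (Submodule.disjoint_span_singleton' h0).2 hv
  rw [h1, finrank_bot, finrank_span_singleton h0] at h
  omega

theorem nestSum_congr {A : Finset V} {G G' : Submodule ℝ V → ℝ} (k : ℕ) (U : Submodule ℝ V)
    (S : Set V) (hS : S ⊆ A) (hU : U = Submodule.span ℝ S)
    (h : ∀ S' : Set V, S' ⊆ A →
      Module.finrank ℝ (Submodule.span ℝ S') = Module.finrank ℝ U + k →
      G (Submodule.span ℝ S') = G' (Submodule.span ℝ S')) :
    nestSum A G k U = nestSum A G' k U := by
  induction k generalizing U S with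
  | zero =>
    rw [nestSum, nestSum]
    subst hU
    exact h S hS rfl
  | succ k ih =>
    rw [nestSum, nestSum]
    refine Finset.sum_congr rfl fun v hv => ?_
    by_cases hvU : v ∈ U
    · rw [distSq_eq_zero hvU, zero_mul, zero_mul]
    · rw [ih _ (S ∪ {v}) (Set.union_subset hS (by simpa using hv))
        (by rw [Submodule.span_union, hU])]
      intro S' hS' hd
      refine h S' hS' ?_
      rw [hd, finrank_sup_singleton hvU]
      ring

open Classical in
theorem nestSum_indicator (A : Finset V) (u : V) (k : ℕ) (U : Submodule ℝ V) :
    nestSum A (fun U => if ∀ x ∈ U, ⟪x, u⟫_ℝ = 0 then 1 else 0) k U =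
      if ∀ x ∈ U, ⟪x, u⟫_ℝ = 0 then
        nestSum (A.filter fun v => ⟪v, u⟫_ℝ = 0) (fun _ => 1) k U else 0 := by
  induction k generalizing U with
  | zero => rfl
  | succ k ih =>
    simp only [nestSum, ih]
    have key : ∀ v, (∀ x ∈ U ⊔ ℝ ∙ v, ⟪x, u⟫_ℝ = 0) ↔ (∀ x ∈ U, ⟪x, u⟫_ℝ = 0) ∧ ⟪v, u⟫_ℝ = 0 := by
      intro v
      constructor
      · intro h
        exact ⟨fun x hx => h x (Submodule.mem_sup_left hx),
          h v (Submodule.mem_sup_right (Submodule.mem_span_singleton_self v))⟩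
      · rintro ⟨h1, h2⟩ x hx
        obtain ⟨y, hy, z, hz, rfl⟩ := Submodule.mem_sup.1 hx
        obtain ⟨a, rfl⟩ := Submodule.mem_span_singleton.1 hz
        rw [inner_add_left, h1 y hy, inner_smul_left, h2]
        simp
    by_cases hU : ∀ x ∈ U, ⟪x, u⟫_ℝ = 0
    · rw [if_pos hU, Finset.sum_filter]
      refine Finset.sum_congr rfl fun v _ => ?_
      by_cases hv : ⟪v, u⟫_ℝ = 0
      · rw [if_pos ((key v).2 ⟨hU, hv⟩), if_pos hv]
      · rw [if_neg fun h => hv ((key v).1 h).2, if_neg hv, mul_zero]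
    · rw [if_neg hU]
      refine Finset.sum_eq_zero fun v _ => ?_
      rw [if_neg fun h => hU ((key v).1 h).1, mul_zero]

theorem nestSum_map {A A' : Finset V} (f : V ≃ₗᵢ[ℝ] V) (hA : ∀ v, f v ∈ A' ↔ v ∈ A) (k : ℕ)
    (U : Submodule ℝ V) :
    nestSum A' (fun _ => 1) k (U.map (f.toLinearEquiv : V →ₗ[ℝ] V)) =
      nestSum A (fun _ => 1) k U := by
  induction k generalizing U with
  | zero => rfl
  | succ k ih =>
    rw [nestSum, nestSum]
    symm
    refine Finset.sum_bij (fun v _ => f v) (fun v hv => (hA v).2 hv)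
      (fun _ _ _ _ h => f.injective h) (fun v hv => ⟨f.symm v, ?_, by simp⟩) (fun v hv => ?_)
    · rw [← hA]
      simpa using hv
    · rw [distSq_map, ← ih, Submodule.map_sup, Submodule.map_span, Set.image_singleton]
      rfl

theorem sum_distSq {A : Finset V} {t : ℝ} (hA : ∀ u, ∑ v ∈ A, ⟪v, u⟫_ℝ ^ 2 = t * ⟪u, u⟫_ℝ)
    (U : Submodule ℝ V) :
    ∑ v ∈ A, distSq U v = t * (Module.finrank ℝ V - Module.finrank ℝ U) := by
  set e := stdOrthonormalBasis ℝ Uᗮ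
  have h1 : ∀ v, distSq U v = ∑ i, ⟪v, (e i : V)⟫_ℝ ^ 2 := by
    intro v
    have h2 := Submodule.sub_starProjection_mem_orthogonal (K := U) v
    rw [distSq, ← real_inner_self_eq_norm_sq, ← ReflRep.sum_inner_sq_of_mem _ h2]
    refine Finset.sum_congr rfl fun i _ => ?_
    rw [inner_sub_left, (Submodule.mem_orthogonal _ _).1 (e i).2 _
      (Submodule.starProjection_apply_mem U v), sub_zero]
  simp only [h1]
  rw [Finset.sum_comm]
  have h3 : ∀ i, ∑ v ∈ A, ⟪v, (e i : V)⟫_ℝ ^ 2 = t := by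
    intro i
    have h4 : ‖(e i : V)‖ = 1 := e.orthonormal.1 i
    rw [hA, real_inner_self_eq_norm_sq, h4]
    ring
  rw [Finset.sum_congr rfl fun i _ => h3 i]
  have h5 := Submodule.finrank_add_finrank_orthogonal U
  rw [← h5]
  simp [mul_comm]

theorem nestSum_eq_factorial {A : Finset V} {t : ℝ}
    (hA : ∀ u, ∑ v ∈ A, ⟪v, u⟫_ℝ ^ 2 = t * ⟪u, u⟫_ℝ) (k : ℕ) (U : Submodule ℝ V)
    (hU : Module.finrank ℝ V = Module.finrank ℝ U + k) :
    nestSum A (fun _ => 1) k U = k.factorial * t ^ k := by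
  induction k generalizing U with
  | zero => simp [nestSum]
  | succ k ih =>
    have h1 : ∀ v ∈ A, distSq U v * nestSum A (fun _ => 1) k (U ⊔ ℝ ∙ v)
        = distSq U v * (k.factorial * t ^ k) := by
      intro v _
      by_cases hv : v ∈ U
      · rw [distSq_eq_zero hv, zero_mul, zero_mul]
      · rw [ih]
        rw [finrank_sup_singleton hv, hU]
        ring
    rw [nestSum, Finset.sum_congr rfl h1, ← Finset.sum_mul, sum_distSq hA, hU, Nat.factorial_succ]
    push_cast
    ring

theorem distSq_eq_of_finrank {U X : Submodule ℝ V} {u v : V} (hUX : U ≤ X) (hu : u ∈ X)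
    (hu0 : u ≠ 0) (hUu : ∀ x ∈ U, ⟪x, u⟫_ℝ = 0)
    (hd : Module.finrank ℝ X = Module.finrank ℝ U + 1) (hv : v ∈ X) :
    distSq U v * ⟪u, u⟫_ℝ = ⟪v, u⟫_ℝ ^ 2 := by
  have huu : ⟪u, u⟫_ℝ ≠ 0 := inner_self_ne_zero.2 hu0
  have huU : u ∉ U := fun h => huu (hUu u h)
  have hX : U ⊔ ℝ ∙ u = X := by
    apply Submodule.eq_of_le_of_finrank_eq
    · exact sup_le hUX (by simpa using hu)
    · rw [finrank_sup_singleton huU, hd]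
  rw [← hX] at hv
  obtain ⟨p, hp, z, hz, rfl⟩ := Submodule.mem_sup.1 hv
  obtain ⟨a, rfl⟩ := Submodule.mem_span_singleton.1 hz
  rw [distSq_eq hp (by
    intro x hx
    rw [add_sub_cancel_left, inner_smul_right, hUu x hx, mul_zero]), add_sub_cancel_left,
    inner_add_left, hUu p hp, inner_smul_left, ← real_inner_self_eq_norm_sq, inner_smul_left,
    inner_smul_right]
  simp only [RCLike.conj_to_real]
  ring

end NestedDistances

namespace ReflRep

variable {B W V : Type*} [Fintype B] [DecidableEq B] [Group W] [Fintype W]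
  [NormedAddCommGroup V] [InnerProductSpace ℝ V] (R : ReflRep B W V)

open Classical in
/-- The elements of the standard parabolic subgroup, as a finset. -/
noncomputable def elems (J : Finset B) : Finset W := Finset.univ.filter fun w => w ∈ R.sub J

/-- The fundamental weight of `s` in the span of `J`. -/
noncomputable def weight (J : Finset B) (s : B) : V :=
  (R.exists_mem_span_inner_eq J (Pi.single s 1)).choose

variable {R}

theorem mem_elems {J : Finset B} {w : W} : w ∈ R.elems J ↔ w ∈ R.sub J := by
  simp [elems]

theorem card_elems_pos (J : Finset B) : 0 < (R.elems J).card :=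
  Finset.card_pos.2 ⟨1, mem_elems.2 (one_mem _)⟩

theorem weight_mem (J : Finset B) (s : B) : R.weight J s ∈ R.span J :=
  (R.exists_mem_span_inner_eq J (Pi.single s 1)).choose_spec.1

theorem inner_weight {J : Finset B} (s : B) {b : B} (hb : b ∈ J) :
    ⟪R.root b, R.weight J s⟫_ℝ = if b = s then 1 else 0 := by
  rw [weight, (R.exists_mem_span_inner_eq J (Pi.single s 1)).choose_spec.2 b hb, Pi.single_apply]

theorem dominant_weight (J : Finset B) (s : B) : R.Dominant J (R.weight J s) := by
  intro b hb
  rw [inner_weight s hb]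
  split_ifs <;> norm_num

theorem filter_weight {J : Finset B} (s : B) :
    (J.filter fun j => ⟪R.root j, R.weight J s⟫_ℝ = 0) = J.erase s := by
  ext b
  rw [Finset.mem_filter, Finset.mem_erase, and_comm]
  refine and_congr_left fun hb => ?_
  rw [inner_weight s hb]
  split_ifs with h <;> simp [h]

theorem weight_ne_zero {J : Finset B} {s : B} (hs : s ∈ J) : R.weight J s ≠ 0 := by
  intro h
  have := inner_weight (R := R) s hs
  rw [h] at this
  simp at this

theorem rep_weight_eq {J : Finset B} {s t : B} (hs : s ∈ J) {x : W} (hx : x ∈ R.sub J)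
    {a : ℝ} (ha : 0 < a) (h : R.rep x (R.weight J s) = a • R.weight J t) :
    s = t ∧ x ∈ R.sub (J.erase s) := by
  have hx' : x ∈ R.sub (J.erase s) := by
    rw [← filter_weight (R := R)]
    refine R.mem_sub_of_dominant hx (dominant_weight J s) ?_
    rw [h]
    intro b hb
    rw [inner_smul_right]
    exact mul_nonneg ha.le (dominant_weight J t b hb)
  refine ⟨?_, hx'⟩
  rw [R.rep_eq_of_inner_eq_zero (J := J.erase s) _ hx'] at h
  · by_contra hst
    have h1 := inner_weight (R := R) s hs
    rw [h, inner_smul_right, inner_weight t hs, if_neg hst] at h1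
    simp at h1
  · intro j hj
    rw [Finset.mem_erase] at hj
    rw [inner_weight s hj.2, if_neg hj.1]

theorem rep_weight_of_mem {J : Finset B} {s : B} {x : W} (hx : x ∈ R.sub (J.erase s)) :
    R.rep x (R.weight J s) = R.weight J s :=
  R.rep_eq_of_inner_eq_zero (J := J.erase s) (fun j hj => by
    rw [Finset.mem_erase] at hj
    rw [inner_weight s hj.2, if_neg hj.1]) hx

open Classical in
theorem sum_ray_eq_one {J : Finset B} {u : V} {s₀ : B} (hs₀ : s₀ ∈ J) {w₀ : W}
    (hw₀ : w₀ ∈ R.sub J) {t₀ : ℝ} (ht₀ : 0 < t₀) (h : R.rep w₀ (R.weight J s₀) = t₀ • u) :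
    ∑ s ∈ J, ∑ w ∈ R.elems J,
      (if ∃ t > (0 : ℝ), R.rep w (R.weight J s) = t • u then ((R.elems (J.erase s)).card : ℝ)⁻¹ else 0)
        = 1 := by
  have key : ∀ s ∈ J, ((R.elems J).filter fun w => ∃ t > (0 : ℝ), R.rep w (R.weight J s) = t • u)
      = if s = s₀ then (R.elems (J.erase s₀)).image (w₀ * ·) else ∅ := by
    intro s hs
    have h1 : ∀ w ∈ R.sub J, ∀ t > (0 : ℝ), R.rep w (R.weight J s) = t • u →
        s = s₀ ∧ w₀⁻¹ * w ∈ R.sub (J.erase s) := by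
      intro w hw t ht hwt
      refine rep_weight_eq hs (mul_mem (inv_mem hw₀) hw) (div_pos ht ht₀) ?_
      rw [rep_mul, hwt, ← R.rep_inv_rep w₀ (R.weight J s₀), h, map_smul, map_smul, smul_smul,
        div_mul_cancel₀ _ ht₀.ne']
    split_ifs with hss
    · subst hss
      ext w
      simp only [Finset.mem_filter, Finset.mem_image, mem_elems]
      constructor
      · rintro ⟨hw, t, ht, hwt⟩
        exact ⟨_, (h1 w hw t ht hwt).2, by group⟩
      · rintro ⟨x, hx, rfl⟩
        exact ⟨mul_mem hw₀ (R.sub_mono (Finset.erase_subset _ _) hx), t₀, ht₀, by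
          rw [rep_mul, rep_weight_of_mem hx, h]⟩
    · refine Finset.filter_eq_empty_iff.2 fun w hw => ?_
      rintro ⟨t, ht, hwt⟩
      exact hss (h1 w (mem_elems.1 hw) t ht hwt).1
  have key2 : ∀ s ∈ J, ∑ w ∈ R.elems J,
      (if ∃ t > (0 : ℝ), R.rep w (R.weight J s) = t • u then ((R.elems (J.erase s)).card : ℝ)⁻¹ else 0)
        = if s = s₀ then 1 else 0 := by
    intro s hs
    rw [← Finset.sum_filter, key s hs]
    split_ifs with hss
    · subst hss
      rw [Finset.sum_const, Finset.card_image_of_injective _ (mul_right_injective w₀),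
        nsmul_eq_mul, mul_inv_cancel₀]
      exact_mod_cast (card_elems_pos _).ne'
    · simp
  rw [Finset.sum_congr rfl key2, Finset.sum_ite_eq' J s₀, if_pos hs₀]

theorem exists_ray {J : Finset B} {u : V} (hu : u ∈ R.span J) (hu0 : u ≠ 0) {S : Set V}
    (hS : S ⊆ R.roots J) (hd : Module.finrank ℝ (Submodule.span ℝ S) + 1 = J.card)
    (hSu : ∀ x ∈ S, ⟪x, u⟫_ℝ = 0) :
    ∃ s ∈ J, ∃ w ∈ R.sub J, ∃ t > (0 : ℝ), R.rep w (R.weight J s) = t • u := by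
  have := R.finiteDimensional
  obtain ⟨g, hg, hdom⟩ := R.exists_dominant J u
  set Z := J.filter fun j => ⟪R.root j, R.rep g u⟫_ℝ = 0 with hZ
  have hgu : R.rep g u ∈ R.span J := R.rep_mem_span hg hu
  have h1 : (Submodule.span ℝ S).map ((R.rep g).toLinearEquiv : V →ₗ[ℝ] V) ≤ R.span Z := by
    rw [Submodule.map_span, Submodule.span_le]
    rintro _ ⟨x, hx, rfl⟩
    have hx' := mem_roots.1 (rep_mem_roots hg (hS hx))
    refine R.mem_span_filter_of_inner_eq_zero hdom hx'.1 hx'.2 ?_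
    exact (R.inner_rep g x u).trans (hSu x hx)
  have h2 := Submodule.finrank_mono h1
  rw [R.finrank_span, LinearEquiv.finrank_map_eq] at h2
  have h3 := Finset.card_filter_add_card_filter_not (s := J)
    (fun j => ⟪R.root j, R.rep g u⟫_ℝ = 0)
  rw [← hZ] at h3
  have h4 : ∃ s ∈ J, ⟪R.root s, R.rep g u⟫_ℝ ≠ 0 := by
    by_contra! h
    have h5 := R.inner_eq_zero_of_mem_span h hgu
    rw [R.inner_rep] at h5
    exact hu0 (inner_self_eq_zero.1 h5)
  obtain ⟨s, hs, hs0⟩ := h4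
  have h6 : ∀ r ∈ J, r ≠ s → ⟪R.root r, R.rep g u⟫_ℝ = 0 := by
    intro r hr hrs
    by_contra h
    have := Finset.card_le_one.1 (show (J.filter fun j => ¬ ⟪R.root j, R.rep g u⟫_ℝ = 0).card ≤ 1
      by omega) r (by simp [hr, h]) s (by simp [hs, hs0])
    exact hrs this
  have hpos : 0 < ⟪R.root s, R.rep g u⟫_ℝ := lt_of_le_of_ne (hdom s hs) (Ne.symm hs0)
  have h7 : R.rep g u = ⟪R.root s, R.rep g u⟫_ℝ • R.weight J s := by
    refine R.eq_of_inner_eq hgu (Submodule.smul_mem _ _ (weight_mem J s)) fun r hr => ?_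
    rw [inner_smul_right, inner_weight s hr]
    split_ifs with h
    · rw [h, mul_one]
    · rw [h6 r hr h, mul_zero]
  refine ⟨s, hs, g⁻¹, inv_mem hg, _, inv_pos.2 hpos, ?_⟩
  generalize ⟪R.root s, R.rep g u⟫_ℝ = a at h7 hpos
  rw [← R.rep_inv_rep g u, h7, map_smul, smul_smul, inv_mul_cancel₀ hpos.ne', one_smul]

variable (R) in
/-- The sum of squared volumes of the bases of the span of `J` consisting of roots. -/
noncomputable def volSum [FiniteDimensional ℝ V] (J : Finset B) : ℝ :=
  nestSum (R.roots J) (fun _ => 1) J.card ⊥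

theorem span_le_of_subset_roots {J : Finset B} {S : Set V} (hS : S ⊆ R.roots J) :
    Submodule.span ℝ S ≤ R.span J :=
  Submodule.span_le.2 fun _ hx => (mem_roots.1 (hS hx)).2

open Classical in
theorem sum_distSq_eq_sum_weights [FiniteDimensional ℝ V] {J : Finset B} {S : Set V}
    (hS : S ⊆ R.roots J) (hd : Module.finrank ℝ (Submodule.span ℝ S) + 1 = J.card) :
    ∑ v ∈ R.roots J, distSq (Submodule.span ℝ S) v =
      ∑ s ∈ J, ∑ w ∈ R.elems J, R.coxNum J s * ((R.elems (J.erase s)).card : ℝ)⁻¹ *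
        if ∀ x ∈ Submodule.span ℝ S, ⟪x, R.rep w (R.weight J s)⟫_ℝ = 0 then 1 else 0 := by
  set U := Submodule.span ℝ S with hU
  have hUJ : U ≤ R.span J := span_le_of_subset_roots hS
  have hd' : Module.finrank ℝ (R.span J) = Module.finrank ℝ U + 1 := by
    rw [R.finrank_span, hd]
  obtain ⟨u, hu, hu0, hUu⟩ : ∃ u ∈ R.span J, u ≠ 0 ∧ ∀ x ∈ U, ⟪x, u⟫_ℝ = 0 := by
    have hne : ∃ v ∈ R.span J, v ∉ U := by
      by_contra! h
      have := Submodule.finrank_mono (show R.span J ≤ U from h)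
      omega
    obtain ⟨v, hv, hvU⟩ := hne
    have hp := Submodule.starProjection_apply_mem U v
    refine ⟨v - U.starProjection v, sub_mem hv (hUJ hp), fun h => hvU ?_, fun x hx => ?_⟩
    · rw [sub_eq_zero.1 h]; exact hp
    · exact (Submodule.mem_orthogonal _ _).1 (Submodule.sub_starProjection_mem_orthogonal v) x hx
  set G := ∑ v ∈ R.roots J, distSq U v with hG
  have hval : ∀ s ∈ J, ∀ w ∈ R.sub J, (∀ x ∈ U, ⟪x, R.rep w (R.weight J s)⟫_ℝ = 0) →
      R.coxNum J s = G / 2 := by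
    intro s hs w hw hUw
    have h0 : R.rep w (R.weight J s) ≠ 0 := fun h =>
      weight_ne_zero hs ((R.rep w).map_eq_zero_iff.1 h)
    have h1 : G * ⟪R.weight J s, R.weight J s⟫_ℝ
        = 2 * R.coxNum J s * ⟪R.weight J s, R.weight J s⟫_ℝ := by
      rw [← sum_sq_of_inner_eq_zero hs (weight_mem J s) fun r hr hrs => by
        rw [inner_weight s hr, if_neg hrs], hG, Finset.sum_mul, ← R.inner_rep w,
        ← sum_roots_rep (inv_mem hw) fun v => ⟪v, R.weight J s⟫_ℝ ^ 2]
      refine Finset.sum_congr rfl fun v hv => ?_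
      rw [distSq_eq_of_finrank hUJ (R.rep_mem_span hw (weight_mem J s)) h0 hUw hd'
        (mem_roots.1 hv).2, R.inner_rep_left, inv_inv]
    have h2 := mul_right_cancel₀ (inner_self_ne_zero.2 (weight_ne_zero hs)) h1
    linarith
  have hray : ∀ y ∈ R.span J, y ≠ 0 → ((∀ x ∈ U, ⟪x, y⟫_ℝ = 0) ↔
      (∃ t > (0 : ℝ), y = t • u) ∨ ∃ t > (0 : ℝ), y = t • -u) := by
    intro y hy hy0
    constructor
    · intro h
      have huU : u ∉ U := fun hh => inner_self_ne_zero.2 hu0 (hUu u hh)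
      have hX : U ⊔ ℝ ∙ u = R.span J := by
        apply Submodule.eq_of_le_of_finrank_eq
        · exact sup_le hUJ (by simpa using hu)
        · rw [finrank_sup_singleton huU, hd']
      have hy' := hy
      rw [← hX] at hy'
      obtain ⟨p, hp, z, hz, rfl⟩ := Submodule.mem_sup.1 hy'
      obtain ⟨a, rfl⟩ := Submodule.mem_span_singleton.1 hz
      have hp0 : p = 0 := by
        have := h p hp
        rw [inner_add_right, inner_smul_right, hUu p hp, mul_zero, add_zero] at this
        exact inner_self_eq_zero.1 this
      subst hp0
      rcases lt_trichotomy a 0 with ha | ha | ha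
      · exact Or.inr ⟨-a, by simpa using ha, by simp⟩
      · exact absurd (by simp [ha]) hy0
      · exact Or.inl ⟨a, ha, by simp⟩
    · rintro (⟨t, _, rfl⟩ | ⟨t, _, rfl⟩) x hx
      · rw [inner_smul_right, hUu x hx, mul_zero]
      · rw [inner_smul_right, inner_neg_right, hUu x hx, neg_zero, mul_zero]
  have hexcl : ∀ y : V, (∃ t > (0 : ℝ), y = t • u) → ¬ ∃ t > (0 : ℝ), y = t • -u := by
    rintro y ⟨t, ht, rfl⟩ ⟨t', ht', h⟩
    rw [smul_neg, eq_neg_iff_add_eq_zero, ← add_smul] at h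
    rcases smul_eq_zero.1 h with h | h
    · linarith
    · exact hu0 h
  have hterm : ∀ s ∈ J, ∀ w ∈ R.elems J, (R.coxNum J s * ((R.elems (J.erase s)).card : ℝ)⁻¹ *
        if ∀ x ∈ U, ⟪x, R.rep w (R.weight J s)⟫_ℝ = 0 then 1 else 0) =
      G / 2 * ((if ∃ t > (0 : ℝ), R.rep w (R.weight J s) = t • u then
          ((R.elems (J.erase s)).card : ℝ)⁻¹ else 0) +
        if ∃ t > (0 : ℝ), R.rep w (R.weight J s) = t • -u then
          ((R.elems (J.erase s)).card : ℝ)⁻¹ else 0) := by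
    intro s hs w hw
    rw [mem_elems] at hw
    have hy := R.rep_mem_span hw (weight_mem J s)
    have hy0 : R.rep w (R.weight J s) ≠ 0 := fun h =>
      weight_ne_zero hs ((R.rep w).map_eq_zero_iff.1 h)
    by_cases h : ∀ x ∈ U, ⟪x, R.rep w (R.weight J s)⟫_ℝ = 0
    · rw [if_pos h, hval s hs w hw h]
      rcases (hray _ hy hy0).1 h with h1 | h1
      · rw [if_pos h1, if_neg (hexcl _ h1)]; ring
      · rw [if_pos h1, if_neg fun h2 => hexcl _ h2 h1]; ring
    · have h1 := mt (hray _ hy hy0).2 h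
      rw [not_or] at h1
      rw [if_neg h, if_neg h1.1, if_neg h1.2]
      ring
  rw [Finset.sum_congr rfl fun s hs => Finset.sum_congr rfl (hterm s hs)]
  simp only [← Finset.mul_sum, Finset.sum_add_distrib]
  obtain ⟨s₁, hs₁, w₁, hw₁, t₁, ht₁, h₁⟩ := exists_ray hu hu0 hS hd fun x hx =>
    hUu x (Submodule.subset_span hx)
  obtain ⟨s₂, hs₂, w₂, hw₂, t₂, ht₂, h₂⟩ := exists_ray (neg_mem hu) (neg_ne_zero.2 hu0) hS hd
    fun x hx => by rw [inner_neg_right, hUu x (Submodule.subset_span hx), neg_zero]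
  rw [sum_ray_eq_one hs₁ hw₁ ht₁ h₁, sum_ray_eq_one hs₂ hw₂ ht₂ h₂]
  ring

open Classical in
theorem nestSum_filter_weight [FiniteDimensional ℝ V] {J : Finset B} {s : B} {w : W}
    (hw : w ∈ R.sub J) (k : ℕ) :
    nestSum ((R.roots J).filter fun v => ⟪v, R.rep w (R.weight J s)⟫_ℝ = 0) (fun _ => 1) k ⊥ =
      nestSum (R.roots (J.erase s)) (fun _ => 1) k ⊥ := by
  rw [← nestSum_map (R.rep w) (A := R.roots (J.erase s)) (A' := (R.roots J).filter fun v =>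
    ⟪v, R.rep w (R.weight J s)⟫_ℝ = 0) _ k ⊥, Submodule.map_bot]
  intro v
  rw [Finset.mem_filter, R.inner_rep]
  constructor
  · rintro ⟨h1, h2⟩
    have h3 := mem_roots.1 (rep_mem_roots (inv_mem hw) h1)
    rw [R.rep_inv_rep] at h3
    refine mem_roots.2 ⟨h3.1, ?_⟩
    rw [← filter_weight (R := R)]
    exact R.mem_span_filter_of_inner_eq_zero (dominant_weight J s) h3.1 h3.2 h2
  · intro h
    rw [mem_roots] at h
    refine ⟨rep_mem_roots hw (mem_roots.2 ⟨h.1, R.span_mono (Finset.erase_subset _ _) h.2⟩), ?_⟩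
    refine R.inner_eq_zero_of_mem_span (J := J.erase s) (fun j hj => ?_) h.2
    rw [Finset.mem_erase] at hj
    rw [inner_weight s hj.2, if_neg hj.1]

theorem volSum_eq [FiniteDimensional ℝ V] {J : Finset B} (hJ : J.Nonempty) :
    R.volSum J = ∑ s ∈ J, R.coxNum J s * ((R.elems J).card / (R.elems (J.erase s)).card) *
      R.volSum (J.erase s) := by
  classical
  obtain ⟨k, hk⟩ : ∃ k, J.card = k + 1 := ⟨J.card - 1, by have := hJ.card_pos; omega⟩
  rw [volSum, hk, nestSum_succ', nestSum_congr (G' := fun U => ∑ p ∈ J ×ˢ R.elems J,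
    R.coxNum J p.1 * ((R.elems (J.erase p.1)).card : ℝ)⁻¹ *
      if ∀ x ∈ U, ⟪x, R.rep p.2 (R.weight J p.1)⟫_ℝ = 0 then 1 else 0) k ⊥ ∅ (by simp) (by simp),
    nestSum_sum, Finset.sum_product]
  · refine Finset.sum_congr rfl fun s hs => ?_
    have h1 : ∀ w ∈ R.elems J, R.coxNum J s * ((R.elems (J.erase s)).card : ℝ)⁻¹ *
        nestSum (R.roots J) (fun U =>
          if ∀ x ∈ U, ⟪x, R.rep w (R.weight J s)⟫_ℝ = 0 then 1 else 0) k ⊥ =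
        R.coxNum J s * ((R.elems (J.erase s)).card : ℝ)⁻¹ * R.volSum (J.erase s) := by
      intro w hw
      rw [nestSum_indicator, if_pos (by simp), nestSum_filter_weight (mem_elems.1 hw), volSum,
        Finset.card_erase_of_mem hs, hk, Nat.add_sub_cancel]
    rw [Finset.sum_congr rfl h1, Finset.sum_const, nsmul_eq_mul]
    ring
  · intro S hS hd
    rw [finrank_bot, zero_add] at hd
    simp only [mul_one]
    rw [sum_distSq_eq_sum_weights hS (by rw [hd, hk]), Finset.sum_product]

variable (R) in
/-- The normalised sum of squared volumes. -/
noncomputable def normVol [FiniteDimensional ℝ V] (J : Finset B) : ℝ :=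
  R.volSum J / (2 ^ J.card * (R.elems J).card)

theorem normVol_empty [FiniteDimensional ℝ V] : R.normVol ∅ = 1 := by
  have h : R.elems ∅ = {1} := by
    ext w
    rw [mem_elems, R.sub_empty, Subgroup.mem_bot, Finset.mem_singleton]
  rw [normVol, volSum, h]
  simp [nestSum]

theorem normVol_eq [FiniteDimensional ℝ V] {J : Finset B} (hJ : J.Nonempty) :
    R.normVol J = (1 / 2) * ∑ s ∈ J, R.coxNum J s * R.normVol (J.erase s) := by
  rw [normVol, volSum_eq hJ, Finset.mul_sum, Finset.sum_div]
  refine Finset.sum_congr rfl fun s hs => ?_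
  have h1 : ((R.elems J).card : ℝ) ≠ 0 := by exact_mod_cast (card_elems_pos J).ne'
  have h2 : ((R.elems (J.erase s)).card : ℝ) ≠ 0 := by exact_mod_cast (card_elems_pos _).ne'
  obtain ⟨k, hk⟩ : ∃ k, J.card = k + 1 := ⟨J.card - 1, by have := hJ.card_pos; omega⟩
  rw [normVol, Finset.card_erase_of_mem hs, hk, Nat.add_sub_cancel, pow_succ]
  field_simp

theorem card_mul_normVol_univ [FiniteDimensional ℝ V]
    (hB : R.IsComponent Finset.univ Finset.univ) (s : B) :
    Fintype.card W * R.normVol Finset.univ =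
      (Fintype.card B).factorial * R.coxNum Finset.univ s ^ Fintype.card B := by
  have h1 : R.elems Finset.univ = Finset.univ := by
    ext w
    simp [mem_elems, R.sub_univ]
  have h2 : (Fintype.card W : ℝ) ≠ 0 := by exact_mod_cast Fintype.card_ne_zero
  rw [normVol, volSum, h1, Finset.card_univ, Finset.card_univ,
    nestSum_eq_factorial (sum_sq_univ hB s), mul_pow]
  · field_simp
  · rw [finrank_bot, zero_add, Module.finrank_eq_card_basis R.root]

end ReflRep

section FactorizationCount

variable {G : Type*} [Group G] [DecidableEq G]

/-- The number of ways to reach `1` from `g` by `k` right multiplications by elements of `T`. -/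
def factCount (T : Finset G) : ℕ → G → ℕ
  | 0, g => if g = 1 then 1 else 0
  | k + 1, g => ∑ t ∈ T, factCount T k (g * t)

theorem factCount_conj {T : Finset G} (hT : ∀ x, ∀ t ∈ T, x * t * x⁻¹ ∈ T) (k : ℕ) (x g : G) :
    factCount T k (x * g * x⁻¹) = factCount T k g := by
  induction k generalizing g with
  | zero => simp [factCount]
  | succ k ih =>
    rw [factCount, factCount]
    refine Finset.sum_bij' (fun t _ => x⁻¹ * t * x) (fun t _ => x * t * x⁻¹)
      (fun t ht => by simpa using hT x⁻¹ t ht) (fun t ht => hT x t ht)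
      (fun t _ => by group) (fun t _ => by group) (fun t _ => ?_)
    rw [← ih (g * _)]
    congr 1
    group

theorem exists_list_of_factCount_ne_zero {T : Finset G} (hT : ∀ t ∈ T, t * t = 1) {k : ℕ} {g : G}
    (h : factCount T k g ≠ 0) : ∃ l : List G, l.length = k ∧ (∀ t ∈ l, t ∈ T) ∧ l.prod = g := by
  induction k generalizing g with
  | zero =>
    rw [factCount] at h
    exact ⟨[], rfl, by simp, by by_contra hg; exact h (if_neg (Ne.symm hg))⟩
  | succ k ih =>
    rw [factCount] at h
    obtain ⟨t, ht, h1⟩ := Finset.exists_ne_zero_of_sum_ne_zero h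
    obtain ⟨l, hl, hlT, hlp⟩ := ih h1
    refine ⟨l ++ [t], by simp [hl], ?_, ?_⟩
    · intro x hx
      rcases List.mem_append.1 hx with hx | hx
      · exact hlT x hx
      · rw [List.mem_singleton.1 hx]; exact ht
    · rw [List.prod_append, hlp, List.prod_singleton, mul_assoc, hT t ht, mul_one]

end FactorizationCount

namespace ReflRep

variable {B W V : Type*} [Fintype B] [DecidableEq B] [Group W] [Fintype W] [DecidableEq W]
  [NormedAddCommGroup V] [InnerProductSpace ℝ V] (R : ReflRep B W V)

/-- The finset of reflections. -/
noncomputable def refls : Finset W :=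
  Finset.univ.image fun p : W × B => p.1 * R.simple p.2 * p.1⁻¹

open Classical in
/-- The reflection attached to a root. -/
noncomputable def reflOf (v : V) : W :=
  if h : R.IsRoot v then h.choose * R.simple h.choose_spec.choose * h.choose⁻¹ else 1

variable {R}

theorem mem_refls {t : W} : t ∈ R.refls ↔ ∃ w b, t = w * R.simple b * w⁻¹ := by
  simp only [refls, Finset.mem_image, Finset.mem_univ, true_and, Prod.exists, eq_comm]

theorem refls_conj (x : W) : ∀ t ∈ R.refls, x * t * x⁻¹ ∈ R.refls := by
  intro t ht
  obtain ⟨w, b, rfl⟩ := mem_refls.1 ht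
  exact mem_refls.2 ⟨x * w, b, by group⟩

theorem refls_mul_self : ∀ t ∈ R.refls, t * t = 1 := by
  intro t ht
  obtain ⟨w, b, rfl⟩ := mem_refls.1 ht
  have : w * R.simple b * w⁻¹ * (w * R.simple b * w⁻¹) = w * (R.simple b * R.simple b) * w⁻¹ := by
    group
  rw [this, R.simple_mul_simple, mul_one, mul_inv_cancel]

theorem rep_conj_simple (w : W) (b : B) (v : V) :
    R.rep (w * R.simple b * w⁻¹) v
      = v - ⟪R.rep w (R.root b), v⟫_ℝ • R.rep w (R.root b) := by
  rw [rep_mul, rep_mul, R.rep_simple, map_sub, map_smul, R.rep_rep_inv, R.inner_rep_left]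

theorem rep_reflOf {v : V} (h : R.IsRoot v) (u : V) :
    R.rep (R.reflOf v) u = u - ⟪v, u⟫_ℝ • v := by
  rw [reflOf, dif_pos h, rep_conj_simple, ← h.choose_spec.choose_spec]

theorem reflOf_mem {v : V} (h : R.IsRoot v) : R.reflOf v ∈ R.refls := by
  rw [reflOf, dif_pos h]
  exact mem_refls.2 ⟨_, _, rfl⟩

theorem reflOf_root (b : B) : R.reflOf (R.root b) = R.simple b :=
  R.ext_rep fun u => by rw [rep_reflOf (R.isRoot_root b), R.rep_simple]

theorem reflOf_neg {v : V} (h : R.IsRoot v) : R.reflOf (-v) = R.reflOf v :=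
  R.ext_rep fun u => by
    rw [rep_reflOf h, rep_reflOf h.neg, inner_neg_left, neg_smul_neg]

theorem reflOf_signed (ε : B → Bool) (s : B) : R.reflOf (R.signed ε s) = R.simple s := by
  rw [signed]
  split_ifs
  · exact reflOf_root s
  · rw [reflOf_neg (R.isRoot_root s), reflOf_root]

theorem reflOf_rep (w : W) (v : V) : R.reflOf (R.rep w v) = w * R.reflOf v * w⁻¹ := by
  by_cases h : R.IsRoot v
  · refine R.ext_rep fun u => ?_
    rw [rep_reflOf (h.rep w), rep_mul, rep_mul, rep_reflOf h, map_sub, map_smul, R.rep_rep_inv,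
      R.inner_rep_left]
  · have h' : ¬ R.IsRoot (R.rep w v) := fun h' => h (by simpa [R.rep_inv_rep] using h'.rep w⁻¹)
    rw [reflOf, reflOf, dif_neg h, dif_neg h', mul_one, mul_inv_cancel]

theorem exists_reflOf {t : W} (ht : t ∈ R.refls) : ∃ v, R.IsRoot v ∧ R.reflOf v = t := by
  obtain ⟨w, b, rfl⟩ := mem_refls.1 ht
  exact ⟨R.rep w (R.root b), (R.isRoot_root b).rep w, by rw [reflOf_rep, reflOf_root]⟩

theorem eq_or_eq_neg_of_reflOf {u v : V} (hu : R.IsRoot u) (hv : R.IsRoot v)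
    (h : R.reflOf u = R.reflOf v) : u = v ∨ u = -v := by
  have h1 := rep_reflOf hu u
  rw [h, rep_reflOf hv, hu.inner_self, two_smul] at h1
  set a := ⟪v, u⟫_ℝ with ha
  have h2 : (2 : ℝ) • u = a • v := by
    rw [two_smul, ← sub_eq_zero]
    have : u + u - a • v = (u - a • v) - (u - (u + u)) := by abel
    rw [this, h1, sub_self]
  have h3 : a ^ 2 = 4 := by
    have h4 : ⟪(2 : ℝ) • u, (2 : ℝ) • u⟫_ℝ = ⟪a • v, a • v⟫_ℝ := by rw [h2]
    rw [inner_smul_left, inner_smul_right, inner_smul_left, inner_smul_right, hu.inner_self,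
      hv.inner_self] at h4
    simp only [RCLike.conj_to_real] at h4
    nlinarith
  have h5 : u = (a / 2) • v := by
    rw [div_eq_inv_mul, ← smul_smul, ← h2, smul_smul]
    norm_num
  rcases sq_eq_sq_iff_eq_or_eq_neg.1 (show a ^ 2 = 2 ^ 2 by rw [h3]; norm_num) with h6 | h6
  · left; rw [h5, h6]; norm_num
  · right; rw [h5, h6]; norm_num

theorem sum_roots_reflOf (g : W → ℝ) :
    ∑ v ∈ R.roots Finset.univ, g (R.reflOf v) = 2 * ∑ t ∈ R.refls, g t := by
  classical
  have hmem : ∀ v, v ∈ R.roots Finset.univ ↔ R.IsRoot v := by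
    intro v
    rw [mem_roots, R.span_univ]
    simp
  rw [← Finset.sum_fiberwise_of_maps_to (t := R.refls) (g := R.reflOf)
    (fun v hv => reflOf_mem ((hmem v).1 hv)), Finset.mul_sum]
  refine Finset.sum_congr rfl fun t ht => ?_
  obtain ⟨v, hv, rfl⟩ := exists_reflOf ht
  have h1 : (R.roots Finset.univ).filter (fun u => R.reflOf u = R.reflOf v) = {v, -v} := by
    ext u
    rw [Finset.mem_filter, hmem, Finset.mem_insert, Finset.mem_singleton]
    constructor
    · rintro ⟨h1, h2⟩
      exact eq_or_eq_neg_of_reflOf h1 hv h2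
    · rintro (rfl | rfl)
      · exact ⟨hv, rfl⟩
      · exact ⟨hv.neg, reflOf_neg hv⟩
  have h2 : v ≠ -v := by
    intro h
    rw [eq_neg_iff_add_eq_zero, ← two_smul ℝ] at h
    rcases smul_eq_zero.1 h with h | h
    · norm_num at h
    · exact hv.ne_zero h
  rw [h1, Finset.sum_pair h2, reflOf_neg hv]
  ring

theorem half_mul_half {ε : B → Bool} (hε : R.IsColoring ε) (J : Finset B) (x : Bool) :
    R.half ε J x * R.half ε J x = 1 := by
  refine R.eq_one_of_rep fun v => ?_
  have h : ∀ r ∈ J.filter (ε · = x), ⟪R.root r, R.rep (R.half ε J x) v⟫_ℝ = -⟪R.root r, v⟫_ℝ := by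
    intro r hr
    rw [Finset.mem_filter] at hr
    rw [hε.rep_half, inner_sub_right, inner_sum, Finset.sum_eq_single_of_mem r (by simpa using hr),
      inner_smul_right, R.inner_self]
    · ring
    · intro s hs hsr
      rw [Finset.mem_filter] at hs
      rw [inner_smul_right, hε.inner_eq_zero (Ne.symm hsr) (hr.2.trans hs.2.symm), mul_zero]
  rw [rep_mul, hε.rep_half, Finset.sum_congr rfl fun r hr => by rw [h r hr], hε.rep_half]
  simp

theorem inner_eq_zero_of_rep_cox {ε : B → Bool} (hε : R.IsColoring ε) {J : Finset B} {v : V}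
    (h : R.rep (R.cox ε J) v = v) : ∀ r ∈ J, ⟪R.root r, v⟫_ℝ = 0 := by
  have h1 : R.rep (R.half ε J false) v = R.rep (R.half ε J true) v := by
    conv_rhs => rw [← h]
    rw [cox, ← rep_mul, ← mul_assoc, half_mul_half hε, one_mul]
  rw [hε.rep_half, hε.rep_half, sub_right_inj] at h1
  have h2 : ∀ x r, R.root.repr (∑ s ∈ J.filter (ε · = x), ⟪R.root s, v⟫_ℝ • R.root s) r
      = if r ∈ J.filter (ε · = x) then ⟪R.root r, v⟫_ℝ else 0 := by
    intro x r
    simp [Finsupp.single_apply]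
  intro r hr
  have h3 := congrArg (fun y => R.root.repr y r) h1
  simp only [h2, Finset.mem_filter, hr, true_and] at h3
  cases hx : ε r <;> simp [hx] at h3 <;> simp [h3]

theorem rep_list_sub_mem (l : List V) (hl : ∀ v ∈ l, R.IsRoot v) (u : V) :
    R.rep (l.map R.reflOf).prod u - u ∈ Submodule.span ℝ {v | v ∈ l} := by
  induction l with
  | nil => simp
  | cons v l ih =>
    have h1 := ih fun x hx => hl x (List.mem_cons_of_mem _ hx)
    rw [List.map_cons, List.prod_cons, rep_mul, rep_reflOf (hl v List.mem_cons_self), sub_right_comm]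
    refine sub_mem (Submodule.span_mono (fun x hx => List.mem_cons_of_mem _ hx) h1)
      (Submodule.smul_mem _ _ (Submodule.subset_span List.mem_cons_self))

/-- The span of the roots in a reflection factorisation contains the span of `J`. -/
theorem span_le_of_prod_eq_cox {ε : B → Bool} (hε : R.IsColoring ε) {J : Finset B} (l : List V)
    (hl : ∀ v ∈ l, R.IsRoot v) (h : (l.map R.reflOf).prod = R.cox ε J) :
    R.span J ≤ Submodule.span ℝ {v | v ∈ l} := by
  have := R.finiteDimensional
  let f : V →ₗ[ℝ] V := ((R.rep (R.cox ε J)).toLinearEquiv : V →ₗ[ℝ] V) - LinearMap.id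
  have hf : ∀ v, f v = R.rep (R.cox ε J) v - v := fun v => rfl
  have hle : (R.span J).map f ≤ R.span J := by
    rintro _ ⟨v, hv, rfl⟩
    rw [hf]
    exact sub_mem (R.rep_mem_span (R.cox_mem ε J) hv) hv
  have hinj : ∀ v ∈ R.span J, f v = 0 → v = 0 := by
    intro v hv hv0
    rw [hf, sub_eq_zero] at hv0
    exact inner_self_eq_zero.1
      (R.inner_eq_zero_of_mem_span (inner_eq_zero_of_rep_cox hε hv0) hv)
  have heq : (R.span J).map f = R.span J := by
    apply Submodule.eq_of_le_of_finrank_eq hle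
    have hi : Function.Injective (f.domRestrict (R.span J)) := by
      rw [← LinearMap.ker_eq_bot, LinearMap.ker_eq_bot']
      rintro ⟨v, hv⟩ h0
      exact Subtype.ext (hinj v hv h0)
    have := LinearMap.finrank_range_of_inj hi
    rwa [LinearMap.range_domRestrict] at this
  rw [← heq]
  rintro _ ⟨v, hv, rfl⟩
  rw [hf, ← h]
  exact rep_list_sub_mem l hl v

theorem finrank_span_list_le (l : List V) :
    Module.finrank ℝ (Submodule.span ℝ {v | v ∈ l}) ≤ l.length := by
  classical
  have h := finrank_span_finset_le_card (R := ℝ) l.toFinset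
  have h2 : ((l.toFinset : Finset V) : Set V) = {v | v ∈ l} := by ext; simp
  rw [h2] at h
  exact h.trans l.toFinset_card_le

theorem exists_roots_list {l : List W} (hl : ∀ t ∈ l, t ∈ R.refls) :
    ∃ l' : List V, (∀ v ∈ l', R.IsRoot v) ∧ l'.map R.reflOf = l := by
  induction l with
  | nil => exact ⟨[], by simp, rfl⟩
  | cons t l ih =>
    obtain ⟨l', h1, h2⟩ := ih fun x hx => hl x (List.mem_cons_of_mem _ hx)
    obtain ⟨v, hv, hvt⟩ := exists_reflOf (hl t List.mem_cons_self)
    exact ⟨v :: l', by simpa [hv] using h1, by rw [List.map_cons, hvt, h2]⟩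

/-- A reflection factorisation of the Coxeter element of `J` has length at least `|J|`. -/
theorem card_le_length {ε : B → Bool} (hε : R.IsColoring ε) {J : Finset B} {l : List W}
    (hl : ∀ t ∈ l, t ∈ R.refls) (h : l.prod = R.cox ε J) : J.card ≤ l.length := by
  have := R.finiteDimensional
  obtain ⟨l', h1, rfl⟩ := exists_roots_list hl
  have h2 := Submodule.finrank_mono (span_le_of_prod_eq_cox hε l' h1 h)
  rw [R.finrank_span] at h2
  rw [List.length_map]
  exact h2.trans (finrank_span_list_le l')

theorem factCount_eq_zero {ε : B → Bool} (hε : R.IsColoring ε) {J : Finset B} {k : ℕ}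
    (hk : J.card = k + 1) {v : V} (hv : R.IsRoot v) (hvJ : v ∉ R.span J) :
    factCount R.refls k (R.cox ε J * R.reflOf v) = 0 := by
  have := R.finiteDimensional
  by_contra h
  obtain ⟨l, hl, hlT, hlp⟩ := exists_list_of_factCount_ne_zero refls_mul_self h
  obtain ⟨l', h1, rfl⟩ := exists_roots_list hlT
  have h2 : ((l' ++ [v]).map R.reflOf).prod = R.cox ε J := by
    rw [List.map_append, List.prod_append, hlp, List.map_singleton, List.prod_singleton,
      mul_assoc, refls_mul_self _ (reflOf_mem hv), mul_one]
  have h3 := span_le_of_prod_eq_cox hε (l' ++ [v]) (by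
    intro x hx
    rcases List.mem_append.1 hx with hx | hx
    · exact h1 x hx
    · rw [List.mem_singleton.1 hx]; exact hv) h2
  have h4 := finrank_span_list_le (l' ++ [v])
  have h5 : R.span J = Submodule.span ℝ {x | x ∈ l' ++ [v]} := by
    apply Submodule.eq_of_le_of_finrank_le h3
    rw [R.finrank_span, hk]
    rw [List.length_map] at hl
    simpa [hl] using h4
  exact hvJ (h5 ▸ Submodule.subset_span (by simp))

theorem half_erase_of_ne {ε : B → Bool} (J : Finset B) {s : B} {x : Bool} (h : ε s ≠ x) :
    R.half ε (J.erase s) x = R.half ε J x := by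
  rw [half, half]
  congr 1
  ext b
  simp only [Finset.mem_filter, Finset.mem_erase]
  constructor
  · rintro ⟨⟨_, h1⟩, h2⟩
    exact ⟨h1, h2⟩
  · rintro ⟨h1, h2⟩
    exact ⟨⟨by rintro rfl; exact h h2, h1⟩, h2⟩

theorem half_mul_simple {ε : B → Bool} (hε : R.IsColoring ε) {J : Finset B} {s : B} (hs : s ∈ J) :
    R.half ε J (ε s) * R.simple s = R.half ε (J.erase s) (ε s) ∧
      R.simple s * R.half ε J (ε s) = R.half ε (J.erase s) (ε s) := by
  have hf : J.filter (ε · = ε s) = insert s ((J.erase s).filter (ε · = ε s)) := by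
    ext b
    simp only [Finset.mem_filter, Finset.mem_insert, Finset.mem_erase]
    by_cases hb : b = s
    · subst hb; simp [hs]
    · simp [hb]
  have h0 : ∀ r ∈ (J.erase s).filter (ε · = ε s), ⟪R.root r, R.root s⟫_ℝ = 0 := by
    intro r hr
    rw [Finset.mem_filter, Finset.mem_erase] at hr
    exact hε.inner_eq_zero hr.1.1 hr.2
  have hS : ∀ v, R.rep (R.half ε J (ε s)) v = R.rep (R.half ε (J.erase s) (ε s)) v
      - ⟪R.root s, v⟫_ℝ • R.root s := by
    intro v
    rw [hε.rep_half, hε.rep_half, hf, Finset.sum_insert (by simp)]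
    abel
  have hs1 : R.rep (R.half ε (J.erase s) (ε s)) (R.root s) = R.root s := by
    rw [hε.rep_half, Finset.sum_eq_zero fun r hr => by rw [h0 r hr, zero_smul], sub_zero]
  have hs2 : ∀ v, ⟪R.root s, R.rep (R.half ε (J.erase s) (ε s)) v⟫_ℝ = ⟪R.root s, v⟫_ℝ := by
    intro v
    conv_lhs => rw [← hs1]
    rw [R.inner_rep]
  constructor
  · refine R.ext_rep fun v => ?_
    rw [rep_mul, hS, R.rep_simple, map_sub, map_smul, hs1, inner_sub_right, inner_smul_right,
      R.inner_self, sub_sub, ← add_smul]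
    ring_nf
    simp
  · refine R.ext_rep fun v => ?_
    rw [rep_mul, hS, map_sub, map_smul, R.rep_simple_self, R.rep_simple, hs2]
    simp

theorem factCount_cox_mul_simple {ε : B → Bool} (hε : R.IsColoring ε) {J : Finset B} {s : B}
    (hs : s ∈ J) (k : ℕ) :
    factCount R.refls k (R.cox ε J * R.simple s) = factCount R.refls k (R.cox ε (J.erase s)) := by
  cases hx : ε s
  · have h1 := (half_mul_simple hε hs).1
    rw [hx] at h1
    rw [cox, cox, mul_assoc, h1, half_erase_of_ne J (x := true) (by simp [hx])]
  · have h1 := (half_mul_simple hε hs).2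
    rw [hx] at h1
    rw [← factCount_conj refls_conj k (R.simple s), R.simple_inv, mul_assoc, mul_assoc,
      R.simple_mul_simple, mul_one, cox, cox, ← mul_assoc, h1,
      half_erase_of_ne J (x := false) (by simp [hx])]

theorem factCount_eq {ε : B → Bool} (hε : R.IsColoring ε) {J : Finset B} {k : ℕ}
    (hk : J.card = k + 1) :
    (factCount R.refls (k + 1) (R.cox ε J) : ℝ) =
      (1 / 2) * ∑ s ∈ J, R.coxNum J s * factCount R.refls k (R.cox ε (J.erase s)) := by
  have h1 := sum_roots_reflOf (R := R) fun t => (factCount R.refls k (R.cox ε J * t) : ℝ)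
  have h2 : R.roots J ⊆ R.roots Finset.univ := by
    intro v hv
    rw [mem_roots] at *
    exact ⟨hv.1, R.span_mono (Finset.subset_univ _) hv.2⟩
  rw [← Finset.sum_subset h2 (by
    intro v hv hvJ
    rw [factCount_eq_zero hε hk (mem_roots.1 hv).1 fun h => hvJ (mem_roots.2 ⟨(mem_roots.1 hv).1, h⟩),
      Nat.cast_zero]), hε.sum_roots J _ (by
    intro v
    rw [reflOf_rep, ← factCount_conj refls_conj k (R.cox ε J) (R.cox ε J * R.reflOf v)]
    congr 2
    group)] at h1
  rw [factCount, Nat.cast_sum]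
  have h3 : ∀ s ∈ J, R.coxNum J s * (factCount R.refls k (R.cox ε J * R.reflOf (R.signed ε s)) : ℝ)
      = R.coxNum J s * factCount R.refls k (R.cox ε (J.erase s)) := by
    intro s hs
    rw [reflOf_signed, factCount_cox_mul_simple hε hs]
  rw [Finset.sum_congr rfl h3] at h1
  rw [h1]
  ring

theorem factCount_eq_normVol [FiniteDimensional ℝ V] {ε : B → Bool} (hε : R.IsColoring ε) (k : ℕ)
    {J : Finset B} (hk : J.card = k) : (factCount R.refls k (R.cox ε J) : ℝ) = R.normVol J := by
  induction k generalizing J with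
  | zero =>
    rw [Finset.card_eq_zero] at hk
    subst hk
    rw [normVol_empty]
    simp [factCount, cox, half, prodSimple]
  | succ k ih =>
    rw [factCount_eq hε hk, normVol_eq (Finset.card_pos.1 (by omega))]
    congr 1
    refine Finset.sum_congr rfl fun s hs => ?_
    rw [ih (by rw [Finset.card_erase_of_mem hs, hk, Nat.add_sub_cancel])]

theorem card_mul_factCount {ε : B → Bool} (hε : R.IsColoring ε)
    (hB : R.IsComponent Finset.univ Finset.univ) :
    Fintype.card W * factCount R.refls (Fintype.card B) (R.cox ε Finset.univ) =
      (Fintype.card B).factorial * orderOf (R.cox ε Finset.univ) ^ Fintype.card B := by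
  have := R.finiteDimensional
  obtain ⟨s, _⟩ := hB.nonempty
  have h := card_mul_normVol_univ hB s
  rw [← factCount_eq_normVol hε _ Finset.card_univ, orderOf_cox hε hB] at h
  exact_mod_cast h

end ReflRep

section ForestProducts

variable {B G : Type*} [DecidableEq B] [Group G]

theorem exists_isConj_prod_contract {J : Finset B} {f : B → G} {u v : B} (huv : u ≠ v)
    (hu : u ∈ J) (hv : v ∈ J) (hf : ∀ j ∈ J, j ≠ v → j ≠ u → Commute (f j) (f v))
    {l : List B} (hl : l.Nodup) (hJ : l.toFinset = J) :
    ∃ m : List B, m.Nodup ∧ m.toFinset = J.erase v ∧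
      IsConj (l.map f).prod (m.map (Function.update f u (f u * f v))).prod := by
  obtain ⟨a, b, rfl⟩ := List.append_of_mem (List.mem_toFinset.1 (hJ ▸ hv))
  have hperm : (a ++ v :: b).Perm (v :: (b ++ a)) :=
    List.perm_middle.trans (List.Perm.cons _ List.perm_append_comm)
  have hn := hperm.nodup_iff.1 hl
  rw [List.nodup_cons] at hn
  have hmem : ∀ x, x ∈ b ++ a ↔ x ≠ v ∧ x ∈ J := by
    intro x
    rw [← hJ, List.mem_toFinset, hperm.mem_iff, List.mem_cons]
    constructor
    · intro hx
      exact ⟨fun h => hn.1 (h ▸ hx), Or.inr hx⟩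
    · rintro ⟨h1, h2 | h2⟩
      · exact absurd h2 h1
      · exact h2
  refine ⟨b ++ a, hn.2, ?_, ?_⟩
  · ext x
    rw [List.mem_toFinset, Finset.mem_erase, hmem]
  have h1 : IsConj ((a ++ v :: b).map f).prod (((b ++ a).map f).prod * f v) := by
    refine isConj_iff.2 ⟨(b.map f).prod, ?_⟩
    simp only [List.map_append, List.map_cons, List.prod_append, List.prod_cons]
    group
  refine h1.trans ?_
  obtain ⟨p, q, hpq⟩ := List.append_of_mem ((hmem u).2 ⟨huv, hu⟩)
  rw [hpq] at hn hmem ⊢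
  have hn2 := List.perm_middle.nodup_iff.1 hn.2
  rw [List.nodup_cons, List.mem_append, not_or] at hn2
  have hupd : ∀ r : List B, u ∉ r → r.map (Function.update f u (f u * f v)) = r.map f := by
    intro r hr
    refine List.map_congr_left fun x hx => Function.update_of_ne ?_ _ _
    rintro rfl
    exact hr hx
  have hcomm : Commute (q.map f).prod (f v) := by
    refine Commute.list_prod_left _ _ fun y hy => ?_
    obtain ⟨x, hx, rfl⟩ := List.mem_map.1 hy
    have hx' := (hmem x).1 (by simp [hx])
    refine hf x hx'.2 hx'.1 ?_
    rintro rfl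
    exact hn2.1.2 hx
  have : ((p ++ u :: q).map f).prod * f v =
      ((p ++ u :: q).map (Function.update f u (f u * f v))).prod := by
    simp only [List.map_append, List.map_cons, List.prod_append, List.prod_cons,
      Function.update_self, hupd p hn2.1.1, hupd q hn2.1.2, mul_assoc]
    rw [hcomm.eq]
  rw [this]

/-- If the noncommutation graph of a family of group elements is a forest, all the products of the
family, one factor for each index and in any order, are conjugate. -/
theorem isConj_prod_of_forest {adj : B → B → Prop} (hsymm : ∀ a b, adj a b → adj b a)
    (hleaf : ∀ J : Finset B, J.Nonempty →
      ∃ v ∈ J, ∀ i ∈ J.erase v, ∀ j ∈ J.erase v, adj v i → adj v j → i = j)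
    (J : Finset B) (f : B → G)
    (hf : ∀ a ∈ J, ∀ b ∈ J, a ≠ b → ¬ adj a b → Commute (f a) (f b))
    {l l' : List B} (hl : l.Nodup) (hl' : l'.Nodup) (hJ : l.toFinset = J)
    (hJ' : l'.toFinset = J) : IsConj (l.map f).prod (l'.map f).prod := by
  induction hk : J.card generalizing J f l l' with
  | zero =>
    rw [Finset.card_eq_zero] at hk
    subst hk
    rw [List.toFinset_eq_empty_iff] at hJ hJ'
    subst hJ hJ'
    exact IsConj.refl _
  | succ k ih =>
    obtain ⟨v, hv, hlf⟩ := hleaf J (Finset.card_pos.1 (by omega))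
    by_cases hne : (J.erase v).Nonempty
    · obtain ⟨u, hu, hadj⟩ : ∃ u ∈ J.erase v, ∀ j ∈ J, j ≠ v → j ≠ u → ¬ adj v j := by
        by_cases h : ∃ u ∈ J.erase v, adj v u
        · obtain ⟨u, hu, hvu⟩ := h
          exact ⟨u, hu, fun j hj hjv hju hvj =>
            hju (hlf j (Finset.mem_erase.2 ⟨hjv, hj⟩) u hu hvj hvu)⟩
        · push Not at h
          obtain ⟨u, hu⟩ := hne
          exact ⟨u, hu, fun j hj hjv _ => h j (Finset.mem_erase.2 ⟨hjv, hj⟩)⟩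
      have huJ := Finset.mem_of_mem_erase hu
      have huv := Finset.ne_of_mem_erase hu
      have hfv : ∀ j ∈ J, j ≠ v → j ≠ u → Commute (f j) (f v) := fun j hj hjv hju =>
        hf j hj v hv hjv fun h => hadj j hj hjv hju (hsymm _ _ h)
      obtain ⟨m, hm, hmJ, hc⟩ := exists_isConj_prod_contract huv huJ hv hfv hl hJ
      obtain ⟨m', hm', hmJ', hc'⟩ := exists_isConj_prod_contract huv huJ hv hfv hl' hJ'
      refine hc.trans ((ih (J.erase v) _ ?_ hm hm' hmJ hmJ'
        (by rw [Finset.card_erase_of_mem hv, hk]; rfl)).trans hc'.symm)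
      have key : ∀ b ∈ J.erase v, u ≠ b → ¬ adj u b → Commute (f u * f v) (f b) :=
        fun b hb hub hnab => Commute.mul_left
          (hf u huJ b (Finset.mem_of_mem_erase hb) hub hnab)
          (hfv b (Finset.mem_of_mem_erase hb) (Finset.ne_of_mem_erase hb) (Ne.symm hub)).symm
      intro a ha b hb hab hnab
      by_cases hau : a = u
      · subst hau
        rw [Function.update_self, Function.update_of_ne (Ne.symm hab)]
        exact key b hb hab hnab
      · rw [Function.update_of_ne hau]
        by_cases hbu : b = u
        · subst hbu
          rw [Function.update_self]
          exact (key a ha (Ne.symm hab) fun h => hnab (hsymm _ _ h)).symm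
        · rw [Function.update_of_ne hbu]
          exact hf a (Finset.mem_of_mem_erase ha) b (Finset.mem_of_mem_erase hb) hab hnab
    · have h1 : J = {v} := by
        rw [Finset.not_nonempty_iff_eq_empty, Finset.erase_eq_empty_iff] at hne
        rcases hne with h | h
        · simp [h] at hv
        · exact h
      have : ∀ r : List B, r.Nodup → r.toFinset = J → r = [v] := by
        intro r hr hrJ
        refine List.perm_singleton.1 (List.perm_of_nodup_nodup_toFinset_eq hr (by simp) ?_)
        rw [hrJ, h1]
        simp
      rw [this l hl hJ, this l' hl' hJ']

end ForestProducts

namespace ReflRep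

variable {B W V : Type*} [Fintype B] [DecidableEq B] [Group W] [Fintype W] [DecidableEq W]
  [NormedAddCommGroup V] [InnerProductSpace ℝ V] (R : ReflRep B W V)

/-- The Dynkin diagram has no cycle: every nonempty set of vertices has a leaf. -/
theorem exists_leaf {J : Finset B} (hJ : J.Nonempty) :
    ∃ v ∈ J, ∀ i ∈ J.erase v, ∀ j ∈ J.erase v,
      ⟪R.root v, R.root i⟫_ℝ ≠ 0 → ⟪R.root v, R.root j⟫_ℝ ≠ 0 → i = j := by
  by_contra! hcon
  have h1 : ∀ v ∈ J, ⟪R.root v, ∑ j ∈ J, R.root j⟫_ℝ ≤ 0 := by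
    intro v hv
    obtain ⟨i, hi, j, hj, hvi, hvj, hij⟩ := hcon v hv
    have hj' : j ∈ (J.erase v).erase i := Finset.mem_erase.2 ⟨Ne.symm hij, hj⟩
    rw [inner_sum, ← Finset.add_sum_erase J _ hv, ← Finset.add_sum_erase _ _ hi,
      ← Finset.add_sum_erase _ _ hj', R.inner_self]
    have hrest : ∑ x ∈ ((J.erase v).erase i).erase j, ⟪R.root v, R.root x⟫_ℝ ≤ 0 := by
      refine Finset.sum_nonpos fun x hx => R.inner_root_nonpos ?_
      exact (Finset.ne_of_mem_erase
        (Finset.mem_of_mem_erase (Finset.mem_of_mem_erase hx))).symm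
    have hi2 := (R.inner_trichotomy v i (Finset.ne_of_mem_erase hi).symm).resolve_left hvi
    have hj2 := (R.inner_trichotomy v j (Finset.ne_of_mem_erase hj).symm).resolve_left hvj
    linarith
  have h2 : ⟪∑ j ∈ J, R.root j, ∑ j ∈ J, R.root j⟫_ℝ ≤ 0 := by
    rw [sum_inner]
    exact Finset.sum_nonpos h1
  have h3 : ∑ j ∈ J, R.root j = 0 := inner_self_eq_zero.1 (le_antisymm h2 real_inner_self_nonneg)
  obtain ⟨j, hj⟩ := hJ
  exact one_ne_zero (linearIndependent_iff'.1 R.root.linearIndependent J (fun _ => (1 : ℝ))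
    (by simpa using h3) j hj)

theorem exists_isColoring : ∃ ε : B → Bool, R.IsColoring ε := by
  suffices h : ∀ k, ∀ J : Finset B, J.card = k → ∃ ε : B → Bool, ∀ a ∈ J, ∀ b ∈ J, a ≠ b →
      ⟪R.root a, R.root b⟫_ℝ ≠ 0 → ε a ≠ ε b by
    obtain ⟨ε, hε⟩ := h _ Finset.univ rfl
    exact ⟨ε, fun a b => hε a (Finset.mem_univ _) b (Finset.mem_univ _)⟩
  intro k
  induction k with
  | zero =>
    intro J hJ
    rw [Finset.card_eq_zero] at hJ
    subst hJ
    exact ⟨fun _ => true, by simp⟩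
  | succ k ih =>
    intro J hJ
    obtain ⟨v, hv, hlf⟩ := R.exists_leaf (Finset.card_pos.1 (by omega : 0 < J.card))
    obtain ⟨ε, hε⟩ := ih (J.erase v) (by rw [Finset.card_erase_of_mem hv, hJ]; rfl)
    obtain ⟨x, hx⟩ : ∃ x : Bool, ∀ j ∈ J.erase v, ⟪R.root v, R.root j⟫_ℝ ≠ 0 → x ≠ ε j := by
      by_cases h : ∃ u ∈ J.erase v, ⟪R.root v, R.root u⟫_ℝ ≠ 0
      · obtain ⟨u, hu, hvu⟩ := h
        refine ⟨!ε u, fun j hj hvj => ?_⟩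
        rw [hlf j hj u hu hvj hvu]
        simp
      · push Not at h
        exact ⟨true, fun j hj hvj => absurd (h j hj) hvj⟩
    refine ⟨Function.update ε v x, fun a ha b hb hab h => ?_⟩
    by_cases hav : a = v
    · subst hav
      rw [Function.update_self, Function.update_of_ne (Ne.symm hab)]
      exact hx b (Finset.mem_erase.2 ⟨Ne.symm hab, hb⟩) h
    · rw [Function.update_of_ne hav]
      by_cases hbv : b = v
      · subst hbv
        rw [Function.update_self]
        exact (hx a (Finset.mem_erase.2 ⟨hab, ha⟩) (by rwa [real_inner_comm])).symm
      · rw [Function.update_of_ne hbv]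
        exact hε a (Finset.mem_erase.2 ⟨hav, ha⟩) b (Finset.mem_erase.2 ⟨hbv, hb⟩) hab h

theorem commute_simple {a b : B} (h : ⟪R.root a, R.root b⟫_ℝ = 0) :
    Commute (R.simple a) (R.simple b) := by
  refine R.ext_rep fun v => ?_
  have h' : ⟪R.root b, R.root a⟫_ℝ = 0 := by rwa [real_inner_comm]
  simp only [rep_mul, R.rep_simple, inner_sub_right, inner_smul_right, h, h', mul_zero, sub_zero]
  abel

theorem simple_injective : Function.Injective R.simple := by
  intro a b h
  by_contra hab
  rw [← R.reflOf_root a, ← R.reflOf_root b] at h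
  rcases R.eq_or_eq_neg_of_reflOf (R.isRoot_root a) (R.isRoot_root b) h with h1 | h1
  · exact hab (R.root_inj h1)
  · have := congrArg (fun v => R.root.repr v a) h1
    simp [Ne.symm hab] at this

theorem isConj_cox (ε : B → Bool) {c : W}
    (hc : IsCoxeterElementOf (Set.range R.simple) c) : IsConj (R.cox ε Finset.univ) c := by
  obtain ⟨l, hl, hmem, rfl⟩ := hc
  obtain ⟨l', rfl⟩ : ∃ l' : List B, l'.map R.simple = l := by
    have : l ∈ Set.range (List.map R.simple) := by
      rw [Set.range_list_map]
      exact fun x hx => (hmem x).1 hx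
    exact this
  have hset : ∀ x : Bool, ((Finset.univ : Finset B).filter fun j => ε j = x).toList.toFinset =
      Finset.univ.filter fun j => ε j = x := fun x => Finset.toList_toFinset _
  rw [cox, half, half, prodSimple, prodSimple, ← List.prod_append, ← List.map_append]
  refine isConj_prod_of_forest (adj := fun a b => ⟪R.root a, R.root b⟫_ℝ ≠ 0)
    (fun a b h => by rwa [real_inner_comm]) (fun J hJ => R.exists_leaf hJ) Finset.univ R.simple
    (fun a _ b _ _ h => R.commute_simple (not_not.1 h)) ?_ hl.of_map ?_ ?_
  · refine (Finset.nodup_toList _).append (Finset.nodup_toList _) ?_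
    intro x hx hx'
    simp only [Finset.mem_toList, Finset.mem_filter] at hx hx'
    rw [hx.2] at hx'
    exact absurd hx'.2 (by simp)
  · ext x
    simp only [List.toFinset_append, Finset.mem_union, List.mem_toFinset, Finset.mem_toList,
      Finset.mem_filter, Finset.mem_univ, true_and, iff_true]
    cases ε x <;> simp
  · ext x
    obtain ⟨y, hy, hyx⟩ := List.mem_map.1 ((hmem (R.simple x)).2 ⟨x, rfl⟩)
    simp [← R.simple_injective hyx, hy]

theorem isComponent_univ (hne : Nonempty B)
    (h : ∀ A : Set B, (∀ a ∈ A, ∀ b ∈ Aᶜ, Commute (R.simple a) (R.simple b)) →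
      A = ∅ ∨ A = Set.univ) : R.IsComponent Finset.univ Finset.univ where
  subset := Finset.Subset.refl _
  nonempty := Finset.univ_nonempty
  closed _ _ b _ _ := Finset.mem_univ b
  minimal A _ hA hcl := by
    have h1 := h (A : Set B) fun a ha b hb => R.commute_simple (by
      by_contra hab
      exact hb (hcl a ha b (Finset.mem_univ _) hab))
    rcases h1 with h1 | h1
    · exact absurd (Finset.coe_eq_empty.1 h1) hA.ne_empty
    · exact Finset.coe_eq_univ.1 h1

end ReflRep

/-- The number of minimal reflection factorisations of a Coxeter element. -/
theorem card_mul_factCount_coxeterElement {B W : Type} [Fintype B] [DecidableEq B] [Group W]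
    [Fintype W] [DecidableEq W] {M : CoxeterMatrix B} (cs : CoxeterSystem M W)
    (hirr : IsIrreducibleCS cs) {c : W} (hc : IsCoxeterElementOf (simpleSet cs) c) :
    ∃ T : Finset W, (∀ t, t ∈ T ↔ IsReflectionOf (simpleSet cs) t) ∧
      (∀ l : List W, (∀ t ∈ l, t ∈ T) → l.prod = c → Fintype.card B ≤ l.length) ∧
      Fintype.card W * factCount T (Fintype.card B) c =
        (Fintype.card B).factorial * orderOf c ^ Fintype.card B := by
  obtain ⟨V, R, hR⟩ := exists_reflRep cs hirr
  obtain ⟨ε, hε⟩ := R.exists_isColoring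
  have hcomp : R.IsComponent Finset.univ Finset.univ :=
    R.isComponent_univ hirr.1 (by rw [hR]; exact hirr.2)
  have hc' : IsCoxeterElementOf (Set.range R.simple) c := by rw [hR]; exact hc
  obtain ⟨g, rfl⟩ := isConj_iff.1 (R.isConj_cox ε hc')
  refine ⟨R.refls, fun t => ?_, fun l hl hp => ?_, ?_⟩
  · rw [R.mem_refls, IsReflectionOf, simpleSet, hR]
    simp
  · have := R.card_le_length hε (J := Finset.univ) (l := l.map fun t => g⁻¹ * t * g) ?_ ?_
    · simpa using this
    · intro t ht
      obtain ⟨x, hx, rfl⟩ := List.mem_map.1 ht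
      simpa using R.refls_conj g⁻¹ x (hl x hx)
    · have h1 : (l.map fun t => g⁻¹ * t * g) = l.map (MulAut.conj g⁻¹) := by simp
      rw [h1, ← map_list_prod, hp]
      simp [mul_assoc]
  · have h1 : orderOf (g * R.cox ε Finset.univ * g⁻¹) = orderOf (R.cox ε Finset.univ) := by
      have := orderOf_injective (MulAut.conj g).toMonoidHom (MulAut.conj g).injective
        (R.cox ε Finset.univ)
      simpa using this
    rw [factCount_conj R.refls_conj, R.card_mul_factCount hε hcomp, h1]

section AbsoluteLength

variable {G : Type*} [Group G]

/-- `T` is the set of reflections attached to `S`; it consists of involutions and generates `G`. -/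
structure IsReflectionSet (S : Set G) (T : Finset G) : Prop where
  mem_iff : ∀ t, t ∈ T ↔ IsReflectionOf S t
  exists_list : ∀ g, ∃ l : List G, (∀ t ∈ l, t ∈ T) ∧ l.prod = g
  mul_self : ∀ t ∈ T, t * t = 1

namespace IsReflectionSet

variable {S : Set G} {T : Finset G}

theorem absLength_le (hT : IsReflectionSet S T) {l : List G} (hl : ∀ t ∈ l, t ∈ T) : absLength S l.prod ≤ l.length :=
  Nat.sInf_le ⟨l, fun t ht => (hT.mem_iff t).1 (hl t ht), rfl, rfl⟩

theorem exists_list_length (hT : IsReflectionSet S T) (g : G) :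
    ∃ l : List G, (∀ t ∈ l, t ∈ T) ∧ l.length = absLength S g ∧ l.prod = g := by
  obtain ⟨l, hl, hp⟩ := hT.exists_list g
  obtain ⟨l', h1, h2, h3⟩ := Nat.sInf_mem
    (s := {k | ∃ l : List G, (∀ t ∈ l, IsReflectionOf S t) ∧ l.length = k ∧ l.prod = g})
    ⟨_, l, fun t ht => (hT.mem_iff t).1 (hl t ht), rfl, hp⟩
  exact ⟨l', fun t ht => (hT.mem_iff t).2 (h1 t ht), h2, h3⟩

theorem conj_mem (hT : IsReflectionSet S T) (x : G) {t : G} (ht : t ∈ T) : x * t * x⁻¹ ∈ T := by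
  rw [hT.mem_iff] at ht ⊢
  obtain ⟨g, s, hs, rfl⟩ := ht
  exact ⟨x * g, s, hs, by group⟩

theorem absLength_mul_le (hT : IsReflectionSet S T) (g h : G) : absLength S (g * h) ≤ absLength S g + absLength S h := by
  obtain ⟨l, hl, hlen, hp⟩ := hT.exists_list_length g
  obtain ⟨l', hl', hlen', hp'⟩ := hT.exists_list_length h
  rw [← hlen, ← hlen', ← List.length_append]
  conv_lhs => rw [← hp, ← hp', ← List.prod_append]
  refine hT.absLength_le fun t ht => ?_
  rcases List.mem_append.1 ht with h | h
  · exact hl t h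
  · exact hl' t h

theorem absLength_conj_le (hT : IsReflectionSet S T) (x g : G) : absLength S (x * g * x⁻¹) ≤ absLength S g := by
  obtain ⟨l, hl, hlen, hp⟩ := hT.exists_list_length g
  have h1 : (l.map (MulAut.conj x)).prod = x * g * x⁻¹ := by
    rw [← map_list_prod, hp, MulAut.conj_apply]
  rw [← hlen, ← h1, ← List.length_map (MulAut.conj x)]
  refine hT.absLength_le fun t ht => ?_
  obtain ⟨y, hy, rfl⟩ := List.mem_map.1 ht
  exact hT.conj_mem x (hl y hy)

theorem absLength_one (hT : IsReflectionSet S T) : absLength S (1 : G) = 0 := by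
  simpa using hT.absLength_le (l := []) (by simp)

theorem eq_one_of_absLength (hT : IsReflectionSet S T) {g : G} (h : absLength S g = 0) : g = 1 := by
  obtain ⟨l, -, hlen, hp⟩ := hT.exists_list_length g
  rw [h, List.length_eq_zero_iff] at hlen
  rw [← hp, hlen, List.prod_nil]

theorem absLength_le_one (hT : IsReflectionSet S T) {t : G} (ht : t ∈ T) : absLength S t ≤ 1 := by
  simpa using hT.absLength_le (l := [t]) (by simpa using ht)

theorem mem_of_absLength (hT : IsReflectionSet S T) {g : G} (h : absLength S g = 1) : g ∈ T := by
  obtain ⟨l, hl, hlen, hp⟩ := hT.exists_list_length g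
  rw [h, List.length_eq_one_iff] at hlen
  obtain ⟨a, rfl⟩ := hlen
  rw [List.prod_singleton] at hp
  exact hp ▸ hl a (by simp)

theorem absLength_prod_le (hT : IsReflectionSet S T) {d : ℕ} (τ : Fin d → G) :
    absLength S (List.ofFn τ).prod ≤ ∑ i, absLength S (τ i) := by
  induction d with
  | zero => simp [hT.absLength_one]
  | succ d ih =>
    rw [List.ofFn_succ, List.prod_cons, Fin.sum_univ_succ]
    exact (hT.absLength_mul_le _ _).trans (Nat.add_le_add_left (ih _) _)

theorem absLength_add_le (hT : IsReflectionSet S T) {d : ℕ} (τ : Fin d → G) (k : Fin d) :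
    absLength S (τ k) + absLength S ((τ k)⁻¹ * (List.ofFn τ).prod) ≤ ∑ i, absLength S (τ i) := by
  induction d with
  | zero => exact k.elim0
  | succ d ih =>
    rw [List.ofFn_succ, List.prod_cons, Fin.sum_univ_succ]
    cases k using Fin.cases with
    | zero =>
      rw [inv_mul_cancel_left]
      exact Nat.add_le_add_left (hT.absLength_prod_le _) _
    | succ k =>
      have h1 := ih (fun i => τ i.succ) k
      have h2 := hT.absLength_mul_le ((τ k.succ)⁻¹ * τ 0 * (τ k.succ)⁻¹⁻¹)
        ((τ k.succ)⁻¹ * (List.ofFn fun i => τ i.succ).prod)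
      have h3 := hT.absLength_conj_le (τ k.succ)⁻¹ (τ 0)
      have h4 : (τ k.succ)⁻¹ * τ 0 * (τ k.succ)⁻¹⁻¹ *
          ((τ k.succ)⁻¹ * (List.ofFn fun i => τ i.succ).prod) =
          (τ k.succ)⁻¹ * (τ 0 * (List.ofFn fun i => τ i.succ).prod) := by group
      rw [h4] at h2
      omega

theorem isMDivisibleNC_iff (hT : IsReflectionSet S T) {c : G} {n d : ℕ} (hc : absLength S c = n) (δ : Fin (d + 1) → G) :
    IsMDivisibleNC S c n d δ ↔ (List.ofFn δ).prod = c ∧ ∑ i, absLength S (δ i) = n := by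
  refine ⟨fun h => h.2, fun h => ⟨fun i => ?_, h⟩⟩
  have h1 := hT.absLength_add_le δ i
  have h2 := hT.absLength_mul_le (δ i) ((δ i)⁻¹ * c)
  rw [mul_inv_cancel_left] at h2
  rw [h.1, h.2] at h1
  rw [absLe]
  omega

theorem absLength_le_of_factCount (hT : IsReflectionSet S T) [DecidableEq G] {k : ℕ} {g : G} (h : factCount T k g ≠ 0) :
    absLength S g ≤ k := by
  obtain ⟨l, rfl, hl, rfl⟩ := exists_list_of_factCount_ne_zero hT.mul_self h
  exact hT.absLength_le hl

end IsReflectionSet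

theorem exists_prod_update {d : ℕ} (τ : Fin d → G) (i : Fin d) :
    ∃ r, ∀ s, (List.ofFn (Function.update τ i (τ i * s))).prod =
      r * s * r⁻¹ * (List.ofFn τ).prod := by
  induction d with
  | zero => exact i.elim0
  | succ d ih =>
    cases i using Fin.cases with
    | zero =>
      refine ⟨τ 0, fun s => ?_⟩
      simp only [List.ofFn_succ, List.prod_cons, Function.update_self]
      have : ∀ k : Fin d, Function.update τ 0 (τ 0 * s) k.succ = τ k.succ := fun k =>
        Function.update_of_ne (Fin.succ_ne_zero k) _ _
      simp only [this]
      group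
    | succ i =>
      obtain ⟨r, hr⟩ := ih (fun k => τ k.succ) i
      refine ⟨τ 0 * r, fun s => ?_⟩
      have h1 : (fun k : Fin d => Function.update τ i.succ (τ i.succ * s) k.succ) =
          Function.update (fun k => τ k.succ) i (τ i.succ * s) := by
        ext k
        by_cases hk : k = i
        · subst hk; simp
        · rw [Function.update_of_ne hk, Function.update_of_ne fun h => hk (Fin.succ_injective _ h)]
      rw [List.ofFn_succ, List.prod_cons, h1, hr, Function.update_of_ne (Fin.succ_ne_zero i).symm,
        List.ofFn_succ, List.prod_cons]
      group

end AbsoluteLength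

section Paths

variable {X : Type*} [Fintype X]

open Classical in
/-- The number of walks of length `k` starting at a given vertex. -/
noncomputable def walkCount (step : X → X → Prop) : ℕ → X → ℕ
  | 0, _ => 1
  | k + 1, a => ∑ b with step a b, walkCount step k b

theorem card_walks (step : X → X → Prop) (k : ℕ) (a : X) :
    Nat.card {p : Fin (k + 1) → X // p 0 = a ∧ ∀ t : Fin k, step (p t.castSucc) (p t.succ)} =
      walkCount step k a := by
  classical
  induction k generalizing a with
  | zero =>
    rw [walkCount, Nat.card_eq_one_iff_unique]
    refine ⟨⟨fun p q => Subtype.ext (funext fun i => ?_)⟩, ⟨⟨fun _ => a, rfl, fun t => t.elim0⟩⟩⟩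
    rw [Fin.fin_one_eq_zero i, p.2.1, q.2.1]
  | succ k ih =>
    let e : (Σ b : {b // step a b},
        {p : Fin (k + 1) → X // p 0 = b ∧ ∀ t : Fin k, step (p t.castSucc) (p t.succ)}) →
        {p : Fin (k + 2) → X // p 0 = a ∧ ∀ t : Fin (k + 1), step (p t.castSucc) (p t.succ)} :=
      fun x => ⟨Fin.cons a x.2.1, rfl, fun t => by
        cases t using Fin.cases with
        | zero =>
          have := x.1.2
          rw [← x.2.2.1] at this
          simpa using this
        | succ t => simpa [← Fin.succ_castSucc] using x.2.2.2 t⟩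
    have he : Function.Bijective e := by
      constructor
      · rintro ⟨⟨b, hb⟩, p, hpb, hp⟩ ⟨⟨b', hb'⟩, p', hpb', hp'⟩ h
        have h1 : (Fin.cons a p : Fin (k + 2) → X) = Fin.cons a p' := congrArg Subtype.val h
        obtain rfl : p = p' := Fin.cons_right_injective (α := fun _ => X) a h1
        obtain rfl : b = b' := hpb.symm.trans hpb'
        rfl
      · rintro ⟨p, rfl, hp⟩
        refine ⟨⟨⟨p 1, hp 0⟩, Fin.tail p, rfl, fun t => ?_⟩, Subtype.ext (Fin.cons_self_tail p)⟩
        have := hp t.succ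
        rwa [← Fin.succ_castSucc] at this
    rw [← Nat.card_congr (Equiv.ofBijective e he), Nat.card_sigma, walkCount,
      Finset.sum_subtype (p := step a) _ (by simp)]
    exact Finset.sum_congr rfl fun b _ => ih b

end Paths

section MaximalChains

variable {G : Type*} [Group G]

/-- The covering relation of the poset of `d`-divisible noncrossing partitions. -/
def MDivCovers (S : Set G) (c : G) (n d : ℕ) (δ δ' : Fin (d + 1) → G) : Prop :=
  IsMDivisibleNC S c n d δ' ∧ mDivLe S δ δ' ∧ mDivRank S δ' = mDivRank S δ + 1

namespace IsReflectionSet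

variable {S : Set G} {T : Finset G}

theorem covers_cons (hT : IsReflectionSet S T) {c : G} {n d j : ℕ} (hc : absLength S c = n)
    {δ : Fin (d + 1) → G} (hδ : IsMDivisibleNC S c n d δ) (h0 : absLength S (δ 0) = j + 1)
    {t : G} (ht : t ∈ T) (hj : absLength S (δ 0 * t) ≤ j) (i : Fin d) {r : G}
    (hr : ∀ s, (List.ofFn (Function.update (Fin.tail δ) i (δ i.succ * s))).prod =
      r * s * r⁻¹ * (List.ofFn (Fin.tail δ)).prod) :
    MDivCovers S c n d δ (Fin.cons (δ 0 * t)
      (Function.update (Fin.tail δ) i (δ i.succ * (r⁻¹ * t * r)))) := by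
  obtain ⟨-, hp, hs⟩ := hδ
  rw [List.ofFn_succ, List.prod_cons] at hp
  rw [Fin.sum_univ_succ, h0, ← Finset.add_sum_erase _ _ (Finset.mem_univ i)] at hs
  set τ' := Function.update (Fin.tail δ) i (δ i.succ * (r⁻¹ * t * r)) with hτ'
  have hi : τ' i = δ i.succ * (r⁻¹ * t * r) := Function.update_self _ _ _
  have hk : ∀ k, k ≠ i → τ' k = δ k.succ := fun k hk => Function.update_of_ne hk _ _
  have hsT : r⁻¹ * t * r ∈ T := by simpa using hT.conj_mem r⁻¹ ht
  have h1 := hT.absLength_le_one hsT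
  have h2 := hT.absLength_mul_le (δ i.succ) (r⁻¹ * t * r)
  have herase : ∑ k ∈ Finset.univ.erase i, absLength S (τ' k) =
      ∑ k ∈ Finset.univ.erase i, absLength S (δ k.succ) :=
    Finset.sum_congr rfl fun k hk' => by rw [hk k (Finset.ne_of_mem_erase hk')]
  have hsum : ∑ k, absLength S (τ' k) = absLength S (δ i.succ * (r⁻¹ * t * r)) +
      ∑ k ∈ Finset.univ.erase i, absLength S (δ k.succ) := by
    rw [← Finset.add_sum_erase _ _ (Finset.mem_univ i), hi, herase]
  have hprod : (List.ofFn (Fin.cons (δ 0 * t) τ' : Fin (d + 1) → G)).prod = c := by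
    rw [List.ofFn_succ, List.prod_cons]
    simp only [Fin.cons_zero, Fin.cons_succ]
    rw [hτ', hr, ← hp]
    have : r * (r⁻¹ * t * r) * r⁻¹ = t := by group
    rw [this, mul_assoc, ← mul_assoc t, hT.mul_self t ht, one_mul]
    rfl
  have hle := hT.absLength_prod_le (Fin.cons (δ 0 * t) τ' : Fin (d + 1) → G)
  rw [hprod, hc, Fin.sum_univ_succ] at hle
  simp only [Fin.cons_zero, Fin.cons_succ, hsum] at hle
  refine ⟨(hT.isMDivisibleNC_iff hc _).2 ⟨hprod, ?_⟩, fun k => ?_, ?_⟩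
  · rw [Fin.sum_univ_succ]
    simp only [Fin.cons_zero, Fin.cons_succ, hsum]
    omega
  · rw [Fin.cons_succ, absLe]
    by_cases hki : k = i
    · subst hki
      rw [hi, inv_mul_cancel_left]
      omega
    · rw [hk k hki, inv_mul_cancel, hT.absLength_one, add_zero]
  · rw [mDivRank, mDivRank]
    simp only [Fin.cons_succ, hsum]
    rw [← Finset.add_sum_erase _ (fun k : Fin d => absLength S (δ k.succ)) (Finset.mem_univ i)]
    omega

theorem exists_of_covers (hT : IsReflectionSet S T) {c : G} {n d : ℕ}
    {δ δ' : Fin (d + 1) → G} (hδ : IsMDivisibleNC S c n d δ) (h : MDivCovers S c n d δ δ')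
    {r : Fin d → G} (hr : ∀ i s, (List.ofFn (Function.update (Fin.tail δ) i (δ i.succ * s))).prod =
      r i * s * (r i)⁻¹ * (List.ofFn (Fin.tail δ)).prod) :
    ∃ i, ∃ t ∈ T, δ' = Fin.cons (δ 0 * t)
      (Function.update (Fin.tail δ) i (δ i.succ * ((r i)⁻¹ * t * r i))) := by
  obtain ⟨⟨-, hp', -⟩, hle, hrk⟩ := h
  have hp := hδ.2.1
  have hsum : ∑ i : Fin d, absLength S ((δ i.succ)⁻¹ * δ' i.succ) = 1 := by
    rw [mDivRank, mDivRank, ← Finset.sum_congr rfl fun i _ => hle i,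
      Finset.sum_add_distrib] at hrk
    omega
  obtain ⟨i, -, hi⟩ := Finset.exists_ne_zero_of_sum_ne_zero (by rw [hsum]; exact one_ne_zero)
  rw [← Finset.add_sum_erase _ _ (Finset.mem_univ i)] at hsum
  have hi1 : absLength S ((δ i.succ)⁻¹ * δ' i.succ) = 1 := by omega
  have hrest : ∑ k ∈ Finset.univ.erase i, absLength S ((δ k.succ)⁻¹ * δ' k.succ) = 0 := by omega
  have hs := hT.mem_of_absLength hi1
  have htail : Fin.tail δ' =
      Function.update (Fin.tail δ) i (δ i.succ * ((δ i.succ)⁻¹ * δ' i.succ)) := by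
    funext k
    by_cases hk : k = i
    · subst hk
      rw [Function.update_self, mul_inv_cancel_left]
      rfl
    · rw [Function.update_of_ne hk]
      have := (Finset.sum_eq_zero_iff.1 hrest) k (Finset.mem_erase.2 ⟨hk, Finset.mem_univ k⟩)
      exact (inv_mul_eq_one.1 (hT.eq_one_of_absLength this)).symm
  set s := (δ i.succ)⁻¹ * δ' i.succ with hsdef
  have ht := hT.conj_mem (r i) hs
  refine ⟨i, r i * s * (r i)⁻¹, ht, ?_⟩
  have h1 : (r i)⁻¹ * (r i * s * (r i)⁻¹) * r i = s := by group
  rw [h1, ← htail, ← Fin.cons_self_tail δ', Fin.tail_cons]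
  congr 1
  rw [List.ofFn_succ, List.prod_cons] at hp hp'
  have h2 : (List.ofFn (Fin.tail δ')).prod =
      r i * s * (r i)⁻¹ * (List.ofFn (Fin.tail δ)).prod := by rw [htail, hr]
  change δ' 0 * (List.ofFn (Fin.tail δ')).prod = c at hp'
  change δ 0 * (List.ofFn (Fin.tail δ)).prod = c at hp
  rw [h2, ← hp, ← mul_assoc] at hp'
  rw [← mul_right_cancel hp', mul_assoc, hT.mul_self _ ht, mul_one]

theorem walkCount_covers (hT : IsReflectionSet S T) [Fintype G] [DecidableEq G] {c : G} {n d : ℕ}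
    (hc : absLength S c = n) (h1 : (1 : G) ∉ T) (j : ℕ) {δ : Fin (d + 1) → G}
    (hδ : IsMDivisibleNC S c n d δ) (h0 : absLength S (δ 0) = j) :
    walkCount (MDivCovers S c n d) j δ = d ^ j * factCount T j (δ 0) := by
  classical
  induction j generalizing δ with
  | zero => simp [walkCount, factCount, hT.eq_one_of_absLength h0]
  | succ j ih =>
    have hrk : ∀ δ' : Fin (d + 1) → G, IsMDivisibleNC S c n d δ' →
        absLength S (δ' 0) + mDivRank S δ' = n := fun δ' h => by
      rw [← h.2.2, Fin.sum_univ_succ, mDivRank]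
    have hcov : ∀ δ', MDivCovers S c n d δ δ' → absLength S (δ' 0) = j := fun δ' h => by
      have h2 := hrk δ hδ
      have h3 := hrk δ' h.1
      have h4 := h.2.2
      omega
    choose r hr using exists_prod_update (Fin.tail δ)
    change ∀ i s, (List.ofFn (Function.update (Fin.tail δ) i (δ i.succ * s))).prod =
      r i * s * (r i)⁻¹ * (List.ofFn (Fin.tail δ)).prod at hr
    have hsub : ∑ t ∈ T with absLength S (δ 0 * t) ≤ j, factCount T j (δ 0 * t) =
        ∑ t ∈ T, factCount T j (δ 0 * t) :=
      Finset.sum_filter_of_ne fun t _ h => hT.absLength_le_of_factCount h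
    rw [walkCount, factCount, ← hsub, pow_succ', mul_assoc, Finset.mul_sum]
    have hprod : ∑ x ∈ (Finset.univ : Finset (Fin d)) ×ˢ
        T.filter fun t => absLength S (δ 0 * t) ≤ j, d ^ j * factCount T j (δ 0 * x.2) =
        d * ∑ t ∈ T with absLength S (δ 0 * t) ≤ j, d ^ j * factCount T j (δ 0 * t) := by
      rw [Finset.sum_product]
      simp
    rw [← hprod]
    symm
    refine Finset.sum_bij (fun x _ => Fin.cons (δ 0 * x.2)
      (Function.update (Fin.tail δ) x.1 (δ x.1.succ * ((r x.1)⁻¹ * x.2 * r x.1))))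
      ?_ ?_ ?_ ?_
    · rintro ⟨i, t⟩ hx
      simp only [Finset.mem_product, Finset.mem_filter, Finset.mem_univ, true_and] at hx ⊢
      exact hT.covers_cons hc hδ h0 hx.1 hx.2 i (hr i)
    · rintro ⟨i, t⟩ hx ⟨i', t'⟩ hx' h
      simp only [Finset.mem_product, Finset.mem_filter, Finset.mem_univ, true_and] at hx hx'
      obtain ⟨h2, h3⟩ := Fin.cons_injective2 h
      obtain rfl : t = t' := mul_left_cancel h2
      have : i = i' := by
        by_contra hii
        have h4 := congrFun h3 i
        rw [Function.update_self, Function.update_of_ne hii] at h4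
        change δ i.succ * ((r i)⁻¹ * t * r i) = δ i.succ at h4
        have h5 : t = r i * ((r i)⁻¹ * t * r i) * (r i)⁻¹ := by group
        rw [mul_eq_left.1 h4] at h5
        exact h1 (by simpa [h5] using hx.1)
      rw [this]
    · intro δ' hδ'
      simp only [Finset.mem_filter, Finset.mem_univ, true_and] at hδ'
      obtain ⟨i, t, ht, rfl⟩ := hT.exists_of_covers hδ hδ' hr
      refine ⟨(i, t), ?_, rfl⟩
      simp only [Finset.mem_product, Finset.mem_filter, Finset.mem_univ, true_and]
      exact ⟨ht, (hcov _ hδ').le⟩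
    · rintro ⟨i, t⟩ hx
      simp only [Finset.mem_product, Finset.mem_filter, Finset.mem_univ, true_and] at hx
      have h2 := hT.covers_cons hc hδ h0 hx.1 hx.2 i (hr i)
      rw [ih h2.1 (hcov _ h2)]
      rfl

theorem mDivMaxChainCount_eq (hT : IsReflectionSet S T) [Fintype G] [DecidableEq G] {c : G} {n : ℕ}
    (d : ℕ) (hc : absLength S c = n) (h1 : (1 : G) ∉ T) :
    mDivMaxChainCount S c n d = d ^ n * factCount T n c := by
  let δ₀ : Fin (d + 1) → G := Fin.cons c fun _ => 1
  have hδ₀ : IsMDivisibleNC S c n d δ₀ := by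
    refine (hT.isMDivisibleNC_iff hc _).2 ⟨?_, ?_⟩
    · simp [δ₀, List.ofFn_succ]
    · simp [δ₀, Fin.sum_univ_succ, hT.absLength_one, hc]
  have hrk₀ : mDivRank S δ₀ = 0 := by simp [mDivRank, δ₀, hT.absLength_one]
  have key := hT.walkCount_covers hc h1 n hδ₀ hc
  change _ = d ^ n * factCount T n c at key
  rw [← key, ← card_walks, mDivMaxChainCount]
  refine Nat.card_congr (Equiv.subtypeEquivRight fun x => ?_)
  constructor
  · rintro ⟨hv, hle, hrk⟩
    refine ⟨?_, fun t => ⟨hv _, hle t, by rw [hrk, hrk]; simp⟩⟩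
    have h2 : ∀ i : Fin d, x 0 i.succ = 1 := fun i =>
      hT.eq_one_of_absLength ((Finset.sum_eq_zero_iff.1 (hrk 0)) i (Finset.mem_univ i))
    have h3 := (hv 0).2.1
    rw [List.ofFn_succ, List.prod_cons] at h3
    funext i
    cases i using Fin.cases with
    | zero => simpa [h2, δ₀] using h3
    | succ i => rw [h2]; rfl
  · rintro ⟨hx, hstep⟩
    refine ⟨fun t => ?_, fun t => (hstep t).2.1, fun t => ?_⟩
    · cases t using Fin.cases with
      | zero => rw [hx]; exact hδ₀
      | succ t => exact (hstep t).1
    · induction t using Fin.induction with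
      | zero => rw [hx, hrk₀]; rfl
      | succ t ih => rw [(hstep t).2.2, ih]; simp

end IsReflectionSet

end MaximalChains

/-- **Theorem (maximal chains of `m`-divisible noncrossing partitions).**
If `(W,S)` is a finite irreducible Coxeter system of rank `n` with Coxeter number `h` and
`m ≥ 1`, then `MC^{(m)}(W) = n!·(m·h)ⁿ/|W|`, i.e. `|W| · MC^{(m)}(W) = n! · (m·h)ⁿ`. -/
theorem mdiv_max_chain_formula
    {B : Type} [Fintype B] {W : Type} [Group W] [Fintype W]
    {M : CoxeterMatrix B} (cs : CoxeterSystem M W)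
    (hirr : IsIrreducibleCS cs)
    (c : W) (hc : IsCoxeterElementOf (simpleSet cs) c)
    (h : ℕ) (hh : h = orderOf c)
    (m : ℕ) (hm : 1 ≤ m) :
    Fintype.card W * mDivMaxChainCount (simpleSet cs) c (Fintype.card B) m =
      Nat.factorial (Fintype.card B) * (m * h) ^ (Fintype.card B) := by
  classical
  obtain ⟨T, hmem, hlen, hcount⟩ := card_mul_factCount_coxeterElement cs hirr hc
  have hsimple : ∀ b, cs.simple b ∈ T := fun b =>
    (hmem _).2 ⟨1, cs.simple b, ⟨b, rfl⟩, by simp⟩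
  have hT : IsReflectionSet (simpleSet cs) T := by
    refine ⟨hmem, fun g => ?_, fun t ht => ?_⟩
    · obtain ⟨ω, rfl⟩ := cs.wordProd_surjective g
      refine ⟨ω.map cs.simple, fun t ht => ?_, rfl⟩
      obtain ⟨b, -, rfl⟩ := List.mem_map.1 ht
      exact hsimple b
    · obtain ⟨g, s, ⟨b, rfl⟩, rfl⟩ := (hmem t).1 ht
      have : g * cs.simple b * g⁻¹ * (g * cs.simple b * g⁻¹) =
          g * (cs.simple b * cs.simple b) * g⁻¹ := by group
      rw [this, cs.simple_mul_simple_self]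
      simp
  have h1 : (1 : W) ∉ T := by
    intro h1
    obtain ⟨g, s, ⟨b, rfl⟩, h2⟩ := (hmem 1).1 h1
    have h3 : cs.simple b = 1 := by
      have : cs.simple b = g⁻¹ * (g * cs.simple b * g⁻¹) * g := by group
      rw [this, ← h2]
      simp
    have h4 := cs.length_simple b
    rw [h3, cs.length_one] at h4
    exact zero_ne_one h4
  have hcn : absLength (simpleSet cs) c = Fintype.card B := by
    obtain ⟨l, hl, hll, hlp⟩ := hT.exists_list_length c
    refine le_antisymm ?_ (hll ▸ hlen l hl hlp)
    obtain ⟨k, hk, hkmem, rfl⟩ := hc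
    refine (hT.absLength_le fun t ht => ?_).trans ?_
    · obtain ⟨b, rfl⟩ := (hkmem t).1 ht
      exact hsimple b
    · rw [← List.toFinset_card_of_nodup hk]
      have : k.toFinset ⊆ Finset.univ.image cs.simple := by
        intro x hx
        obtain ⟨b, rfl⟩ := (hkmem x).1 (List.mem_toFinset.1 hx)
        exact Finset.mem_image_of_mem _ (Finset.mem_univ b)
      exact (Finset.card_le_card this).trans Finset.card_image_le
  rw [hT.mDivMaxChainCount_eq m hcn h1, mul_left_comm, hcount, hh, mul_pow]
  ring
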